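/- Let 2/3 < γ < 2. Every generic Bianchi type IX solution of the Wainwright–Hsu system has at least three distinct non-special α-limit points on the Kasner circle; moreover none of the functions N₁, N₂, N₃ converges to zero as τ → −∞. -/

import Mathlib

open Real Filter Topology Set

noncomputable section

namespace WainwrightHsu

/-- The deceleration parameter `q` of the Wainwright–Hsu system. -/
def qf (γ O Sp Sm : ℝ) : ℝ := (1/2) * (3*γ - 2) * O + 2 * (Sp^2 + Sm^2)

/-- The curvature term `S₊`. -/
def SPf (n1 n2 n3 : ℝ) : ℝ := (1/2) * ((n2 - n3)^2 - n1 * (2*n1 - n2 - n3))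

/-- The curvature term `S₋`. -/
def SMf (n1 n2 n3 : ℝ) : ℝ := (Real.sqrt 3 / 2) * (n3 - n2) * (n1 - n2 - n3)

/-- The Hamiltonian constraint. -/
def Constraint (O Sp Sm n1 n2 n3 : ℝ) : Prop :=
  O + Sp^2 + Sm^2 + (3/4) * (n1^2 + n2^2 + n3^2 - 2*(n1*n2 + n2*n3 + n3*n1)) = 1

/-- `(O, Sp, Sm, n1, n2, n3)` is a solution of the Wainwright–Hsu system (with
parameter `γ`) on the set `s ⊆ ℝ`, satisfying `Ω ≥ 0` and the constraint. -/
structure SolOn (γ : ℝ) (s : Set ℝ) (O Sp Sm n1 n2 n3 : ℝ → ℝ) : Prop where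
  hn1 : ∀ τ ∈ s, HasDerivAt n1 ((qf γ (O τ) (Sp τ) (Sm τ) - 4 * Sp τ) * n1 τ) τ
  hn2 : ∀ τ ∈ s, HasDerivAt n2
    ((qf γ (O τ) (Sp τ) (Sm τ) + 2 * Sp τ + 2 * Real.sqrt 3 * Sm τ) * n2 τ) τ
  hn3 : ∀ τ ∈ s, HasDerivAt n3
    ((qf γ (O τ) (Sp τ) (Sm τ) + 2 * Sp τ - 2 * Real.sqrt 3 * Sm τ) * n3 τ) τ
  hSp : ∀ τ ∈ s, HasDerivAt Sp
    (-(2 - qf γ (O τ) (Sp τ) (Sm τ)) * Sp τ - 3 * SPf (n1 τ) (n2 τ) (n3 τ)) τ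
  hSm : ∀ τ ∈ s, HasDerivAt Sm
    (-(2 - qf γ (O τ) (Sp τ) (Sm τ)) * Sm τ - 3 * SMf (n1 τ) (n2 τ) (n3 τ)) τ
  hO : ∀ τ ∈ s, HasDerivAt O ((2 * qf γ (O τ) (Sp τ) (Sm τ) - (3*γ - 2)) * O τ) τ
  hOnn : ∀ τ ∈ s, 0 ≤ O τ
  hcon : ∀ τ ∈ s, Constraint (O τ) (Sp τ) (Sm τ) (n1 τ) (n2 τ) (n3 τ)

/-- The solution is of Taub type. -/
def TaubType (s : Set ℝ) (Sp Sm n1 n2 n3 : ℝ → ℝ) : Prop :=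
  (∀ τ ∈ s, Sm τ = 0 ∧ n2 τ = n3 τ) ∨
  (∀ τ ∈ s, Sm τ = -(Real.sqrt 3) * Sp τ ∧ n1 τ = n2 τ) ∨
  (∀ τ ∈ s, Sm τ = Real.sqrt 3 * Sp τ ∧ n3 τ = n1 τ)

/-- The solution converges to the fixed point `F` as `τ → -∞`. -/
def TendstoF (O Sp Sm n1 n2 n3 : ℝ → ℝ) : Prop :=
  Tendsto O atBot (𝓝 1) ∧ Tendsto Sp atBot (𝓝 0) ∧ Tendsto Sm atBot (𝓝 0) ∧
  Tendsto n1 atBot (𝓝 0) ∧ Tendsto n2 atBot (𝓝 0) ∧ Tendsto n3 atBot (𝓝 0)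

/-- The solution converges to the fixed point `P₁⁺(II)` as `τ → -∞`. -/
def TendstoP1 (γ : ℝ) (O Sp Sm n1 n2 n3 : ℝ → ℝ) : Prop :=
  Tendsto O atBot (𝓝 (1 - (3*γ - 2)/16)) ∧
  Tendsto Sp atBot (𝓝 ((3*γ - 2)/8)) ∧ Tendsto Sm atBot (𝓝 0) ∧
  (∃ c : ℝ, 0 < c ∧ Tendsto n1 atBot (𝓝 c)) ∧
  Tendsto n2 atBot (𝓝 0) ∧ Tendsto n3 atBot (𝓝 0)

/-- The solution converges to the fixed point `P₂⁺(II)` as `τ → -∞`. -/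
def TendstoP2 (γ : ℝ) (O Sp Sm n1 n2 n3 : ℝ → ℝ) : Prop :=
  Tendsto O atBot (𝓝 (1 - (3*γ - 2)/16)) ∧
  Tendsto Sp atBot (𝓝 (-((3*γ - 2)/16))) ∧
  Tendsto Sm atBot (𝓝 (-(Real.sqrt 3 * (3*γ - 2)/16))) ∧
  Tendsto n1 atBot (𝓝 0) ∧
  (∃ c : ℝ, 0 < c ∧ Tendsto n2 atBot (𝓝 c)) ∧ Tendsto n3 atBot (𝓝 0)

/-- The solution converges to the fixed point `P₃⁺(II)` as `τ → -∞`. -/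
def TendstoP3 (γ : ℝ) (O Sp Sm n1 n2 n3 : ℝ → ℝ) : Prop :=
  Tendsto O atBot (𝓝 (1 - (3*γ - 2)/16)) ∧
  Tendsto Sp atBot (𝓝 (-((3*γ - 2)/16))) ∧
  Tendsto Sm atBot (𝓝 (Real.sqrt 3 * (3*γ - 2)/16)) ∧
  Tendsto n1 atBot (𝓝 0) ∧ Tendsto n2 atBot (𝓝 0) ∧
  (∃ c : ℝ, 0 < c ∧ Tendsto n3 atBot (𝓝 c))

/-- A Bianchi IX solution is generic if it is not of Taub type and does not
converge to `F` nor to any of the `Pᵢ⁺(II)` as `τ → -∞`. -/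
def Generic (γ : ℝ) (s : Set ℝ) (O Sp Sm n1 n2 n3 : ℝ → ℝ) : Prop :=
  ¬ TaubType s Sp Sm n1 n2 n3 ∧ ¬ TendstoF O Sp Sm n1 n2 n3 ∧
  ¬ TendstoP1 γ O Sp Sm n1 n2 n3 ∧ ¬ TendstoP2 γ O Sp Sm n1 n2 n3 ∧
  ¬ TendstoP3 γ O Sp Sm n1 n2 n3

/-- `(a, b, c, d, e, f)` is an α-limit point of the solution:
some sequence of times tending to `-∞` along which the solution converges to it. -/
def AlphaLim (O Sp Sm n1 n2 n3 : ℝ → ℝ) (a b c d e f : ℝ) : Prop :=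
  ∃ τs : ℕ → ℝ, Tendsto τs atTop atBot ∧
    Tendsto (fun k => O (τs k)) atTop (𝓝 a) ∧
    Tendsto (fun k => Sp (τs k)) atTop (𝓝 b) ∧
    Tendsto (fun k => Sm (τs k)) atTop (𝓝 c) ∧
    Tendsto (fun k => n1 (τs k)) atTop (𝓝 d) ∧
    Tendsto (fun k => n2 (τs k)) atTop (𝓝 e) ∧
    Tendsto (fun k => n3 (τs k)) atTop (𝓝 f)

/-- ω-limit point (times tending to `+∞`). -/
def OmegaLim (O Sp Sm n1 n2 n3 : ℝ → ℝ) (a b c d e f : ℝ) : Prop :=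
  ∃ τs : ℕ → ℝ, Tendsto τs atTop atTop ∧
    Tendsto (fun k => O (τs k)) atTop (𝓝 a) ∧
    Tendsto (fun k => Sp (τs k)) atTop (𝓝 b) ∧
    Tendsto (fun k => Sm (τs k)) atTop (𝓝 c) ∧
    Tendsto (fun k => n1 (τs k)) atTop (𝓝 d) ∧
    Tendsto (fun k => n2 (τs k)) atTop (𝓝 e) ∧
    Tendsto (fun k => n3 (τs k)) atTop (𝓝 f)

/-- α-limit point, phrased for a point of `ℝ⁶` (in coordinates `Ω, Σ₊, Σ₋, N₁, N₂, N₃`). -/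
def AlphaLimPt (O Sp Sm n1 n2 n3 : ℝ → ℝ) (p : Fin 6 → ℝ) : Prop :=
  ∃ τs : ℕ → ℝ, Tendsto τs atTop atBot ∧
    Tendsto (fun k =>
      (![O (τs k), Sp (τs k), Sm (τs k), n1 (τs k), n2 (τs k), n3 (τs k)] : Fin 6 → ℝ))
      atTop (𝓝 p)

/-- A non-special point of the Kasner circle, given by its `(Σ₊, Σ₋)` coordinates. -/
def NonSpecialKasner (a b : ℝ) : Prop :=
  a^2 + b^2 = 1 ∧ (a, b) ≠ (-1, 0) ∧
  (a, b) ≠ (1/2, Real.sqrt 3 / 2) ∧ (a, b) ≠ (1/2, -(Real.sqrt 3) / 2)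

/-- The state vector of a solution, as a point of Euclidean `ℝ⁶`. -/
def stateVec (O Sp Sm n1 n2 n3 : ℝ → ℝ) (τ : ℝ) : EuclideanSpace ℝ (Fin 6) :=
  (WithLp.equiv 2 (Fin 6 → ℝ)).symm ![O τ, Sp τ, Sm τ, n1 τ, n2 τ, n3 τ]

/-- The Bianchi attractor `𝒜`: the closure of the vacuum type I and II points, i.e. the
points of `ℝ⁶` satisfying the constraint with `Ω = 0` and `N₁N₂ = N₂N₃ = N₃N₁ = 0`. -/
def attractor : Set (EuclideanSpace ℝ (Fin 6)) :=
  {y | Constraint (y 0) (y 1) (y 2) (y 3) (y 4) (y 5) ∧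
    y 0 = 0 ∧ y 3 * y 4 = 0 ∧ y 4 * y 5 = 0 ∧ y 5 * y 3 = 0}


/-! ### Scalar tools -/

/-- A fixed free ultrafilter on `ℕ`. -/
abbrev UF : Filter ℕ := (hyperfilter ℕ : Filter ℕ)

lemma mono_of_hasDeriv {S : Set ℝ} (hS : Convex ℝ S) {f f' : ℝ → ℝ}
    (hf : ∀ t ∈ S, HasDerivAt f (f' t) t) (h : ∀ t ∈ S, 0 ≤ f' t) : MonotoneOn f S := by
  apply monotoneOn_of_deriv_nonneg hS
  · exact fun t ht => (hf t ht).continuousAt.continuousWithinAt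
  · exact fun t ht => (hf t (interior_subset ht)).differentiableAt.differentiableWithinAt
  · intro t ht
    rw [(hf t (interior_subset ht)).deriv]
    exact h t (interior_subset ht)

lemma anti_of_hasDeriv {S : Set ℝ} (hS : Convex ℝ S) {f f' : ℝ → ℝ}
    (hf : ∀ t ∈ S, HasDerivAt f (f' t) t) (h : ∀ t ∈ S, f' t ≤ 0) : AntitoneOn f S := by
  have := mono_of_hasDeriv hS (f := fun t => - f t) (f' := fun t => - f' t)
    (fun t ht => (hf t ht).neg) (fun t ht => by have := h t ht; linarith)
  intro a ha b hb hab
  have := this ha hb hab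
  simp only at this
  linarith

lemma hasDeriv_mul_exp {f : ℝ → ℝ} {d t : ℝ} (c : ℝ) (hf : HasDerivAt f d t) :
    HasDerivAt (fun t => f t * Real.exp (c * t)) ((d + c * f t) * Real.exp (c * t)) t := by
  have h1 : HasDerivAt (fun t : ℝ => Real.exp (c * t)) (Real.exp (c * t) * (c * 1)) t :=
    ((hasDerivAt_id t).const_mul c).exp
  exact (hf.mul h1).congr_deriv (by ring)

/-- A nonnegative function with `|f'| ≤ C f` that vanishes somewhere vanishes everywhere. -/
lemma zero_persist {S : Set ℝ} (hS : Convex ℝ S) {f f' : ℝ → ℝ} {C : ℝ}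
    (hf : ∀ t ∈ S, HasDerivAt f (f' t) t) (h0 : ∀ t ∈ S, 0 ≤ f t)
    (hC : ∀ t ∈ S, |f' t| ≤ C * f t) {t₀ : ℝ} (ht₀ : t₀ ∈ S) (hz : f t₀ = 0) :
    ∀ t ∈ S, f t = 0 := by
  have h1 := anti_of_hasDeriv hS (fun t ht => hasDeriv_mul_exp (-C) (hf t ht)) (by
    intro t ht
    have := abs_le.1 (hC t ht)
    apply mul_nonpos_of_nonpos_of_nonneg _ (Real.exp_pos _).le
    linarith)
  have h2 := mono_of_hasDeriv hS (fun t ht => hasDeriv_mul_exp C (hf t ht)) (by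
    intro t ht
    have := abs_le.1 (hC t ht)
    apply mul_nonneg _ (Real.exp_pos _).le
    linarith)
  intro t ht
  apply le_antisymm _ (h0 t ht)
  rcases le_total t₀ t with h | h
  · have := h1 ht₀ ht h
    simp only [hz, zero_mul] at this
    exact nonpos_of_mul_nonpos_left this (Real.exp_pos _)
  · have := h2 ht ht₀ h
    simp only [hz, zero_mul] at this
    exact nonpos_of_mul_nonpos_left this (Real.exp_pos _)

/-- Linear version of `zero_persist` with sign-free `f`. -/
lemma zero_persist_lin {S : Set ℝ} (hS : Convex ℝ S) {f g : ℝ → ℝ} {C : ℝ}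
    (hf : ∀ t ∈ S, HasDerivAt f (g t * f t) t)
    (hC : ∀ t ∈ S, |g t| ≤ C) {t₀ : ℝ} (ht₀ : t₀ ∈ S) (hz : f t₀ = 0) :
    ∀ t ∈ S, f t = 0 := by
  have := zero_persist hS (f := fun t => f t ^ 2) (f' := fun t => 2 * g t * f t ^ 2) (C := 2 * C)
    (fun t ht => by
      exact ((hf t ht).fun_pow 2).congr_deriv (by push_cast; ring)) (fun t _ => sq_nonneg _)
    (fun t ht => by
      rw [abs_mul, abs_mul, abs_of_nonneg (sq_nonneg (f t))]
      simp only [abs_two]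
      have := hC t ht
      have h3 := sq_nonneg (f t)
      nlinarith) ht₀ (by simp [hz])
  intro t ht
  exact pow_eq_zero_iff (two_ne_zero) |>.1 (this t ht)

/-- exponential forward growth contradicts boundedness -/
lemma growth_zero {f f' : ℝ → ℝ} {lam M : ℝ} (hl : 0 < lam)
    (hf : ∀ t ∈ Ici (0:ℝ), HasDerivAt f (f' t) t) (h0 : ∀ t ∈ Ici (0:ℝ), 0 ≤ f t)
    (hg : ∀ t ∈ Ici (0:ℝ), lam * f t ≤ f' t) (hM : ∀ t ∈ Ici (0:ℝ), f t ≤ M) :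
    f 0 = 0 := by
  have h2 := mono_of_hasDeriv (convex_Ici 0) (fun t ht => hasDeriv_mul_exp (-lam) (hf t ht)) (by
    intro t ht
    apply mul_nonneg _ (Real.exp_pos _).le
    have := hg t ht
    linarith)
  have h00 : (0:ℝ) ∈ Ici (0:ℝ) := le_refl (0:ℝ)
  apply le_antisymm _ (h0 0 h00)
  by_contra hpos
  push Not at hpos
  have hlim : Tendsto (fun t : ℝ => M * Real.exp (-lam * t)) atTop (𝓝 (M * 0)) := by
    apply Tendsto.const_mul
    apply Real.tendsto_exp_atBot.comp
    exact tendsto_id.const_mul_atTop_of_neg (by linarith)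
  rw [mul_zero] at hlim
  have : f 0 ≤ 0 := by
    refine ge_of_tendsto hlim ?_
    filter_upwards [eventually_ge_atTop (0:ℝ)] with t ht
    have h3 := h2 h00 ht ht
    simp only [mul_zero, Real.exp_zero, mul_one] at h3
    have := hM t ht
    have h4 := Real.exp_pos (-lam * t)
    nlinarith
  linarith

/-- first hitting, from the left -/
lemma hit_left {G : ℝ → ℝ} {τ₀ t ε : ℝ} (h : τ₀ ≤ t) (hG : ContinuousOn G (Icc τ₀ t))
    (h0 : ε ≤ G τ₀) (h1 : G t < ε) :
    ∃ σ ∈ Icc τ₀ t, G σ = ε ∧ ∀ τ ∈ Icc σ t, G τ ≤ ε := by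
  have hc : IsCompact (Icc τ₀ t ∩ G ⁻¹' Ici ε) :=
    isCompact_Icc.of_isClosed_subset (hG.preimage_isClosed_of_isClosed isClosed_Icc isClosed_Ici)
      inter_subset_left
  obtain ⟨σ, hσ⟩ := hc.exists_isGreatest ⟨τ₀, ⟨le_rfl, h⟩, h0⟩
  have hσ1 := hσ.1.1
  have hlt : ∀ τ ∈ Ioc σ t, G τ < ε := by
    intro τ hτ
    by_contra hcon
    push Not at hcon
    have := hσ.2 ⟨⟨hσ1.1.trans hτ.1.le, hτ.2⟩, hcon⟩
    linarith [hτ.1]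
  have hst : σ < t := by
    rcases lt_or_eq_of_le hσ1.2 with h | h
    · exact h
    · have := hσ.1.2
      rw [h] at this
      simp only [mem_preimage, mem_Ici] at this
      linarith
  have hle : G σ ≤ ε := by
    have hcw : ContinuousWithinAt G (Ioc σ t) σ :=
      (hG σ hσ1).mono (fun τ hτ => ⟨hσ1.1.trans hτ.1.le, hτ.2⟩)
    have hne : (𝓝[Ioc σ t] σ).NeBot := by
      rw [nhdsWithin_Ioc_eq_nhdsGT hst]; infer_instance
    refine le_of_tendsto hcw ?_
    filter_upwards [self_mem_nhdsWithin] with τ hτ using (hlt τ hτ).le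
  refine ⟨σ, hσ1, le_antisymm hle hσ.1.2, ?_⟩
  intro τ hτ
  rcases lt_or_eq_of_le hτ.1 with h | h
  · exact (hlt τ ⟨h, hτ.2⟩).le
  · rw [← h]; exact hle

lemma hit_right {G : ℝ → ℝ} {τ₀ t ε : ℝ} (h : t ≤ τ₀) (hG : ContinuousOn G (Icc t τ₀))
    (h0 : ε ≤ G τ₀) (h1 : G t < ε) :
    ∃ σ ∈ Icc t τ₀, G σ = ε ∧ ∀ τ ∈ Icc t σ, G τ ≤ ε := by
  obtain ⟨σ, hσ, h2, h3⟩ := hit_left (G := fun s => G (-s)) (τ₀ := -τ₀) (t := -t) (ε := ε)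
    (by linarith) (by
      apply hG.comp continuous_neg.continuousOn
      intro s hs
      exact ⟨by linarith [hs.2], by linarith [hs.1]⟩) (by simpa using h0) (by simpa using h1)
  refine ⟨-σ, ⟨by linarith [hσ.2], by linarith [hσ.1]⟩, h2, ?_⟩
  intro τ hτ
  have := h3 (-τ) ⟨by linarith [hτ.2], by linarith [hτ.1]⟩
  simpa using this

/-! ### Limit solutions along the ultrafilter -/

section Limits
variable {E : Type*} [NormedAddCommGroup E] [NormedSpace ℝ E] [ProperSpace E]

/-- `Z` is the limit solution of `X` along the time sequence `t`. -/
def LimAlong (X : ℝ → E) (t : ℕ → ℝ) (Z : ℝ → E) : Prop :=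
  ∀ s, Tendsto (fun n => X (t n + s)) UF (𝓝 (Z s))

lemma uf_limit {u : ℕ → E} {M : ℝ} (h : ∀ᶠ n in UF, ‖u n‖ ≤ M) :
    ∃ z, Tendsto u UF (𝓝 z) := by
  have hc := isCompact_closedBall (0:E) M
  have : ((hyperfilter ℕ).map u : Filter E) ≤ 𝓟 (Metric.closedBall 0 M) := by
    rw [le_principal_iff]
    change u ⁻¹' _ ∈ UF
    filter_upwards [h] with n hn
    simpa using hn
  obtain ⟨z, -, hz⟩ := hc.ultrafilter_le_nhds _ this
  exact ⟨z, hz⟩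

lemma bounds_of_contDiff {f : E → E} (hf : ContDiff ℝ 1 f) (M : ℝ) :
    ∃ K B : ℝ, 0 ≤ K ∧ 0 ≤ B ∧ (∀ x y : E, ‖x‖ ≤ M → ‖y‖ ≤ M → ‖f x - f y‖ ≤ K * ‖x - y‖) ∧
      ∀ x : E, ‖x‖ ≤ M → ‖f x‖ ≤ B := by
  obtain ⟨K, hK⟩ := hf.contDiffOn.exists_lipschitzOnWith (s := Metric.closedBall (0:E) M)
    (by norm_num) (convex_closedBall _ _) (isCompact_closedBall _ _)
  obtain ⟨B, hB⟩ := (isCompact_closedBall (0:E) M).exists_bound_of_continuousOn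
    hf.continuous.continuousOn
  refine ⟨K, max B 0, K.2, le_max_right _ _, ?_, ?_⟩
  · intro x y hx hy
    have := hK.dist_le_mul x (by simpa using hx) y (by simpa using hy)
    simpa [dist_eq_norm] using this
  · intro x hx
    exact (hB x (by simpa using hx)).trans (le_max_left _ _)

variable {f : E → E} {S : Set ℝ} {X : ℝ → E} {M : ℝ}

lemma lip_of_bound (hS : S.OrdConnected) (hX : ∀ τ ∈ S, HasDerivAt X (f (X τ)) τ)
    {B : ℝ} (hB : ∀ τ ∈ S, ‖f (X τ)‖ ≤ B) {a b : ℝ} (ha : a ∈ S) (hb : b ∈ S) :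
    ‖X b - X a‖ ≤ B * |b - a| := by
  have := Convex.norm_image_sub_le_of_norm_hasDerivWithin_le (s := S) (f := X)
    (f' := fun τ => f (X τ)) (C := B)
    (fun τ hτ => (hX τ hτ).hasDerivWithinAt) hB hS.convex ha hb
  simpa using this

lemma taylor_bound (hS : S.OrdConnected) (hX : ∀ τ ∈ S, HasDerivAt X (f (X τ)) τ)
    {K B : ℝ} (hK : 0 ≤ K) (hB0 : 0 ≤ B) (hB : ∀ τ ∈ S, ‖f (X τ)‖ ≤ B)
    (hL : ∀ a ∈ S, ∀ b ∈ S, ‖f (X a) - f (X b)‖ ≤ K * ‖X a - X b‖)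
    {a h : ℝ} (ha : a ∈ S) (hb : a + h ∈ S) :
    ‖X (a + h) - X a - h • f (X a)‖ ≤ K * B * h ^ 2 := by
  have hsub : uIcc a (a + h) ⊆ S := hS.uIcc_subset ha hb
  have := Convex.norm_image_sub_le_of_norm_hasDerivWithin_le (s := uIcc a (a + h))
    (f := fun τ => X τ - (τ - a) • f (X a))
    (f' := fun τ => f (X τ) - (1:ℝ) • f (X a)) (C := K * (B * |h|)) (x := a) (y := a + h)
    (fun τ hτ => by
      apply HasDerivAt.hasDerivWithinAt
      apply (hX τ (hsub hτ)).sub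
      exact ((hasDerivAt_id τ).sub_const a).smul_const _)
    (fun τ hτ => by
      rw [one_smul]
      refine (hL τ (hsub hτ) a ha).trans ?_
      apply mul_le_mul_of_nonneg_left _ hK
      refine (lip_of_bound hS hX hB ha (hsub hτ)).trans ?_
      apply mul_le_mul_of_nonneg_left _ hB0
      have := abs_sub_left_of_mem_uIcc hτ
      simpa using this) (convex_uIcc _ _) left_mem_uIcc right_mem_uIcc
  simp only [add_sub_cancel_left, sub_self, zero_smul, sub_zero, Real.norm_eq_abs] at this
  calc _ = ‖X (a + h) - h • f (X a) - X a‖ := by congr 1; abel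
    _ ≤ _ := this
    _ = _ := by rw [← sq_abs h]; ring

theorem exists_limit (hf : ContDiff ℝ 1 f) (hS : S.OrdConnected)
    (hX : ∀ τ ∈ S, HasDerivAt X (f (X τ)) τ) (hM : ∀ τ ∈ S, ‖X τ‖ ≤ M) {t : ℕ → ℝ}
    (ht : ∀ c, ∀ᶠ n in UF, t n + c ∈ S) :
    ∃ Z, LimAlong X t Z ∧ ∀ s, HasDerivAt Z (f (Z s)) s := by
  obtain ⟨K, B, hK, hB0, hKL, hB⟩ := bounds_of_contDiff hf M
  have hz : ∀ s, ∃ z, Tendsto (fun n => X (t n + s)) UF (𝓝 z) := fun s =>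
    uf_limit (M := M) (by filter_upwards [ht s] with n hn using hM _ hn)
  choose Z hZ using hz
  refine ⟨Z, hZ, ?_⟩
  intro s
  have key : ∀ h : ℝ, ‖Z (s + h) - Z s - h • f (Z s)‖ ≤ K * B * h ^ 2 := by
    intro h
    have hl : Tendsto (fun n => ‖X (t n + s + h) - X (t n + s) - h • f (X (t n + s))‖) UF
        (𝓝 ‖Z (s + h) - Z s - h • f (Z s)‖) := by
      apply Tendsto.norm
      apply Tendsto.sub
      · apply Tendsto.sub _ (hZ s)
        have := hZ (s + h)
        simpa [add_assoc] using this
      · apply Tendsto.const_smul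
        exact (hf.continuous.tendsto _).comp (hZ s)
    refine le_of_tendsto hl ?_
    filter_upwards [ht s, ht (s + h)] with n h1 h2
    apply taylor_bound hS hX hK hB0 (fun τ hτ => hB _ (hM τ hτ))
      (fun a ha b hb => hKL _ _ (hM a ha) (hM b hb)) h1
    simpa [add_assoc] using h2
  rw [hasDerivAt_iff_isLittleO_nhds_zero]
  have h1 : (fun h : ℝ => Z (s + h) - Z s - h • f (Z s)) =O[𝓝 0] fun h : ℝ => h ^ 2 := by
    apply Asymptotics.IsBigO.of_bound (K * B)
    filter_upwards with h
    refine (key h).trans_eq ?_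
    simp
  exact h1.trans_isLittleO (Asymptotics.isLittleO_pow_id (by norm_num))

/-- Uniqueness at an equilibrium. -/
lemma const_of_equilibrium (hf : ContDiff ℝ 1 f) {Y : ℝ → E}
    (hY : ∀ s, HasDerivAt Y (f (Y s)) s) (hM : ∀ s, ‖Y s‖ ≤ M) {v : E} (hv : f v = 0)
    (h0 : Y 0 = v) : ∀ s, Y s = v := by
  obtain ⟨K, hK⟩ := hf.contDiffOn.exists_lipschitzOnWith (s := Metric.closedBall (0:E) M)
    (by norm_num) (convex_closedBall _ _) (isCompact_closedBall _ _)
  have hvM : ‖v‖ ≤ M := h0 ▸ hM 0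
  have := ODE_solution_unique_univ (v := fun _ => f) (s := fun _ => Metric.closedBall (0:E) M)
    (K := K) (f := Y) (g := fun _ => v) (t₀ := 0) (fun _ => hK)
    (fun t => ⟨hY t, by simpa using hM t⟩)
    (fun t => ⟨by rw [hv]; exact hasDerivAt_const _ _, by simpa using hvM⟩) h0
  intro s
  rw [this]

lemma lim_shift (hS : S.OrdConnected) {B : ℝ} (hX : ∀ τ ∈ S, HasDerivAt X (f (X τ)) τ)
    (hB : ∀ τ ∈ S, ‖f (X τ)‖ ≤ B) {t : ℕ → ℝ} (ht : ∀ c, ∀ᶠ n in UF, t n + c ∈ S)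
    {Y : ℝ → E} (hY : LimAlong X t Y) {d : ℕ → ℝ} {d₀ : ℝ} (hd : Tendsto d UF (𝓝 d₀))
    (hdS : ∀ᶠ n in UF, t n + d n ∈ S) :
    Tendsto (fun n => X (t n + d n)) UF (𝓝 (Y d₀)) := by
  have h1 : Tendsto (fun n => X (t n + d n) - X (t n + d₀)) UF (𝓝 0) := by
    apply squeeze_zero_norm' (a := fun n => B * |d n - d₀|)
    · filter_upwards [hdS, ht d₀] with n h1 h2
      refine (lip_of_bound hS hX hB h2 h1).trans_eq ?_
      congr 2
      ring
    · have : Tendsto (fun n => B * |d n - d₀|) UF (𝓝 (B * |d₀ - d₀|)) :=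
        ((hd.sub_const d₀).abs).const_mul B
      simpa using this
  have := h1.add (hY d₀)
  simpa using this

/-- Exit lemma, both directions in time, for a solution on `Iic 0`. -/
theorem exit_back (hf : ContDiff ℝ 1 f) (hX : ∀ τ ∈ Iic (0:ℝ), HasDerivAt X (f (X τ)) τ)
    (hM : ∀ τ ∈ Iic (0:ℝ), ‖X τ‖ ≤ M) {g : E → ℝ} (hg : Continuous g) {ε : ℝ} {t : ℕ → ℝ}
    (ht : Tendsto t UF atBot) {Y : ℝ → E} (hY : LimAlong X t Y) (hYg : ∀ s, g (Y s) < ε)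
    (hfreq : ∃ᶠ τ in atBot, ε ≤ g (X τ)) :
    ∃ σ : ℕ → ℝ, Tendsto σ UF atBot ∧ (∀ᶠ n in UF, σ n ≤ t n ∧ g (X (σ n)) = ε ∧
      ∀ τ ∈ Icc (σ n) (t n), g (X τ) ≤ ε) ∧ Tendsto (fun n => t n - σ n) UF atTop := by
  obtain ⟨K, B, hK, hB0, hKL, hB⟩ := bounds_of_contDiff hf M
  have hex : ∀ n, ∃ σ, (t n ≤ 0 ∧ g (X (t n)) < ε) → (σ ≤ t n ∧ g (X σ) = ε ∧
      ∀ τ ∈ Icc σ (t n), g (X τ) ≤ ε) := by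
    intro n
    by_cases h : t n ≤ 0 ∧ g (X (t n)) < ε
    · obtain ⟨τ₀, h1, h2⟩ := (hfreq.and_eventually (eventually_le_atBot (t n))).exists
      obtain ⟨σ, h3, h4, h5⟩ := hit_left (G := fun τ => g (X τ)) h2 (by
        intro τ hτ
        exact (hg.continuousAt.comp (hX τ (hτ.2.trans h.1)).continuousAt).continuousWithinAt)
        h1 h.2
      exact ⟨σ, fun _ => ⟨h3.2, h4, h5⟩⟩
    · exact ⟨0, fun h' => absurd h' h⟩
  choose σ hσ using hex
  have hY0 : Tendsto (fun n => X (t n)) UF (𝓝 (Y 0)) := by simpa using hY 0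
  have hev : ∀ᶠ n in UF, t n ≤ 0 ∧ g (X (t n)) < ε :=
    (ht.eventually (eventually_le_atBot 0)).and
      (((hg.tendsto _).comp hY0).eventually (gt_mem_nhds (hYg 0)))
  have hev2 := hev.mono (fun n hn => hσ n hn)
  refine ⟨σ, ?_, hev2, ?_⟩
  · exact tendsto_atBot_mono' _ (hev2.mono fun n hn => hn.1) ht
  · rw [tendsto_atTop]
    intro T
    by_contra hcon
    have h1 : ∀ᶠ n in UF, ¬ (T ≤ t n - σ n) := Ultrafilter.eventually_not.2 hcon
    obtain ⟨d, hd⟩ := uf_limit (u := fun n => σ n - t n) (M := T) (by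
      filter_upwards [h1, hev2] with n h2 h3
      rw [Real.norm_eq_abs, abs_le]
      constructor <;> linarith [h3.1])
    have h2 := lim_shift (S := Iic 0) ordConnected_Iic hX (fun τ hτ => hB _ (hM τ hτ))
      (fun c => (tendsto_atBot_add_const_right _ c ht).eventually (eventually_le_atBot 0)) hY hd (by
        filter_upwards [hev2, hev] with n h3 h4
        simp only [mem_Iic, add_sub_cancel]
        exact h3.1.trans h4.1)
    simp only [add_sub_cancel] at h2
    have h3 : Tendsto (fun n => g (X (σ n))) UF (𝓝 (g (Y d))) := (hg.tendsto _).comp h2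
    have h4 : Tendsto (fun n => g (X (σ n))) UF (𝓝 ε) := by
      apply tendsto_const_nhds.congr'
      filter_upwards [hev2] with n hn using hn.2.1.symm
    have := tendsto_nhds_unique h3 h4
    linarith [hYg d]

theorem exit_fwd (hf : ContDiff ℝ 1 f) (hX : ∀ τ ∈ Iic (0:ℝ), HasDerivAt X (f (X τ)) τ)
    (hM : ∀ τ ∈ Iic (0:ℝ), ‖X τ‖ ≤ M) {g : E → ℝ} (hg : Continuous g) {ε : ℝ} {t : ℕ → ℝ}
    (ht : Tendsto t UF atBot) {Y : ℝ → E} (hY : LimAlong X t Y) (hYg : ∀ s, g (Y s) < ε)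
    (hfreq : ∃ᶠ τ in atBot, ε ≤ g (X τ)) :
    ∃ σ : ℕ → ℝ, Tendsto σ UF atBot ∧ (∀ᶠ n in UF, t n ≤ σ n ∧ g (X (σ n)) = ε ∧
      ∀ τ ∈ Icc (t n) (σ n), g (X τ) ≤ ε) ∧ Tendsto (fun n => σ n - t n) UF atTop := by
  obtain ⟨K, B, hK, hB0, hKL, hB⟩ := bounds_of_contDiff hf M
  have hex : ∀ n, ∃ σ, ∀ τ₀, τ₀ ≤ 0 → t n ≤ τ₀ → ε ≤ g (X τ₀) → g (X (t n)) < ε →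
      (t n ≤ σ ∧ σ ≤ τ₀ ∧ g (X σ) = ε ∧ ∀ τ ∈ Icc (t n) σ, g (X τ) ≤ ε) := by
    intro n
    by_cases h : ∃ τ₀, τ₀ ≤ 0 ∧ t n ≤ τ₀ ∧ ε ≤ g (X τ₀) ∧ g (X (t n)) < ε
    · obtain ⟨τ₀, h1, h2, h3, h4⟩ := h
      have hcont : ∀ τ₁ ≤ (0:ℝ), ContinuousOn (fun τ => g (X τ)) (Icc (t n) τ₁) := by
        intro τ₁ h1 τ hτ
        exact (hg.continuousAt.comp (hX τ (hτ.2.trans h1)).continuousAt).continuousWithinAt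
      obtain ⟨σ, h5, h6, h7⟩ := hit_right h2 (hcont τ₀ h1) h3 h4
      by_cases hlast : ∀ τ₁, t n ≤ τ₁ → τ₁ < σ → g (X τ₁) < ε
      · refine ⟨σ, fun τ₁ h8 h9 h10 h11 => ⟨h5.1, ?_, h6, h7⟩⟩
        by_contra hc
        push Not at hc
        linarith [hlast τ₁ h9 hc]
      · -- take the first hitting time by compactness
        have hc : IsCompact (Icc (t n) τ₀ ∩ (fun τ => g (X τ)) ⁻¹' Ici ε) :=
          isCompact_Icc.of_isClosed_subset
            ((hcont τ₀ h1).preimage_isClosed_of_isClosed isClosed_Icc isClosed_Ici)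
            inter_subset_left
        obtain ⟨ρ, hρ⟩ := hc.exists_isLeast ⟨τ₀, ⟨h2, le_rfl⟩, h3⟩
        obtain ⟨σ', h5', h6', h7'⟩ := hit_right hρ.1.1.1 (hcont ρ (hρ.1.1.2.trans h1)) hρ.1.2 h4
        have : σ' = ρ := le_antisymm h5'.2
          (hρ.2 ⟨⟨h5'.1, h5'.2.trans hρ.1.1.2⟩, by simp [h6']⟩)
        subst this
        refine ⟨σ', fun τ₁ h8 h9 h10 h11 => ⟨h5'.1, ?_, h6', h7'⟩⟩
        by_contra hc
        push Not at hc
        have := hρ.2 ⟨⟨h9, hc.le.trans hρ.1.1.2⟩, h10⟩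
        linarith
    · exact ⟨0, fun τ₀ h1 h2 h3 h4 => absurd ⟨τ₀, h1, h2, h3, h4⟩ h⟩
  choose σ hσ using hex
  have hY0 : Tendsto (fun n => X (t n)) UF (𝓝 (Y 0)) := by simpa using hY 0
  have hev : ∀ᶠ n in UF, g (X (t n)) < ε :=
      (((hg.tendsto _).comp hY0).eventually (gt_mem_nhds (hYg 0)))
  have hlate : ∀ T : ℝ, ∀ᶠ n in UF, t n ≤ σ n ∧ σ n ≤ T ∧ σ n ≤ 0 ∧ g (X (σ n)) = ε ∧
      ∀ τ ∈ Icc (t n) (σ n), g (X τ) ≤ ε := by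
    intro T
    obtain ⟨τ₀, h1, h2⟩ := (hfreq.and_eventually (eventually_le_atBot (min T 0))).exists
    filter_upwards [hev, ht.eventually (eventually_le_atBot τ₀)] with n h3 h4
    obtain ⟨h5, h6, h7, h8⟩ := hσ n τ₀ (h2.trans (min_le_right _ _)) h4 h1 h3
    exact ⟨h5, h6.trans (h2.trans (min_le_left _ _)), h6.trans (h2.trans (min_le_right _ _)), h7, h8⟩
  have hev2 := hlate 0
  refine ⟨σ, ?_, hev2.mono fun n hn => ⟨hn.1, hn.2.2.2⟩, ?_⟩
  · rw [tendsto_atBot]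
    intro T
    filter_upwards [hlate T] with n hn using hn.2.1
  · rw [tendsto_atTop]
    intro T
    by_contra hcon
    have h1 : ∀ᶠ n in UF, ¬ (T ≤ σ n - t n) := Ultrafilter.eventually_not.2 hcon
    obtain ⟨d, hd⟩ := uf_limit (u := fun n => σ n - t n) (M := T) (by
      filter_upwards [h1, hev2] with n h2 h3
      rw [Real.norm_eq_abs, abs_le]
      constructor <;> linarith [h3.1])
    have h2 := lim_shift (S := Iic 0) ordConnected_Iic hX (fun τ hτ => hB _ (hM τ hτ))
      (fun c => (tendsto_atBot_add_const_right _ c ht).eventually (eventually_le_atBot 0)) hY hd (by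
        filter_upwards [hev2] with n h3
        simp only [mem_Iic, add_sub_cancel]
        exact h3.2.2.1)
    simp only [add_sub_cancel] at h2
    have h3 : Tendsto (fun n => g (X (σ n))) UF (𝓝 (g (Y d))) := (hg.tendsto _).comp h2
    have h4 : Tendsto (fun n => g (X (σ n))) UF (𝓝 ε) := by
      apply tendsto_const_nhds.congr'
      filter_upwards [hev2] with n hn using hn.2.2.2.1.symm
    have := tendsto_nhds_unique h3 h4
    linarith [hYg d]

end Limits

/-! ### The system in symmetric variables -/

/-- State space: `(Ω, A, N)`. -/
abbrev VV : Type := ℝ × (Fin 3 → ℝ) × (Fin 3 → ℝ)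

def qv (w O a b c : ℝ) : ℝ := w / 2 * O + (a ^ 2 + b ^ 2 + c ^ 2) / 3

def QV (w : ℝ) (v : VV) : ℝ := qv w v.1 (v.2.1 0) (v.2.1 1) (v.2.1 2)

def SV (n : Fin 3 → ℝ) (i : Fin 3) : ℝ :=
  -2 * (n 0 ^ 2 + n 1 ^ 2 + n 2 ^ 2 - n i ^ 2) + (n 0 + n 1 + n 2 - n i) ^ 2
    + n i * (3 * n i - (n 0 + n 1 + n 2))

/-- The vector field. -/
def FF (w : ℝ) (v : VV) : VV :=
  ((2 * QV w v - w) * v.1,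
   fun i => -(2 - QV w v) * v.2.1 i - 3 * SV v.2.2 i,
   fun i => (QV w v + 2 * v.2.1 i) * v.2.2 i)

structure PhysL (O a b c x y z : ℝ) : Prop where
  O0 : 0 ≤ O
  x0 : 0 ≤ x
  y0 : 0 ≤ y
  z0 : 0 ≤ z
  sum : a + b + c = 0
  con : O + (a ^ 2 + b ^ 2 + c ^ 2) / 6
    + 3 / 4 * (x ^ 2 + y ^ 2 + z ^ 2 - 2 * (x * y + y * z + z * x)) = 1

def Phys (v : VV) : Prop :=
  PhysL v.1 (v.2.1 0) (v.2.1 1) (v.2.1 2) (v.2.2 0) (v.2.2 1) (v.2.2 2)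

structure Dist3 (i j k : Fin 3) : Prop where
  ij : i ≠ j
  jk : j ≠ k
  ik : i ≠ k

lemma Dist3.cases {i j k : Fin 3} (d : Dist3 i j k) {p : Fin 3 → Fin 3 → Fin 3 → Prop}
    (h1 : p 0 1 2) (h2 : p 0 2 1) (h3 : p 1 0 2) (h4 : p 1 2 0) (h5 : p 2 0 1) (h6 : p 2 1 0) :
    p i j k := by
  obtain ⟨a, b, c⟩ := d
  fin_cases i <;> fin_cases j <;> fin_cases k <;> simp_all

lemma Dist3.exists_of (i : Fin 3) : ∃ j k, Dist3 i j k := by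
  fin_cases i
  · exact ⟨1, 2, by decide, by decide, by decide⟩
  · exact ⟨0, 2, by decide, by decide, by decide⟩
  · exact ⟨0, 1, by decide, by decide, by decide⟩

lemma Dist3.exists_of2 {i j : Fin 3} (h : i ≠ j) : ∃ k, Dist3 i j k := by
  fin_cases i <;> fin_cases j <;> simp at h
  · exact ⟨2, by decide, by decide, by decide⟩
  · exact ⟨1, by decide, by decide, by decide⟩
  · exact ⟨2, by decide, by decide, by decide⟩
  · exact ⟨0, by decide, by decide, by decide⟩
  · exact ⟨1, by decide, by decide, by decide⟩
  · exact ⟨0, by decide, by decide, by decide⟩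

lemma Dist3.swap {i j k : Fin 3} (d : Dist3 i j k) : Dist3 i k j := ⟨d.ik, d.jk.symm, d.ij⟩
lemma Dist3.rot {i j k : Fin 3} (d : Dist3 i j k) : Dist3 j k i := ⟨d.jk, d.ik.symm, d.ij.symm⟩

lemma Dist3.all {i j k : Fin 3} (d : Dist3 i j k) {p : Fin 3 → Prop} (hi : p i) (hj : p j)
    (hk : p k) : ∀ m, p m := by
  intro m
  revert p
  refine d.cases (p := fun i j k => ∀ {p : Fin 3 → Prop}, p i → p j → p k → p m)
    ?_ ?_ ?_ ?_ ?_ ?_ <;> fin_cases m <;> intro p <;> simp_all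

lemma QV_eq {i j k : Fin 3} (d : Dist3 i j k) (w : ℝ) (v : VV) :
    QV w v = qv w v.1 (v.2.1 i) (v.2.1 j) (v.2.1 k) := by
  refine d.cases (p := fun i j k => QV w v = qv w v.1 (v.2.1 i) (v.2.1 j) (v.2.1 k))
    ?_ ?_ ?_ ?_ ?_ ?_ <;> simp only [QV, qv] <;> ring

lemma SV_eq {i j k : Fin 3} (d : Dist3 i j k) (n : Fin 3 → ℝ) :
    SV n i = -(n j - n k) ^ 2 + n i * (2 * n i - n j - n k) := by
  refine d.cases (p := fun i j k => SV n i = -(n j - n k) ^ 2 + n i * (2 * n i - n j - n k))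
    ?_ ?_ ?_ ?_ ?_ ?_ <;> simp only [SV] <;> ring

lemma Phys.loc {v : VV} (h : Phys v) {i j k : Fin 3} (d : Dist3 i j k) :
    PhysL v.1 (v.2.1 i) (v.2.1 j) (v.2.1 k) (v.2.2 i) (v.2.2 j) (v.2.2 k) := by
  obtain ⟨h1, h2, h3, h4, h5, h6⟩ := h
  refine d.cases (p := fun i j k => PhysL v.1 (v.2.1 i) (v.2.1 j) (v.2.1 k) (v.2.2 i) (v.2.2 j)
    (v.2.2 k)) ?_ ?_ ?_ ?_ ?_ ?_ <;> constructor <;> first | assumption | linarith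

lemma Phys.of_loc {v : VV} {i j k : Fin 3} (d : Dist3 i j k)
    (h : PhysL v.1 (v.2.1 i) (v.2.1 j) (v.2.1 k) (v.2.2 i) (v.2.2 j) (v.2.2 k)) : Phys v := by
  revert h
  refine d.cases (p := fun i j k => PhysL v.1 (v.2.1 i) (v.2.1 j) (v.2.1 k) (v.2.2 i) (v.2.2 j)
    (v.2.2 k) → Phys v) ?_ ?_ ?_ ?_ ?_ ?_ <;> rintro ⟨h1, h2, h3, h4, h5, h6⟩ <;> constructor
    <;> first | assumption | linarith

lemma FF_contDiff (w : ℝ) : ContDiff ℝ 1 (FF w) := by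
  have hA : ∀ i : Fin 3, ContDiff ℝ 1 (fun v : VV => v.2.1 i) := fun i => by fun_prop
  have hN : ∀ i : Fin 3, ContDiff ℝ 1 (fun v : VV => v.2.2 i) := fun i => by fun_prop
  have hQ : ContDiff ℝ 1 (QV w) := by
    unfold QV qv
    fun_prop
  have hS : ∀ i : Fin 3, ContDiff ℝ 1 (fun v : VV => SV v.2.2 i) := fun i => by
    unfold SV
    fun_prop
  unfold FF
  refine ContDiff.prodMk ?_ (ContDiff.prodMk (contDiff_pi.2 fun i => ?_) (contDiff_pi.2 fun i => ?_))
  · fun_prop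
  · exact ((contDiff_const.sub hQ).neg.mul (hA i)).sub (contDiff_const.mul (hS i))
  · exact (hQ.add (contDiff_const.mul (hA i))).mul (hN i)

lemma Phys_closed : IsClosed {v : VV | Phys v} := by
  have : {v : VV | Phys v} = {v : VV | 0 ≤ v.1} ∩ {v | 0 ≤ v.2.2 0} ∩ {v | 0 ≤ v.2.2 1} ∩
      {v | 0 ≤ v.2.2 2} ∩ {v | v.2.1 0 + v.2.1 1 + v.2.1 2 = 0} ∩
      {v | v.1 + ((v.2.1 0) ^ 2 + (v.2.1 1) ^ 2 + (v.2.1 2) ^ 2) / 6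
    + 3 / 4 * ((v.2.2 0) ^ 2 + (v.2.2 1) ^ 2 + (v.2.2 2) ^ 2 - 2 * ((v.2.2 0) * (v.2.2 1)
      + (v.2.2 1) * (v.2.2 2) + (v.2.2 2) * (v.2.2 0))) = 1} := by
    ext v
    constructor
    · rintro ⟨h1, h2, h3, h4, h5, h6⟩
      exact ⟨⟨⟨⟨⟨h1, h2⟩, h3⟩, h4⟩, h5⟩, h6⟩
    · rintro ⟨⟨⟨⟨⟨h1, h2⟩, h3⟩, h4⟩, h5⟩, h6⟩
      exact ⟨h1, h2, h3, h4, h5, h6⟩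
  rw [this]
  refine IsClosed.inter (IsClosed.inter (IsClosed.inter (IsClosed.inter (IsClosed.inter ?_ ?_) ?_)
    ?_) ?_) ?_
  · exact isClosed_le continuous_const (by fun_prop)
  · exact isClosed_le continuous_const (by fun_prop)
  · exact isClosed_le continuous_const (by fun_prop)
  · exact isClosed_le continuous_const (by fun_prop)
  · exact isClosed_eq (by fun_prop) continuous_const
  · exact isClosed_eq (by fun_prop) continuous_const

/-- Scalar form of a solution. -/
structure Loc (w : ℝ) (S : Set ℝ) (O a b c x y z : ℝ → ℝ) : Prop where
  hO : ∀ t ∈ S, HasDerivAt O ((2 * qv w (O t) (a t) (b t) (c t) - w) * O t) t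
  ha : ∀ t ∈ S, HasDerivAt a (-(2 - qv w (O t) (a t) (b t) (c t)) * a t
    - 3 * (-(y t - z t) ^ 2 + x t * (2 * x t - y t - z t))) t
  hb : ∀ t ∈ S, HasDerivAt b (-(2 - qv w (O t) (a t) (b t) (c t)) * b t
    - 3 * (-(z t - x t) ^ 2 + y t * (2 * y t - z t - x t))) t
  hc : ∀ t ∈ S, HasDerivAt c (-(2 - qv w (O t) (a t) (b t) (c t)) * c t
    - 3 * (-(x t - y t) ^ 2 + z t * (2 * z t - x t - y t))) t
  hx : ∀ t ∈ S, HasDerivAt x ((qv w (O t) (a t) (b t) (c t) + 2 * a t) * x t) t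
  hy : ∀ t ∈ S, HasDerivAt y ((qv w (O t) (a t) (b t) (c t) + 2 * b t) * y t) t
  hz : ∀ t ∈ S, HasDerivAt z ((qv w (O t) (a t) (b t) (c t) + 2 * c t) * z t) t
  ph : ∀ t ∈ S, PhysL (O t) (a t) (b t) (c t) (x t) (y t) (z t)

/-- Vector form of a solution. -/
structure Sol (w : ℝ) (S : Set ℝ) (X : ℝ → VV) : Prop where
  d : ∀ t ∈ S, HasDerivAt X (FF w (X t)) t
  ph : ∀ t ∈ S, Phys (X t)

lemma Sol.loc {w : ℝ} {S : Set ℝ} {X : ℝ → VV} (h : Sol w S X) {i j k : Fin 3}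
    (d : Dist3 i j k) :
    Loc w S (fun t => (X t).1) (fun t => (X t).2.1 i) (fun t => (X t).2.1 j)
      (fun t => (X t).2.1 k) (fun t => (X t).2.2 i) (fun t => (X t).2.2 j)
      (fun t => (X t).2.2 k) := by
  have h1 : ∀ t ∈ S, HasDerivAt (fun t => (X t).1) (FF w (X t)).1 t := fun t ht => (h.d t ht).fst
  have h2 : ∀ m, ∀ t ∈ S, HasDerivAt (fun t => (X t).2.1 m) ((FF w (X t)).2.1 m) t :=
    fun m t ht => (hasDerivAt_pi.1 (h.d t ht).snd.fst) m
  have h3 : ∀ m, ∀ t ∈ S, HasDerivAt (fun t => (X t).2.2 m) ((FF w (X t)).2.2 m) t :=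
    fun m t ht => (hasDerivAt_pi.1 (h.d t ht).snd.snd) m
  refine ⟨?_, ?_, ?_, ?_, ?_, ?_, ?_, ?_⟩
  · intro t ht
    rw [← QV_eq d]
    exact h1 t ht
  · intro t ht
    rw [← QV_eq d, ← SV_eq d]
    exact h2 i t ht
  · intro t ht
    rw [← QV_eq d, ← SV_eq d.rot]
    exact h2 j t ht
  · intro t ht
    rw [← QV_eq d, ← SV_eq d.rot.rot]
    exact h2 k t ht
  · intro t ht
    rw [← QV_eq d]
    exact h3 i t ht
  · intro t ht
    rw [← QV_eq d]
    exact h3 j t ht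
  · intro t ht
    rw [← QV_eq d]
    exact h3 k t ht
  · intro t ht
    exact (h.ph t ht).loc d

lemma Loc.mono {w : ℝ} {S T : Set ℝ} {O a b c x y z : ℝ → ℝ} (h : Loc w S O a b c x y z)
    (hT : T ⊆ S) : Loc w T O a b c x y z :=
  ⟨fun t ht => h.hO t (hT ht), fun t ht => h.ha t (hT ht), fun t ht => h.hb t (hT ht),
   fun t ht => h.hc t (hT ht), fun t ht => h.hx t (hT ht), fun t ht => h.hy t (hT ht),
   fun t ht => h.hz t (hT ht), fun t ht => h.ph t (hT ht)⟩

lemma Loc.rot {w : ℝ} {S : Set ℝ} {O a b c x y z : ℝ → ℝ} (h : Loc w S O a b c x y z) :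
    Loc w S O b c a y z x := by
  have hq : ∀ t, qv w (O t) (b t) (c t) (a t) = qv w (O t) (a t) (b t) (c t) := fun t => by
    simp only [qv]; ring
  refine ⟨?_, ?_, ?_, ?_, ?_, ?_, ?_, ?_⟩
  · intro t ht; rw [hq]; exact h.hO t ht
  · intro t ht; rw [hq]; exact h.hb t ht
  · intro t ht; rw [hq]; exact h.hc t ht
  · intro t ht; rw [hq]; exact h.ha t ht
  · intro t ht; rw [hq]; exact h.hy t ht
  · intro t ht; rw [hq]; exact h.hz t ht
  · intro t ht; rw [hq]; exact h.hx t ht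
  · intro t ht
    obtain ⟨h1, h2, h3, h4, h5, h6⟩ := h.ph t ht
    exact ⟨h1, h3, h4, h2, by linarith, by linarith⟩

/-! pointwise identities -/

lemma PhysL.c_eq {O a b c x y z : ℝ} (h : PhysL O a b c x y z) : c = - a - b := by
  linarith [h.sum]

lemma PhysL.two_sub_q {O a b c x y z : ℝ} (h : PhysL O a b c x y z) (w : ℝ) :
    2 - qv w O a b c = (2 - w / 2) * O
      + 3 / 2 * ((y - z) ^ 2 + x ^ 2 - 2 * x * (y + z)) := by
  have := h.con
  simp only [qv]
  linear_combination (-2) * this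

lemma PhysL.q_nonneg {O a b c x y z w : ℝ} (h : PhysL O a b c x y z) (hw : 0 ≤ w) :
    0 ≤ qv w O a b c := by
  have := h.O0
  unfold qv
  positivity

lemma PhysL.q_ge {O a b c x y z w : ℝ} (h : PhysL O a b c x y z) (hw : 0 ≤ w) :
    a ^ 2 / 2 ≤ qv w O a b c := by
  have := mul_nonneg (div_nonneg hw (by norm_num : (0:ℝ) ≤ 2)) h.O0
  have h2 := h.c_eq
  subst h2
  unfold qv
  nlinarith [sq_nonneg (a + 2 * b)]

/-! ### Derived evolution equations -/

def VL (b c y z : ℝ) : ℝ := (b - c) * (y - z) / (y + z)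

section
variable {w : ℝ} {S : Set ℝ} {O a b c x y z : ℝ → ℝ}

lemma Loc.hu (h : Loc w S O a b c x y z) {t : ℝ} (ht : t ∈ S) :
    HasDerivAt (fun t => b t - c t) (-(2 - qv w (O t) (a t) (b t) (c t)) * (b t - c t)
      - 9 * (y t - z t) * (y t + z t - x t)) t :=
  ((h.hb t ht).sub (h.hc t ht)).congr_deriv (by ring)

lemma Loc.hD (h : Loc w S O a b c x y z) {t : ℝ} (ht : t ∈ S) :
    HasDerivAt (fun t => y t - z t) ((qv w (O t) (a t) (b t) (c t) - a t) * (y t - z t)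
      + (b t - c t) * (y t + z t)) t :=
  ((h.hy t ht).sub (h.hz t ht)).congr_deriv (by
    have := (h.ph t ht).sum
    linear_combination (y t - z t) * this)

lemma Loc.hP (h : Loc w S O a b c x y z) {t : ℝ} (ht : t ∈ S) :
    HasDerivAt (fun t => y t + z t) ((qv w (O t) (a t) (b t) (c t) - a t) * (y t + z t)
      + (b t - c t) * (y t - z t)) t :=
  ((h.hy t ht).add (h.hz t ht)).congr_deriv (by
    have := (h.ph t ht).sum
    linear_combination (y t + z t) * this)

lemma Loc.hV (h : Loc w S O a b c x y z) {t : ℝ} (ht : t ∈ S) (hP : 0 < y t + z t) :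
    HasDerivAt (fun t => VL (b t) (c t) (y t) (z t))
      ((b t - c t) ^ 2 - 9 * (y t - z t) ^ 2
        - (2 - qv w (O t) (a t) (b t) (c t)) * VL (b t) (c t) (y t) (z t)
        - VL (b t) (c t) (y t) (z t) ^ 2 + 9 * x t * ((y t - z t) ^ 2 / (y t + z t))) t := by
  have h1 := ((h.hu ht).mul (h.hD ht)).div (h.hP ht) hP.ne'
  refine HasDerivAt.congr_deriv (f := fun t => VL (b t) (c t) (y t) (z t)) h1 ?_
  simp only [VL, Pi.mul_apply]
  field_simp
  ring

lemma Loc.hlog (h : Loc w S O a b c x y z) {t : ℝ} (ht : t ∈ S) (hy : 0 < y t) (hz : 0 < z t) :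
    HasDerivAt (fun t => Real.log (y t) + Real.log (z t))
      (2 * qv w (O t) (a t) (b t) (c t) - 2 * a t) t := by
  refine (((h.hy t ht).log hy.ne').add ((h.hz t ht).log hz.ne')).congr_deriv ?_
  have := (h.ph t ht).sum
  field_simp
  linear_combination 2 * this

lemma Loc.hp (h : Loc w S O a b c x y z) {t : ℝ} (ht : t ∈ S) :
    HasDerivAt (fun t => x t * y t * z t)
      (3 * qv w (O t) (a t) (b t) (c t) * (x t * y t * z t)) t := by
  refine (((h.hx t ht).mul (h.hy t ht)).mul (h.hz t ht)).congr_deriv ?_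
  have := (h.ph t ht).sum
  simp only [Pi.mul_apply]
  linear_combination 2 * (x t * y t * z t) * this

end

lemma PhysL.log_rate {w O a b c x y z : ℝ} (h : PhysL O a b c x y z) :
    2 * qv w O a b c - 2 * a = (2 - a) ^ 2 / 2 + (w - 2) * O
      + ((b - c) ^ 2 - 9 * (y - z) ^ 2) / 6 - 3 / 2 * x ^ 2 + 3 * x * (y + z) := by
  have h1 := h.con
  have h2 := h.c_eq
  subst h2
  simp only [qv]
  linear_combination 2 * h1

lemma PhysL.O_rate {w O a b c x y z : ℝ} (h : PhysL O a b c x y z) :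
    2 * qv w O a b c - w = (2 - w) * (1 - O) + a ^ 2 / 2
      + ((b - c) ^ 2 - 9 * (y - z) ^ 2) / 6 - 3 / 2 * x ^ 2 + 3 * x * (y + z) := by
  have h1 := h.con
  have h2 := h.c_eq
  subst h2
  simp only [qv]
  linear_combination 2 * h1

lemma PhysL.con2 {O a b c x y z : ℝ} (h : PhysL O a b c x y z) :
    O + a ^ 2 / 4 + (b - c) ^ 2 / 12 + 3 / 4 * ((y - z) ^ 2 + x ^ 2 - 2 * x * (y + z)) = 1 := by
  have h1 := h.con
  have h2 := h.c_eq
  subst h2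
  linear_combination h1

/-! ### Boundedness -/

lemma curv_lower {x y z M : ℝ} (hx : 0 ≤ x) (hy : 0 ≤ y) (hz : 0 ≤ z) (hM : 1 ≤ M)
    (hp : x * y * z ≤ M) :
    -(4 * M) ≤ x ^ 2 + y ^ 2 + z ^ 2 - 2 * (x * y + y * z + z * x) := by
  have hxy := mul_nonneg hx hy
  have hyz := mul_nonneg hy hz
  have hzx := mul_nonneg hz hx
  by_contra hcon
  push Not at hcon
  have h1 : M < x * y := by nlinarith [sq_nonneg (x + y - z)]
  have h2 : M < y * z := by nlinarith [sq_nonneg (y + z - x)]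
  have h3 : M < z * x := by nlinarith [sq_nonneg (z + x - y)]
  have hp0 : 0 ≤ x * y * z := mul_nonneg hxy hz
  have h4 : M * M < (x * y) * (y * z) := by nlinarith
  have h5 : M * M * M < (x * y) * (y * z) * (z * x) := by
    have : 0 < M * M := by positivity
    nlinarith
  have h6 : (x * y) * (y * z) * (z * x) = (x * y * z) ^ 2 := by ring
  have h7 : (x * y * z) ^ 2 ≤ M ^ 2 := pow_le_pow_left₀ hp0 hp 2
  nlinarith

lemma m_lower {w : ℝ} (hw0 : 0 < w) (hw4 : w < 4) : ∃ C c η₀ : ℝ, 0 ≤ C ∧ 0 < c ∧ 0 < η₀ ∧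
    ∀ O a : ℝ, 0 ≤ O → O ≤ 1 - a ^ 2 / 4 + 2 * η₀ →
    c * ((2 - a) ^ 2 + O) ≤ (2 - a) ^ 2 / 2 - (2 - w) * O
      + C * O * (a ^ 2 / 2 + (2 - w) * (1 - O)) := by
  rcases lt_or_ge 2 w with h | h
  · refine ⟨0, min (1 / 2) (w - 2), 1, le_rfl, lt_min (by norm_num) (by linarith), by norm_num, ?_⟩
    intro O a hO _
    have h1 := min_le_left (1 / 2) (w - 2)
    have h2 := min_le_right (1 / 2) (w - 2)
    nlinarith [sq_nonneg (2 - a)]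
  · set C := 96 / w ^ 2 with hC
    have hC0 : 0 < C := by positivity
    have hCw : C * w ^ 2 = 96 := by rw [hC]; field_simp
    obtain ⟨η, hη0, h1, h2, h3⟩ : ∃ η : ℝ, 0 < η ∧ η ≤ 1 / 2 ∧ η * (8 * C) ≤ 1 ∧
        η * (32 * (1 + 2 * C)) ≤ w := by
      refine ⟨min (1 / 2) (min (1 / (8 * C)) (w / (32 * (1 + 2 * C)))), by positivity,
        min_le_left _ _, ?_, ?_⟩
      · rw [← le_div_iff₀ (by positivity)]
        exact (min_le_right _ _).trans (min_le_left _ _)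
      · rw [← le_div_iff₀ (by positivity)]
        exact (min_le_right _ _).trans (min_le_right _ _)
    refine ⟨C, w / 16, η, hC0.le, by positivity, hη0, ?_⟩
    intro O a hO hOa
    have hO1 : -(2 * η) ≤ 1 - O := by nlinarith [sq_nonneg a]
    have hO2 : O ≤ 2 := by linarith
    have hCO : 0 ≤ C * O := by positivity
    have h4 : -(4 * η) ≤ (2 - w) * (1 - O) := by nlinarith
    have h5 : C * O * (a ^ 2 / 2 - 4 * η) ≤ C * O * (a ^ 2 / 2 + (2 - w) * (1 - O)) :=
      mul_le_mul_of_nonneg_left (by linarith) hCO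
    rcases le_or_gt (w / 4) a with ha | ha
    · have h6 : w ^ 2 / 16 ≤ a ^ 2 := by nlinarith
      have h7 : C * O * (w ^ 2 / 32) ≤ C * O * (a ^ 2 / 2) :=
        mul_le_mul_of_nonneg_left (by linarith) hCO
      have h8 : C * O * (w ^ 2 / 32) = 3 * O := by linear_combination O / 32 * hCw
      have h9 : C * O * (4 * η) ≤ O / 2 := by nlinarith
      nlinarith [sq_nonneg (2 - a)]
    · have h7 : 0 ≤ C * O * (a ^ 2 / 2) := by positivity
      have h9 : C * O * (4 * η) ≤ 8 * C * η := by
        have : 0 < C * η := by positivity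
        nlinarith
      have h10 : (2 - w) * O ≤ (2 - w) + 4 * η := by nlinarith
      have h11 : (2 - w / 4) ^ 2 ≤ (2 - a) ^ 2 := by
        apply pow_le_pow_left₀ <;> linarith
      have h12 : (1 - w / 8) * (2 - w / 4) ^ 2 ≤ (1 - w / 8) * (2 - a) ^ 2 :=
        mul_le_mul_of_nonneg_left h11 (by linarith)
      have h13 : (2 - w) + w / 4 ≤ (1 - w / 8) * (2 - w / 4) ^ 2 / 2 := by
        nlinarith [mul_pos hw0 hw0, mul_pos (mul_pos hw0 hw0) hw0]
      nlinarith

lemma psi_aux1 {O e r η x P D s q V : ℝ} (hO0 : 0 ≤ O) (he0 : 0 ≤ e) (hr0 : 0 ≤ r) (hη0 : 0 ≤ η)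
    (hx0 : 0 ≤ x) (hP0 : 0 ≤ P) (hrP : r * P = 1) (hr : r ≤ η) (hη : η ≤ 1 / 2) (he2 : e ≤ 2)
    (hxP : x * P ≤ η) (hx : x ≤ η) (hD2 : D ^ 2 ≤ 4 / 3 * e) (he1 : e ≤ |s| + 3 / 2 * (x * P))
    (habs : |2 - q| ≤ 2 * O + 3 / 2 * D ^ 2 + 3 / 2 * x ^ 2 + 3 * (x * P))
    (hV2 : |V| ≤ 2 * e * r) :
    |(2 - q) * V| ≤ 12 * η * (O + s ^ 2) + 36 * x := by
  have hxP0 : 0 ≤ x * P := by positivity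
  have hA : |(2 - q) * V| ≤ (2 * O + 3 / 2 * D ^ 2 + 3 / 2 * x ^ 2 + 3 * (x * P)) * (2 * e * r) := by
    rw [abs_mul]
    exact mul_le_mul habs hV2 (abs_nonneg _) (by positivity)
  have her : e * r ≤ 2 * η := mul_le_mul he2 hr hr0 (by norm_num)
  have t1 : 2 * O * (2 * e * r) ≤ 8 * η * O := by
    have := mul_le_mul_of_nonneg_left her hO0
    linarith
  have t2 : 3 / 2 * D ^ 2 * (2 * e * r) ≤ 8 * η * s ^ 2 + 18 * x := by
    have g1 : e ^ 2 ≤ 2 * s ^ 2 + 9 / 2 * (x * P) ^ 2 := by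
      have : e ^ 2 ≤ (|s| + 3 / 2 * (x * P)) ^ 2 := pow_le_pow_left₀ he0 he1 2
      have g := sq_nonneg (|s| - 3 / 2 * (x * P))
      have g' := sq_abs s
      linarith
    have g2 : 3 / 2 * D ^ 2 * (2 * e * r) ≤ 4 * (e ^ 2 * r) := by
      have : D ^ 2 * (e * r) ≤ 4 / 3 * e * (e * r) :=
        mul_le_mul_of_nonneg_right hD2 (by positivity)
      linarith
    have g3 : e ^ 2 * r ≤ (2 * s ^ 2 + 9 / 2 * (x * P) ^ 2) * r :=
      mul_le_mul_of_nonneg_right g1 hr0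
    have g4 : (x * P) ^ 2 * r = x * (x * P) := by
      linear_combination x ^ 2 * P * hrP
    have g5 : s ^ 2 * r ≤ s ^ 2 * η := mul_le_mul_of_nonneg_left hr (sq_nonneg s)
    have g6 : x * (x * P) ≤ x * 1 := mul_le_mul_of_nonneg_left (by linarith) hx0
    linarith
  have t3 : 3 / 2 * x ^ 2 * (2 * e * r) ≤ 6 * x := by
    have : e * r ≤ 1 := by linarith
    have g : x ^ 2 * (e * r) ≤ x ^ 2 * 1 := mul_le_mul_of_nonneg_left this (sq_nonneg x)
    have g2 : x * x ≤ x * 1 := mul_le_mul_of_nonneg_left (by linarith) hx0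
    linarith
  have t4 : 3 * (x * P) * (2 * e * r) ≤ 12 * x := by
    have : 3 * (x * P) * (2 * e * r) = 6 * (x * e) := by linear_combination 6 * x * e * hrP
    rw [this]
    have := mul_le_mul_of_nonneg_left he2 hx0
    linarith
  have g6 : 0 ≤ η * O := by positivity
  have g7 : 0 ≤ η * s ^ 2 := by positivity
  linarith

lemma psi_aux2 {c₀ C η s O x q p a : ℝ} (h3 : η * (8 + 23 * C) ≤ c₀) (hC : 0 ≤ C) (hη0 : 0 ≤ η)
    (hO0 : 0 ≤ O) (hx0 : 0 ≤ x) (hq0 : 0 ≤ q) (hxp : x ≤ p) (hx : x ≤ η) (hs : s = 2 - a)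
    (hqa : a ^ 2 / 2 ≤ q) :
    0 ≤ c₀ * (s ^ 2 + O) - (1 + 2 * C) * (2 * η * (O + s ^ 2) + 6 * x) - 7 * C * η * O
      + 4 * (1 + 2 * C) * (3 * q * p) := by
  have g1 : η * (8 + 23 * C) * (s ^ 2 + O) ≤ c₀ * (s ^ 2 + O) :=
    mul_le_mul_of_nonneg_right h3 (by positivity)
  have g6 : 0 ≤ η * O := by positivity
  have g7 : 0 ≤ η * s ^ 2 := by positivity
  have g8 : 0 ≤ C * (η * O) := by positivity
  have g9 : 0 ≤ C * (η * s ^ 2) := by positivity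
  have g10 : 0 ≤ q * p := mul_nonneg hq0 (hx0.trans hxp)
  have g11 : 0 ≤ C * (q * p) := mul_nonneg hC g10
  rcases le_or_gt 1 (s ^ 2) with hs1 | hs1
  · have g2 : x ≤ η * s ^ 2 := hx.trans (le_mul_of_one_le_right hη0 hs1)
    have g3 : C * x ≤ C * (η * s ^ 2) := mul_le_mul_of_nonneg_left g2 hC
    linarith
  · have ha1 : 1 ≤ a := by nlinarith
    have hq2 : 1 / 2 ≤ q := by nlinarith
    have g2 : 1 / 2 * x ≤ q * p := mul_le_mul hq2 hxp hx0 hq0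
    have g3 : C * (1 / 2 * x) ≤ C * (q * p) := mul_le_mul_of_nonneg_left g2 hC
    linarith

set_option maxHeartbeats 1000000 in
/-- the derivative of `Ψ` is nonnegative when `yz` is large -/
lemma Psi_nonneg {w : ℝ} (hw0 : 0 < w) (hw4 : w < 4) : ∃ C C' η : ℝ, 0 ≤ C ∧ 0 ≤ C' ∧ 0 < η ∧
    ∀ O a b c x y z : ℝ, PhysL O a b c x y z → 1 ≤ y * z → x ≤ η → x * (y + z) ≤ η →
    1 / (y + z) ≤ η → 
    0 ≤ (2 * qv w O a b c - 2 * a) + C * ((2 * qv w O a b c - w) * O)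
      - 1 / 6 * (1 + C * O) * ((b - c) ^ 2 - 9 * (y - z) ^ 2
        - (2 - qv w O a b c) * VL b c y z
        - VL b c y z ^ 2 + 9 * x * ((y - z) ^ 2 / (y + z)))
      - 1 / 6 * (C * ((2 * qv w O a b c - w) * O)) * VL b c y z
      + C' * (3 * qv w O a b c * (x * y * z)) := by
  obtain ⟨C, c₀, η₀, hC, hc₀, hη₀, hm⟩ := m_lower hw0 hw4
  obtain ⟨η, hη0, h1, h2, h3⟩ : ∃ η : ℝ, 0 < η ∧ η ≤ 1 / 2 ∧ η ≤ η₀ ∧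
      η * (8 + 23 * C) ≤ c₀ := by
    refine ⟨min (1 / 2) (min η₀ (c₀ / (8 + 23 * C))), by positivity,
      min_le_left _ _, (min_le_right _ _).trans (min_le_left _ _), ?_⟩
    rw [← le_div_iff₀ (by positivity)]
    exact (min_le_right _ _).trans (min_le_right _ _)
  refine ⟨C, 4 * (1 + 2 * C), η, hC, by positivity, hη0, ?_⟩
  intro O a b c x y z h hyz hx hxP hP
  rw [h.log_rate]
  have hO0 := h.O0
  have hx0 := h.x0
  have hy0 := h.y0
  have hz0 := h.z0
  have hyp : 0 < y := by
    rcases hy0.lt_or_eq with h | h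
    · exact h
    · rw [← h] at hyz; norm_num at hyz
  have hcon := h.con2
  have hq1 := h.two_sub_q w
  have hq0 := h.q_nonneg hw0.le
  have hqa := h.q_ge hw0.le
  have hOr := h.O_rate (w := w)
  set q := qv w O a b c
  set u := b - c
  set D := y - z with hD
  set P := y + z with hPdef
  set V := VL b c y z with hV
  have hPpos : 0 < P := by positivity
  have hP2 : 2 ≤ P := by
    have h2 : 1 ≤ η * P := by rwa [div_le_iff₀ hPpos] at hP
    have h3 : η * P ≤ 1 / 2 * P := mul_le_mul_of_nonneg_right h1 hPpos.le
    linarith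
  have hDP : D ^ 2 ≤ P ^ 2 := by rw [hD, hPdef]; nlinarith [mul_nonneg hy0 hz0]
  have hxP0 : 0 ≤ x * P := by positivity
  set e := u ^ 2 / 12 + 3 / 4 * D ^ 2 with he
  have he0 : 0 ≤ e := by positivity
  set s := 2 - a with hs
  have has : a = 2 - s := by rw [hs]; ring
  have heq : O + e = s - s ^ 2 / 4 - 3 / 4 * x ^ 2 + 3 / 2 * (x * P) := by
    rw [he]; rw [has] at hcon; linarith
  have he1 : e ≤ |s| + 3 / 2 * (x * P) := by
    linarith [le_abs_self s, sq_nonneg s, sq_nonneg x]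
  have hOe : O + e ≤ 2 := by linarith [sq_nonneg (s / 2 - 1), sq_nonneg x]
  have huD : |u * D| ≤ 2 * e := by
    rw [abs_le, he]
    constructor <;> linarith [sq_nonneg (u / 6 - D / 2), sq_nonneg (u / 6 + D / 2)]
  have hVP : V * P = u * D := by rw [hV, VL]; rw [div_mul_cancel₀ _ hPpos.ne']
  have hVabs : |V| = |u * D| * (1 / P) := by
    rw [← hVP, abs_mul, abs_of_pos hPpos]; field_simp
  set r := 1 / P with hr
  have hr0 : 0 < r := by positivity
  have hrP : r * P = 1 := by rw [hr]; field_simp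
  -- m
  have hmm := hm O a hO0 (by linarith [sq_nonneg x, sq_nonneg u, sq_nonneg D])
  -- T1
  have hT1 : 0 ≤ -(3 / 2) * x ^ 2 + 3 * (x * P) - 3 / 2 * (x * (D ^ 2 / P)) := by
    have h5 : D ^ 2 / P ≤ P := by rw [div_le_iff₀ hPpos]; nlinarith
    have h6 : x * (D ^ 2 / P) ≤ x * P := mul_le_mul_of_nonneg_left h5 hx0
    have h7 : x * x ≤ x * P := mul_le_mul_of_nonneg_left (by linarith) hx0
    linarith
  -- V bounds
  have hV4 : |V| ≤ 4 * η := by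
    rw [hVabs]
    have : |u * D| ≤ 4 := by linarith
    exact mul_le_mul this hP hr0.le (by norm_num)
  have hV2 : |V| ≤ 2 * e * r := by rw [hVabs]; exact mul_le_mul_of_nonneg_right huD hr0.le
  have hT2 : |(2 - q) * V| ≤ 12 * η * (O + s ^ 2) + 36 * x := by
    have habs : |2 - q| ≤ 2 * O + 3 / 2 * D ^ 2 + 3 / 2 * x ^ 2 + 3 * (x * P) := by
      rw [hq1, abs_le]
      have hw2 : 0 ≤ (w / 2) * O := by positivity
      have hw3 : 0 ≤ (2 - w / 2) * O := mul_nonneg (by linarith) hO0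
      constructor <;> linarith [sq_nonneg D, sq_nonneg x]
    have hD2 : D ^ 2 ≤ 4 / 3 * e := by rw [he]; linarith [sq_nonneg u]
    exact psi_aux1 hO0 he0 hr0.le hη0.le hx0 hPpos.le hrP hP h1 (by linarith) hxP hx hD2 he1 habs hV2
  have hT3 : |(2 * q - w) * O * V| ≤ 40 * η * O := by
    have hw3 : 0 ≤ (2 - w / 2) * O := mul_nonneg (by linarith) hO0
    have hq5 : q ≤ 4 := by linarith [sq_nonneg D, sq_nonneg x]
    have g : |2 * q - w| ≤ 10 := by rw [abs_le]; constructor <;> linarith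
    rw [abs_mul, abs_mul, abs_of_nonneg hO0]
    have : |2 * q - w| * O ≤ 10 * O := mul_le_mul_of_nonneg_right g hO0
    have : |2 * q - w| * O * |V| ≤ 10 * O * (4 * η) :=
      mul_le_mul this hV4 (abs_nonneg _) (by positivity)
    linarith
  have hp0 : x ≤ x * y * z := by
    rw [mul_assoc]; exact le_mul_of_one_le_right hx0 hyz
  have key : 0 ≤ c₀ * (s ^ 2 + O) - (1 + 2 * C) * (2 * η * (O + s ^ 2) + 6 * x) - 7 * C * η * O
      + 4 * (1 + 2 * C) * (3 * q * (x * y * z)) := by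
    exact psi_aux2 h3 hC hη0.le hO0 hx0 hq0 hp0 hx hs hqa
  have hT2' : -(12 * η * (O + s ^ 2) + 36 * x) ≤ (2 - q) * V := (abs_le.1 hT2).1
  have hT3' : (2 * q - w) * O * V ≤ 40 * η * O := (abs_le.1 hT3).2
  have f1 : (1 + C * O) * (-(12 * η * (O + s ^ 2) + 36 * x)) ≤ (1 + C * O) * ((2 - q) * V) :=
    mul_le_mul_of_nonneg_left hT2' (by positivity)
  have f2 : (1 + C * O) * (12 * η * (O + s ^ 2) + 36 * x) ≤
      (1 + C * 2) * (12 * η * (O + s ^ 2) + 36 * x) := by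
    apply mul_le_mul_of_nonneg_right _ (by positivity)
    have : C * O ≤ C * 2 := mul_le_mul_of_nonneg_left (by linarith) hC
    linarith
  have f3 : C * ((2 * q - w) * O * V) ≤ C * (40 * η * O) := mul_le_mul_of_nonneg_left hT3' hC
  have f4 : 0 ≤ (1 + C * O) * (-(3 / 2) * x ^ 2 + 3 * (x * P) - 3 / 2 * (x * (D ^ 2 / P))) :=
    mul_nonneg (by positivity) hT1
  have f5 : 0 ≤ (1 + C * O) * V ^ 2 := by positivity
  have f6 : 0 ≤ C * (η * O) := by positivity
  have hOrC : C * ((2 * q - w) * O) = C * O * ((2 - w) * (1 - O) + a ^ 2 / 2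
      + (u ^ 2 - 9 * D ^ 2) / 6 - 3 / 2 * x ^ 2 + 3 * x * P) := by rw [hOr]; ring
  have e1 : C * ((2 * q - w) * O) * V = C * ((2 * q - w) * O * V) := by ring
  rw [mul_assoc (1 / 6) (C * ((2 * q - w) * O)) V, e1, hOrC]
  linarith

lemma big_aux {M η : ℝ} (hM : 1 ≤ M) (hη : 0 < η) : ∃ K : ℝ, 1 ≤ K ∧
    ∀ O a b c x y z : ℝ, PhysL O a b c x y z → x * y * z ≤ M → K ≤ y * z →
      1 ≤ y * z ∧ x ≤ η ∧ x * (y + z) ≤ η ∧ 1 / (y + z) ≤ η := by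
  obtain ⟨ξ, hξ0, h1, h2, h3⟩ : ∃ ξ : ℝ, 0 < ξ ∧ ξ ≤ 1 ∧ ξ ≤ η / 4 ∧ ξ * (8 + 8 * M) ≤ η ^ 2 := by
    refine ⟨min 1 (min (η / 4) (η ^ 2 / (8 + 8 * M))), by positivity, min_le_left _ _,
      (min_le_right _ _).trans (min_le_left _ _), ?_⟩
    rw [← le_div_iff₀ (by positivity)]
    exact (min_le_right _ _).trans (min_le_right _ _)
  refine ⟨max 1 (max (M / ξ) (1 / η ^ 2)), le_max_left _ _, ?_⟩
  intro O a b c x y z h hp hK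
  have k1 : 1 ≤ y * z := (le_max_left _ _).trans hK
  have k2 : M / ξ ≤ y * z := ((le_max_left _ _).trans (le_max_right _ _)).trans hK
  have k3 : 1 / η ^ 2 ≤ y * z := ((le_max_right _ _).trans (le_max_right _ _)).trans hK
  have hx0 := h.x0
  have hy0 := h.y0
  have hz0 := h.z0
  have hO0 := h.O0
  have hcon := h.con2
  have hxξ : x ≤ ξ := by
    rw [div_le_iff₀ hξ0] at k2
    by_contra hc
    push Not at hc
    have : y * z * ξ < y * z * x := mul_lt_mul_of_pos_left hc (by linarith)
    linarith
  have hyz0 : 0 < y + z := by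
    rcases (add_nonneg hy0 hz0).lt_or_eq with h | h
    · exact h
    · have hy : y = 0 := by linarith
      rw [hy] at k1; norm_num at k1
  have hT0 : 0 ≤ x * (y + z) := by positivity
  refine ⟨k1, by linarith, ?_, ?_⟩
  · by_contra hc
    push Not at hc
    have hD : (y - z) ^ 2 ≤ 4 / 3 + 2 * (x * (y + z)) := by
      linarith [sq_nonneg a, sq_nonneg (b - c), sq_nonneg x]
    have hT2 : (x * (y + z)) ^ 2 = x ^ 2 * (y - z) ^ 2 + 4 * (x * (x * y * z)) := by ring
    set T := x * (y + z)
    have hx2 : x ^ 2 ≤ ξ := by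
      have := mul_le_mul hxξ (hxξ.trans h1) hx0 hξ0.le
      linarith
    have g1 : x ^ 2 * (y - z) ^ 2 ≤ ξ * (4 / 3 + 2 * T) :=
      mul_le_mul hx2 hD (sq_nonneg _) hξ0.le
    have g2 : x * (x * y * z) ≤ ξ * M := mul_le_mul hxξ hp (by positivity) hξ0.le
    have g3 : η * T ≤ T * T := mul_le_mul_of_nonneg_right hc.le hT0
    have g4 : ξ * T ≤ η / 4 * T := mul_le_mul_of_nonneg_right h2 hT0
    have g5 : η * η < η * T := mul_lt_mul_of_pos_left hc hη
    have : 0 < ξ * M := by positivity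
    linarith
  · rw [div_le_iff₀ hyz0]
    rw [div_le_iff₀ (by positivity)] at k3
    have h5 : 0 ≤ η ^ 2 * (y - z) ^ 2 := by positivity
    have : 1 ^ 2 ≤ (η * (y + z)) ^ 2 := by linarith
    exact (le_abs_self _).trans (abs_le_of_sq_le_sq this (by positivity))

lemma VL_bound {b c y z : ℝ} (hy : 0 < y) (hz : 0 < z) : |VL b c y z| ≤ |b - c| := by
  unfold VL
  rw [abs_div, abs_mul, abs_of_pos (add_pos hy hz), div_le_iff₀ (add_pos hy hz)]
  apply mul_le_mul_of_nonneg_left _ (abs_nonneg _)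
  rw [abs_le]; constructor <;> linarith

section
variable {w : ℝ} {O a b c x y z : ℝ → ℝ}

lemma Loc.p_le (h : Loc w (Iic 0) O a b c x y z) (hw0 : 0 < w) {t : ℝ} (ht : t ≤ 0) :
    x t * y t * z t ≤ x 0 * y 0 * z 0 := by
  refine mono_of_hasDeriv (convex_Iic 0) (f := fun t => x t * y t * z t)
    (fun t ht => h.hp ht) ?_ ht (le_refl (0:ℝ)) ht
  intro t ht
  have p := h.ph t ht
  have := p.q_nonneg hw0.le
  have := p.x0
  have := p.y0
  have := p.z0
  positivity

set_option maxHeartbeats 400000 in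
lemma Loc.pair_bdd (h : Loc w (Iic 0) O a b c x y z) (hw0 : 0 < w) (hw4 : w < 4)
    (hy : ∀ t ≤ 0, 0 < y t) (hz : ∀ t ≤ 0, 0 < z t) :
    ∃ K, ∀ t ≤ 0, y t * z t ≤ K := by
  obtain ⟨C, C', η, hC, hC', hη, hΨ⟩ := Psi_nonneg hw0 hw4
  set M := max 1 (x 0 * y 0 * z 0) with hMdef
  have hM1 : 1 ≤ M := le_max_left _ _
  have hpM : ∀ t ≤ 0, x t * y t * z t ≤ M := fun t ht => (h.p_le hw0 ht).trans (le_max_right _ _)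
  obtain ⟨K, hK1, hK⟩ := big_aux hM1 hη
  -- bounds
  have hbd : ∀ t ≤ 0, O t ≤ 1 + 3 * M ∧ |VL (b t) (c t) (y t) (z t)| ≤ 13 + 36 * M := by
    intro t ht
    have p := h.ph t ht
    have h1 := curv_lower p.x0 p.y0 p.z0 hM1 (hpM t ht)
    have h2 := p.con2
    have h3 := p.O0
    have hO : O t ≤ 1 + 3 * M := by linarith [sq_nonneg (a t), sq_nonneg (b t - c t)]
    refine ⟨hO, (VL_bound (hy t ht) (hz t ht)).trans ?_⟩
    have h4 : (b t - c t) ^ 2 ≤ 12 * (1 + 3 * M) := by linarith [sq_nonneg (a t)]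
    have h5 := sq_abs (b t - c t)
    nlinarith [sq_nonneg (|b t - c t| - 1)]
  set G : ℝ → ℝ := fun t => C * O t - 1 / 6 * (1 + C * O t) * VL (b t) (c t) (y t) (z t)
    + C' * (x t * y t * z t) with hG
  obtain ⟨B, hB⟩ : ∃ B, ∀ t ≤ 0, |G t| ≤ B := by
    refine ⟨C * (1 + 3 * M) + 1 / 6 * (1 + C * (1 + 3 * M)) * (13 + 36 * M) + C' * M, ?_⟩
    intro t ht
    obtain ⟨h1, h2⟩ := hbd t ht
    have p := h.ph t ht
    have hO0 := p.O0
    have hp0 : 0 ≤ x t * y t * z t := mul_nonneg (mul_nonneg p.x0 p.y0) p.z0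
    have e1 : |C * O t| ≤ C * (1 + 3 * M) := by
      rw [abs_of_nonneg (by positivity)]
      exact mul_le_mul_of_nonneg_left h1 hC
    have e2 : |1 / 6 * (1 + C * O t) * VL (b t) (c t) (y t) (z t)| ≤
        1 / 6 * (1 + C * (1 + 3 * M)) * (13 + 36 * M) := by
      rw [abs_mul, abs_of_nonneg (by positivity)]
      apply mul_le_mul _ h2 (abs_nonneg _) (by positivity)
      have := mul_le_mul_of_nonneg_left h1 hC
      linarith
    have e3 : |C' * (x t * y t * z t)| ≤ C' * M := by
      rw [abs_of_nonneg (by positivity)]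
      exact mul_le_mul_of_nonneg_left (hpM t ht) hC'
    simp only [hG]
    refine (abs_add_le _ _).trans ?_
    refine add_le_add ((abs_sub _ _).trans (add_le_add e1 e2)) e3
  have hmono : ∀ t s : ℝ, t ≤ s → s ≤ 0 → (∀ r ∈ Icc t s, K ≤ y r * z r) →
      y t * z t ≤ y s * z s * Real.exp (2 * B) := by
    intro t s hts hs hr
    have hd : ∀ r ∈ Icc t s, HasDerivAt (fun r => (Real.log (y r) + Real.log (z r)) + G r)
        ((2 * qv w (O r) (a r) (b r) (c r) - 2 * a r)
          + C * ((2 * qv w (O r) (a r) (b r) (c r) - w) * O r)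
      - 1 / 6 * (1 + C * O r) * ((b r - c r) ^ 2 - 9 * (y r - z r) ^ 2
        - (2 - qv w (O r) (a r) (b r) (c r)) * VL (b r) (c r) (y r) (z r)
        - VL (b r) (c r) (y r) (z r) ^ 2 + 9 * x r * ((y r - z r) ^ 2 / (y r + z r)))
      - 1 / 6 * (C * ((2 * qv w (O r) (a r) (b r) (c r) - w) * O r)) * VL (b r) (c r) (y r) (z r)
      + C' * (3 * qv w (O r) (a r) (b r) (c r) * (x r * y r * z r))) r := by
      intro r hrm
      have hr0 : r ∈ Iic (0:ℝ) := hrm.2.trans hs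
      have d1 := h.hlog hr0 (hy r hr0) (hz r hr0)
      have d2 := (h.hO r hr0).const_mul C
      have d3 := h.hV hr0 (add_pos (hy r hr0) (hz r hr0))
      have d4 := (h.hp hr0).const_mul C'
      have d5 := ((d2.const_add 1).const_mul (1 / 6)).mul d3
      refine (d1.add ((d2.sub d5).add d4)).congr_deriv ?_
      ring
    have := mono_of_hasDeriv (convex_Icc t s) hd (by
      intro r hrm
      have hr0 : r ≤ 0 := hrm.2.trans hs
      obtain ⟨k1, k2, k3, k4⟩ := hK _ _ _ _ _ _ _ (h.ph r hr0) (hpM r hr0) (hr r hrm)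
      exact hΨ _ _ _ _ _ _ _ (h.ph r hr0) k1 k2 k3 k4) ⟨le_rfl, hts⟩ ⟨hts, le_rfl⟩ hts
    simp only at this
    have ht := hts.trans hs
    rw [← Real.log_mul (hy t ht).ne' (hz t ht).ne', ← Real.log_mul (hy s hs).ne' (hz s hs).ne'] at this
    have b1 := abs_le.1 (hB t ht)
    have b2 := abs_le.1 (hB s hs)
    have p1 := mul_pos (hy t ht) (hz t ht)
    have p2 := mul_pos (hy s hs) (hz s hs)
    rw [← Real.exp_log p1, ← Real.exp_log p2, ← Real.exp_add]
    apply Real.exp_le_exp.2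
    linarith
  have hB0 : 0 ≤ B := (abs_nonneg _).trans (hB 0 le_rfl)
  have hexp : 1 ≤ Real.exp (2 * B) := Real.one_le_exp (by positivity)
  have hK0 : 0 < K := by linarith
  have hyz0 := mul_pos (hy 0 le_rfl) (hz 0 le_rfl)
  refine ⟨(K + y 0 * z 0) * Real.exp (2 * B), ?_⟩
  intro t ht
  by_cases hc : ∀ r ∈ Icc t 0, K ≤ y r * z r
  · refine (hmono t 0 ht le_rfl hc).trans ?_
    apply mul_le_mul_of_nonneg_right _ (by positivity)
    linarith
  · push Not at hc
    obtain ⟨τ₀, hτ, hlt⟩ := hc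
    rcases le_or_gt (y t * z t) K with hle | hgt
    · nlinarith
    · obtain ⟨σ, hσ1, hσ2, hσ3⟩ := hit_right (G := fun r => -(y r * z r)) (ε := -K) hτ.1 (by
        intro r hr
        have hr0 : r ∈ Iic (0:ℝ) := hr.2.trans hτ.2
        exact ((h.hy r hr0).mul (h.hz r hr0)).neg.continuousAt.continuousWithinAt)
        (by linarith) (by linarith)
      refine (hmono t σ hσ1.1 (hσ1.2.trans hτ.2) (fun r hr => by linarith [hσ3 r hr])).trans ?_
      apply mul_le_mul_of_nonneg_right _ (by positivity)
      linarith

lemma Loc.bdd (h : Loc w (Iic 0) O a b c x y z) (hw0 : 0 < w) (hw4 : w < 4)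
    (hx : ∀ t ≤ 0, 0 < x t) (hy : ∀ t ≤ 0, 0 < y t) (hz : ∀ t ≤ 0, 0 < z t) :
    ∃ M, ∀ t ≤ 0, |O t| ≤ M ∧ |a t| ≤ M ∧ |b t| ≤ M ∧ |c t| ≤ M ∧ |x t| ≤ M ∧ |y t| ≤ M ∧
      |z t| ≤ M := by
  obtain ⟨K1, h1⟩ := h.pair_bdd hw0 hw4 hy hz
  obtain ⟨K2, h2⟩ := h.rot.pair_bdd hw0 hw4 hz hx
  obtain ⟨K3, h3⟩ := h.rot.rot.pair_bdd hw0 hw4 hx hy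
  set K := K1 + K2 + K3
  have sq1 : ∀ r B : ℝ, r ^ 2 ≤ B → |r| ≤ 1 + B := by
    intro r B hr
    rw [← sq_abs] at hr
    nlinarith [sq_nonneg (|r| - 1), sq_nonneg (|r|)]
  have hsum : ∀ t ≤ 0, x t * y t + y t * z t + z t * x t ≤ K := by
    intro t ht
    linarith [h1 t ht, h2 t ht, h3 t ht]
  have hK0 : 0 ≤ K := by
    have := hsum 0 le_rfl
    have := mul_pos (hx 0 le_rfl) (hy 0 le_rfl)
    have := mul_pos (hy 0 le_rfl) (hz 0 le_rfl)
    have := mul_pos (hz 0 le_rfl) (hx 0 le_rfl)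
    linarith
  refine ⟨1 + (6 + 9 * K), ?_⟩
  intro t ht
  have p := h.ph t ht
  have hc := p.con
  have hO := p.O0
  have hs := hsum t ht
  have s1 := sq_nonneg (a t)
  have s2 := sq_nonneg (b t)
  have s3 := sq_nonneg (c t)
  have s4 := sq_nonneg (x t)
  have s5 := sq_nonneg (y t)
  have s6 := sq_nonneg (z t)
  refine ⟨?_, ?_, ?_, ?_, ?_, ?_, ?_⟩
  · rw [abs_of_nonneg hO]; linarith
  all_goals
    apply sq1
    linarith

end

/-! ### Framework for alpha-limit sets -/

def Fpt : VV := (1, fun _ => 0, fun _ => 0)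

def PN (w : ℝ) : ℝ := Real.sqrt (w / 12 * (1 - w / 4))

def Ppt (w : ℝ) (i : Fin 3) : VV :=
  (1 - w / 16, fun m => if m = i then -(w / 4) else w / 8, fun m => if m = i then PN w else 0)

structure Ctx (w : ℝ) (X : ℝ → VV) : Prop where
  w0 : 0 < w
  w4 : w < 4
  sol : Sol w (Iic 0) X
  pos : ∀ t ≤ 0, ∀ i, 0 < (X t).2.2 i
  notTaub : ∀ i j k, Dist3 i j k →
    ¬ ∀ t ≤ 0, (X t).2.1 j = (X t).2.1 k ∧ (X t).2.2 j = (X t).2.2 k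
  notF : ¬ Tendsto X atBot (𝓝 Fpt)
  notP : ∀ i, ¬ Tendsto X atBot (𝓝 (Ppt w i))

def AL (X : ℝ → VV) : Set VV := {v | MapClusterPt v atBot X}

structure Orb (w : ℝ) (X Y : ℝ → VV) : Prop where
  sol : Sol w univ Y
  mem : ∀ s, Y s ∈ AL X

lemma const_deriv_zero {f : ℝ → ℝ} {d t c : ℝ} (hf : HasDerivAt f d t) (hc : ∀ s, f s = c) :
    d = 0 := by
  have : f = fun _ => c := funext hc
  rw [this] at hf
  exact hf.unique (hasDerivAt_const t c)

lemma const_deriv_zero_of_lt {f : ℝ → ℝ} {d t c T : ℝ} (hf : HasDerivAt f d t) (ht : t < T)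
    (hc : ∀ s < T, f s = c) : d = 0 := by
  have h1 : f =ᶠ[𝓝 t] fun _ => c := by
    filter_upwards [gt_mem_nhds ht] with s hs using hc s hs
  exact (hf.congr_of_eventuallyEq h1.symm).unique (hasDerivAt_const t c)

lemma UF_le : UF ≤ atTop := Nat.hyperfilter_le_atTop

lemma natCast_UF : Tendsto (fun n : ℕ => (n : ℝ)) UF atTop :=
  tendsto_natCast_atTop_atTop.mono_left UF_le

lemma neg_natCast_UF : Tendsto (fun n : ℕ => -(n : ℝ)) UF atBot :=
  tendsto_neg_atTop_atBot.comp natCast_UF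

lemma UF_eventually_const {p : Prop} (h : ∀ᶠ _n in UF, p) : p := by
  obtain ⟨_, h⟩ := h.exists
  exact h

lemma vv_norm_le {v : VV} {M : ℝ} (h0 : |v.1| ≤ M) (h1 : ∀ i, |v.2.1 i| ≤ M)
    (h2 : ∀ i, |v.2.2 i| ≤ M) : ‖v‖ ≤ M := by
  have hM : 0 ≤ M := (abs_nonneg _).trans h0
  rw [norm_prod_le_iff, norm_prod_le_iff, pi_norm_le_iff_of_nonneg hM, pi_norm_le_iff_of_nonneg hM]
  exact ⟨h0, h1, h2⟩

lemma vv_coord {v : VV} : |v.1| ≤ ‖v‖ ∧ (∀ i, |v.2.1 i| ≤ ‖v‖) ∧ (∀ i, |v.2.2 i| ≤ ‖v‖) := by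
  refine ⟨norm_fst_le v, fun i => ?_, fun i => ?_⟩
  · exact (norm_le_pi_norm v.2.1 i).trans ((norm_fst_le v.2).trans (norm_snd_le v))
  · exact (norm_le_pi_norm v.2.2 i).trans ((norm_snd_le v.2).trans (norm_snd_le v))

lemma d012 : Dist3 0 1 2 := ⟨by decide, by decide, by decide⟩

lemma AL_closed (X : ℝ → VV) : IsClosed (AL X) := isClosed_setOfPred_clusterPt

lemma AL_of_seq {X : ℝ → VV} {t : ℕ → ℝ} {v : VV} (ht : Tendsto t UF atBot)
    (h : Tendsto (fun n => X (t n)) UF (𝓝 v)) : v ∈ AL X :=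
  MapClusterPt.of_comp ht h.mapClusterPt

lemma AL_seq' {X : ℝ → VV} {v : VV} (hv : v ∈ AL X) :
    ∃ t : ℕ → ℝ, Tendsto t atTop atBot ∧ Tendsto (fun n => X (t n)) atTop (𝓝 v) := by
  have h1 : (atBot ⊓ comap X (𝓝 v)).NeBot := by
    have : MapClusterPt v atBot X := hv
    rw [MapClusterPt, ClusterPt, inf_comm] at this
    rw [← Filter.map_neBot_iff X, Filter.push_pull]
    exact this
  obtain ⟨t, ht⟩ := exists_seq_tendsto (atBot ⊓ comap X (𝓝 v))
  rw [tendsto_inf] at ht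
  exact ⟨t, ht.1, tendsto_comap_iff.1 ht.2⟩

lemma AL_seq {X : ℝ → VV} {v : VV} (hv : v ∈ AL X) :
    ∃ t : ℕ → ℝ, Tendsto t UF atBot ∧ Tendsto (fun n => X (t n)) UF (𝓝 v) := by
  obtain ⟨t, h1, h2⟩ := AL_seq' hv
  exact ⟨t, h1.mono_left UF_le, h2.mono_left UF_le⟩

section
variable {w : ℝ} {X : ℝ → VV}

lemma Ctx.bdd (C : Ctx w X) : ∃ M, ∀ t ∈ Iic (0:ℝ), ‖X t‖ ≤ M := by
  obtain ⟨M, hM⟩ := (C.sol.loc d012).bdd C.w0 C.w4 (fun t ht => C.pos t ht 0)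
    (fun t ht => C.pos t ht 1) (fun t ht => C.pos t ht 2)
  refine ⟨M, fun t ht => ?_⟩
  obtain ⟨h1, h2, h3, h4, h5, h6, h7⟩ := hM t ht
  exact vv_norm_le h1 (d012.all h2 h3 h4) (d012.all h5 h6 h7)

lemma Ctx.AL_bdd (C : Ctx w X) : ∃ M, 0 ≤ M ∧ ∀ v ∈ AL X, ‖v‖ ≤ M := by
  obtain ⟨M, hM⟩ := C.bdd
  refine ⟨M, (norm_nonneg _).trans (hM 0 (le_refl (0:ℝ))), fun v hv => ?_⟩
  obtain ⟨t, h1, h2⟩ := AL_seq hv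
  refine le_of_tendsto h2.norm ?_
  filter_upwards [h1.eventually (eventually_le_atBot 0)] with n hn using hM _ hn

lemma Ctx.AL_phys (C : Ctx w X) {v : VV} (hv : v ∈ AL X) : Phys v := by
  obtain ⟨t, h1, h2⟩ := AL_seq hv
  refine Phys_closed.mem_of_tendsto h2 ?_
  filter_upwards [h1.eventually (eventually_le_atBot 0)] with n hn using C.sol.ph _ hn

lemma shift_mem {t : ℕ → ℝ} (ht : Tendsto t UF atBot) (c : ℝ) : ∀ᶠ n in UF, t n + c ∈ Iic (0:ℝ) :=
  (tendsto_atBot_add_const_right _ c ht).eventually (eventually_le_atBot 0)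

lemma Ctx.limit (C : Ctx w X) {t : ℕ → ℝ} (ht : Tendsto t UF atBot) :
    ∃ Z, LimAlong X t Z ∧ Orb w X Z := by
  obtain ⟨M, hM⟩ := C.bdd
  obtain ⟨Z, h1, h2⟩ := exists_limit (FF_contDiff w) (S := Iic 0) ordConnected_Iic C.sol.d hM
    (shift_mem ht)
  have hmem : ∀ s, Z s ∈ AL X := fun s =>
    AL_of_seq (tendsto_atBot_add_const_right _ s ht) (h1 s)
  exact ⟨Z, h1, ⟨fun s _ => h2 s, fun s _ => C.AL_phys (hmem s)⟩, hmem⟩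

lemma Ctx.through (C : Ctx w X) {v : VV} (hv : v ∈ AL X) :
    ∃ (t : ℕ → ℝ) (Z : ℝ → VV), Tendsto t UF atBot ∧ LimAlong X t Z ∧ Orb w X Z ∧ Z 0 = v := by
  obtain ⟨t, h1, h2⟩ := AL_seq hv
  obtain ⟨Z, h3, h4⟩ := C.limit h1
  refine ⟨t, Z, h1, h3, h4, ?_⟩
  have := h3 0
  simp only [add_zero] at this
  exact tendsto_nhds_unique this h2

lemma Orb.limit (C : Ctx w X) {Y : ℝ → VV} (hY : Orb w X Y) (t : ℕ → ℝ) :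
    ∃ Z, LimAlong Y t Z ∧ Orb w X Z := by
  obtain ⟨M, -, hM⟩ := C.AL_bdd
  obtain ⟨Z, h1, h2⟩ := exists_limit (FF_contDiff w) (S := univ) ordConnected_univ hY.sol.d
    (fun τ _ => hM _ (hY.mem τ)) (t := t) (fun c => Eventually.of_forall fun _ => mem_univ _)
  have hmem : ∀ s, Z s ∈ AL X := fun s =>
    (AL_closed X).mem_of_tendsto (h1 s) (Eventually.of_forall fun n => hY.mem _)
  exact ⟨Z, h1, ⟨fun s _ => h2 s, fun s _ => C.AL_phys (hmem s)⟩, hmem⟩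

lemma Orb.loc {Y : ℝ → VV} (hY : Orb w X Y) {i j k : Fin 3} (d : Dist3 i j k) :
    Loc w univ (fun t => (Y t).1) (fun t => (Y t).2.1 i) (fun t => (Y t).2.1 j)
      (fun t => (Y t).2.1 k) (fun t => (Y t).2.2 i) (fun t => (Y t).2.2 j)
      (fun t => (Y t).2.2 k) := hY.sol.loc d

lemma Orb.shift {Y : ℝ → VV} (hY : Orb w X Y) (r : ℝ) : Orb w X (fun s => Y (r + s)) := by
  refine ⟨⟨fun t _ => ?_, fun t _ => hY.sol.ph _ (mem_univ _)⟩, fun s => hY.mem _⟩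
  have := (hY.sol.d (r + t) (mem_univ _)).scomp t ((hasDerivAt_id t).const_add r)
  simpa [Function.comp_def] using this

lemma LimAlong.comp {t : ℕ → ℝ} {Y Z : ℝ → VV} (h : LimAlong Y t Z) {g : VV → ℝ}
    (hg : Continuous g) (s : ℝ) : Tendsto (fun n => g (Y (t n + s))) UF (𝓝 (g (Z s))) :=
  (hg.tendsto _).comp (h s)

/-- uniform bounds for orbits in `AL X` -/
lemma Ctx.q_bdd (C : Ctx w X) : ∃ B : ℝ, 0 ≤ B ∧ ∀ v ∈ AL X, ∀ i j k, Dist3 i j k →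
    |qv w v.1 (v.2.1 i) (v.2.1 j) (v.2.1 k)| ≤ B ∧ |v.1| ≤ B ∧ |v.2.1 i| ≤ B ∧ |v.2.2 i| ≤ B := by
  obtain ⟨M, hM0, hM⟩ := C.AL_bdd
  refine ⟨M + (w / 2 * M + M ^ 2), by have := C.w0; positivity, fun v hv i j k d => ?_⟩
  obtain ⟨h1, h2, h3⟩ := vv_coord (v := v)
  have hv' := hM v hv
  have hw := C.w0
  have hO := (C.AL_phys hv).O0
  have hpos : 0 ≤ w / 2 * M + M ^ 2 := by positivity
  have sqb : ∀ m, (v.2.1 m) ^ 2 ≤ M ^ 2 := fun m => by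
    rw [← sq_abs]; exact pow_le_pow_left₀ (abs_nonneg _) ((h2 m).trans hv') 2
  refine ⟨?_, by linarith, by linarith [h2 i], by linarith [h3 i]⟩
  rw [abs_of_nonneg (by unfold qv; positivity)]
  unfold qv
  have := abs_of_nonneg hO
  have : w / 2 * v.1 ≤ w / 2 * M := mul_le_mul_of_nonneg_left (by linarith) (by positivity)
  linarith [sqb i, sqb j, sqb k]

lemma Orb.N_zero (C : Ctx w X) {Y : ℝ → VV} (hY : Orb w X Y) {i : Fin 3} {s₀ : ℝ}
    (h : (Y s₀).2.2 i = 0) : ∀ s, (Y s).2.2 i = 0 := by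
  obtain ⟨B, hB0, hB⟩ := C.q_bdd
  obtain ⟨j, k, d⟩ := Dist3.exists_of i
  have := zero_persist_lin (S := univ) convex_univ (hY.loc d).hx (C := B + 2 * B) (by
    intro t _
    obtain ⟨h1, h2, h3, h4⟩ := hB _ (hY.mem t) i j k d
    refine (abs_add_le _ _).trans (add_le_add h1 ?_)
    rw [abs_mul, abs_two]
    linarith) (mem_univ s₀) h
  exact fun s => this s (mem_univ s)

lemma Orb.O_zero (C : Ctx w X) {Y : ℝ → VV} (hY : Orb w X Y) {s₀ : ℝ}
    (h : (Y s₀).1 = 0) : ∀ s, (Y s).1 = 0 := by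
  obtain ⟨B, hB0, hB⟩ := C.q_bdd
  have := zero_persist_lin (S := univ) convex_univ (hY.loc d012).hO (C := 2 * B + w) (by
    intro t _
    obtain ⟨h1, h2, h3, h4⟩ := hB _ (hY.mem t) 0 1 2 d012
    refine (abs_sub _ _).trans (add_le_add ?_ (abs_of_pos C.w0).le)
    rw [abs_mul, abs_two]
    linarith) (mem_univ s₀) h
  exact fun s => this s (mem_univ s)

lemma Ctx.AL_prod (C : Ctx w X) {v : VV} (hv : v ∈ AL X) {i j k : Fin 3} (d : Dist3 i j k) :
    v.2.2 i * v.2.2 j * v.2.2 k = 0 := by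
  -- the product is monotone, hence has a limit
  have hL := C.sol.loc d
  have hmono : MonotoneOn (fun t => (X t).2.2 i * (X t).2.2 j * (X t).2.2 k) (Iic 0) := by
    refine mono_of_hasDeriv (convex_Iic 0) (fun t ht => hL.hp ht) (fun t ht => ?_)
    have h1 := (hL.ph t ht).q_nonneg C.w0.le
    have := (C.pos t ht i).le
    have := (C.pos t ht j).le
    have := (C.pos t ht k).le
    positivity
  obtain ⟨p, hp⟩ : ∃ p, Tendsto (fun t => (X t).2.2 i * (X t).2.2 j * (X t).2.2 k) atBot (𝓝 p) := by
    have hm2 : Monotone (fun t => (X (min t 0)).2.2 i * (X (min t 0)).2.2 j * (X (min t 0)).2.2 k) :=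
      fun a b hab => hmono (mem_Iic.2 (min_le_right a 0)) (mem_Iic.2 (min_le_right b 0)) (min_le_min_right _ hab)
    have hbb : BddBelow (range (fun t => (X (min t 0)).2.2 i * (X (min t 0)).2.2 j * (X (min t 0)).2.2 k)) := by
      refine ⟨0, ?_⟩
      rintro _ ⟨t, rfl⟩
      have := (C.pos (min t 0) (min_le_right _ _) i).le
      have := (C.pos (min t 0) (min_le_right _ _) j).le
      have := (C.pos (min t 0) (min_le_right _ _) k).le
      positivity
    refine ⟨_, (tendsto_atBot_ciInf hm2 hbb).congr' ?_⟩
    filter_upwards [eventually_le_atBot (0:ℝ)] with t ht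
    rw [min_eq_left ht]
  obtain ⟨t, Z, ht, hZ, hO, hZ0⟩ := C.through hv
  have hZp : ∀ s, (Z s).2.2 i * (Z s).2.2 j * (Z s).2.2 k = p := by
    intro s
    have h1 := hZ.comp (g := fun v => v.2.2 i * v.2.2 j * v.2.2 k) (by fun_prop) s
    exact tendsto_nhds_unique h1 (hp.comp (tendsto_atBot_add_const_right _ s ht))
  rw [← hZ0, hZp 0]
  by_contra hp0
  have hloc := hO.loc d
  have hq : ∀ s, qv w (Z s).1 ((Z s).2.1 i) ((Z s).2.1 j) ((Z s).2.1 k) = 0 := by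
    intro s
    have := const_deriv_zero (hloc.hp (mem_univ s)) hZp
    simp only [hZp s] at this
    rcases mul_eq_zero.1 this with h | h
    · linarith
    · exact absurd h hp0
  have hz : ∀ s, (Z s).1 = 0 ∧ (Z s).2.1 i = 0 ∧ (Z s).2.1 j = 0 ∧ (Z s).2.1 k = 0 := by
    intro s
    have h1 := hq s
    have h2 := (hloc.ph s (mem_univ s)).O0
    unfold qv at h1
    have hw := C.w0
    have e0 : 0 ≤ w / 2 * (Z s).1 := by positivity
    have e1 := sq_nonneg ((Z s).2.1 i)
    have e2 := sq_nonneg ((Z s).2.1 j)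
    have e3 := sq_nonneg ((Z s).2.1 k)
    refine ⟨?_, ?_, ?_, ?_⟩
    · have : w / 2 * (Z s).1 = 0 := by linarith
      rcases mul_eq_zero.1 this with h | h
      · linarith
      · exact h
    all_goals
      apply pow_eq_zero_iff (two_ne_zero) |>.1
      linarith
  have c1 := const_deriv_zero (hloc.ha 0 (mem_univ 0)) (fun s => (hz s).2.1)
  have c2 := const_deriv_zero (hloc.hb 0 (mem_univ 0)) (fun s => (hz s).2.2.1)
  have c3 := const_deriv_zero (hloc.hc 0 (mem_univ 0)) (fun s => (hz s).2.2.2)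
  obtain ⟨z1, z2, z3, z4⟩ := hz 0
  have ph := hloc.ph 0 (mem_univ 0)
  have hc := ph.con
  have x0 := ph.x0
  have y0 := ph.y0
  simp only [z1, z2, z3, z4] at hc c1 c2 c3
  set x := (Z 0).2.2 i
  set y := (Z 0).2.2 j
  set z := (Z 0).2.2 k
  have k1 : x * (x - y - z) = 4 / 9 := by linarith
  have k2 : y * (y - x - z) = 4 / 9 := by linarith
  have z0 := ph.z0
  have p1 : 0 < x - y - z := by
    by_contra hcon
    push Not at hcon
    linarith [mul_nonpos_of_nonneg_of_nonpos x0 hcon]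
  have p2 : 0 < y - x - z := by
    by_contra hcon
    push Not at hcon
    linarith [mul_nonpos_of_nonneg_of_nonpos y0 hcon]
  have : (0:ℝ) ≤ z := z0
  linarith

end

lemma mono_lim_top {f : ℝ → ℝ} {B T : ℝ} (hm : MonotoneOn f (Ici T)) (hb : ∀ t ∈ Ici T, f t ≤ B) :
    ∃ c, Tendsto f atTop (𝓝 c) := by
  have hm2 : Monotone (fun t => f (max t T)) := fun a b hab =>
    hm (mem_Ici.2 (le_max_right a T)) (mem_Ici.2 (le_max_right b T)) (max_le_max_right _ hab)
  have hbb : BddAbove (range (fun t => f (max t T))) := by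
    refine ⟨B, ?_⟩
    rintro _ ⟨t, rfl⟩
    exact hb _ (mem_Ici.2 (le_max_right _ _))
  refine ⟨_, (tendsto_atTop_ciSup hm2 hbb).congr' ?_⟩
  filter_upwards [eventually_ge_atTop T] with t ht
  rw [max_eq_left ht]

lemma mono_lim_bot {f : ℝ → ℝ} {B T : ℝ} (hm : MonotoneOn f (Iic T)) (hb : ∀ t ∈ Iic T, B ≤ f t) :
    ∃ c, Tendsto f atBot (𝓝 c) := by
  have hm2 : Monotone (fun t => f (min t T)) := fun a b hab =>
    hm (mem_Iic.2 (min_le_right a T)) (mem_Iic.2 (min_le_right b T)) (min_le_min_right _ hab)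
  have hbb : BddBelow (range (fun t => f (min t T))) := by
    refine ⟨B, ?_⟩
    rintro _ ⟨t, rfl⟩
    exact hb _ (mem_Iic.2 (min_le_right _ _))
  refine ⟨_, (tendsto_atBot_ciInf hm2 hbb).congr' ?_⟩
  filter_upwards [eventually_le_atBot T] with t ht
  rw [min_eq_left ht]

def Kas (v : VV) : Prop := v.1 = 0 ∧ ∀ i, v.2.2 i = 0

def TL (i : Fin 3) (v : VV) : Prop := v.1 = 0 ∧ v.2.1 i = 2 ∧ v.2.2 i = 0

lemma lim_zero {t : ℕ → ℝ} {Y Z : ℝ → VV} (h : LimAlong Y t Z) {g : VV → ℝ}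
    (hg : Continuous g) (h0 : ∀ s, g (Y s) = 0) (s : ℝ) : g (Z s) = 0 := by
  have := h.comp hg s
  simp only [h0] at this
  exact (tendsto_nhds_unique this tendsto_const_nhds)

lemma shift_bot {t : ℕ → ℝ} (ht : Tendsto t UF atBot) (s : ℝ) : Tendsto (fun n => t n + s) UF atBot :=
  tendsto_atBot_add_const_right _ s ht

lemma shift_top {t : ℕ → ℝ} (ht : Tendsto t UF atTop) (s : ℝ) : Tendsto (fun n => t n + s) UF atTop :=
  tendsto_atTop_add_const_right _ s ht

/-- value of `g` is constant along a limit if `g ∘ Y` converges -/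
lemma lim_const {t : ℕ → ℝ} {Y Z : ℝ → VV} (h : LimAlong Y t Z) {g : VV → ℝ}
    (hg : Continuous g) {l : Filter ℝ} (ht : ∀ s, Tendsto (fun n => t n + s) UF l) {c : ℝ}
    (hc : Tendsto (fun s => g (Y s)) l (𝓝 c)) (s : ℝ) : g (Z s) = c :=
  tendsto_nhds_unique (h.comp hg s) (hc.comp (ht s))

section
variable {w : ℝ} {X : ℝ → VV}

lemma Orb.N_pos (C : Ctx w X) {Y : ℝ → VV} (hY : Orb w X Y) {i : Fin 3} {s₀ : ℝ}
    (h : (Y s₀).2.2 i ≠ 0) (s : ℝ) : 0 < (Y s).2.2 i := by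
  obtain ⟨j, k, d⟩ := Dist3.exists_of i
  rcases ((hY.loc d).ph s (mem_univ s)).x0.lt_or_eq with h1 | h1
  · exact h1
  · exact absurd (hY.N_zero C h1.symm s₀) h

lemma Orb.O_pos (C : Ctx w X) {Y : ℝ → VV} (hY : Orb w X Y) {s₀ : ℝ}
    (h : (Y s₀).1 ≠ 0) (s : ℝ) : 0 < (Y s).1 := by
  rcases ((hY.loc d012).ph s (mem_univ s)).O0.lt_or_eq with h1 | h1
  · exact h1
  · exact absurd (hY.O_zero C h1.symm s₀) h

/-- vacuum with `x = 0`: derivative of `a` -/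
lemma PhysL.vac_a {w O a b c x y z : ℝ} (h : PhysL O a b c x y z) (hO : O = 0) (hx : x = 0) :
    -(2 - qv w O a b c) * a - 3 * (-(y - z) ^ 2 + x * (2 * x - y - z))
      = 3 / 2 * (y - z) ^ 2 * (2 - a) ∧ a ≤ 2 ∧ -2 ≤ a := by
  have h1 := h.two_sub_q w
  have h2 := h.con2
  subst hO hx
  refine ⟨?_, ?_, ?_⟩
  · rw [h1]; ring
  · nlinarith [sq_nonneg (b - c), sq_nonneg (y - z)]
  · nlinarith [sq_nonneg (b - c), sq_nonneg (y - z)]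

lemma Orb.vac_mono {Y : ℝ → VV} (hY : Orb w X Y) (hO : ∀ s, (Y s).1 = 0)
    {i : Fin 3} (hx : ∀ s, (Y s).2.2 i = 0) : Monotone (fun s => (Y s).2.1 i) := by
  obtain ⟨j, k, d⟩ := Dist3.exists_of i
  have hl := hY.loc d
  rw [← monotoneOn_univ]
  refine mono_of_hasDeriv convex_univ hl.ha (fun s _ => ?_)
  obtain ⟨h1, h2, h3⟩ := (hl.ph s (mem_univ s)).vac_a (w := w) (hO s) (hx s)
  rw [h1]
  have : 0 ≤ 2 - (Y s).2.1 i := by linarith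
  positivity

lemma Orb.vac_const (C : Ctx w X) {Z : ℝ → VV} (hZ : Orb w X Z) (hO : ∀ s, (Z s).1 = 0)
    {i : Fin 3} (hx : ∀ s, (Z s).2.2 i = 0) {c : ℝ} (hc : ∀ s, (Z s).2.1 i = c) :
    TL i (Z 0) ∨ Kas (Z 0) := by
  obtain ⟨j, k, d⟩ := Dist3.exists_of i
  have hl := hZ.loc d
  by_cases hc2 : c = 2
  · left
    exact ⟨hO 0, by rw [hc 0, hc2], hx 0⟩
  right
  have hD : ∀ s, (Z s).2.2 j - (Z s).2.2 k = 0 := by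
    intro s
    have h1 := const_deriv_zero (hl.ha s (mem_univ s)) hc
    rw [((hl.ph s (mem_univ s)).vac_a (w := w) (hO s) (hx s)).1, hc s] at h1
    rcases mul_eq_zero.1 h1 with h2 | h2
    · nlinarith
    · exact absurd (by linarith) hc2
  have huP : ∀ s, ((Z s).2.1 j - (Z s).2.1 k) * ((Z s).2.2 j + (Z s).2.2 k) = 0 := by
    intro s
    have h1 := const_deriv_zero (hl.hD (mem_univ s)) hD
    rw [hD s] at h1
    linarith
  by_cases hy0 : (Z 0).2.2 j = 0
  · have hz0 : (Z 0).2.2 k = 0 := by linarith [hD 0]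
    exact ⟨hO 0, d.all (hx 0) hy0 hz0⟩
  exfalso
  have hyp := hZ.N_pos C hy0
  have hu : ∀ s, (Z s).2.1 j - (Z s).2.1 k = 0 := by
    intro s
    rcases mul_eq_zero.1 (huP s) with h | h
    · exact h
    · have := ((hl.ph s (mem_univ s)).z0)
      linarith [hyp s]
  obtain ⟨B, hB0, hB⟩ := C.q_bdd
  have := growth_zero (f := fun s => (Z s).2.2 j) (lam := 2) (M := B) (by norm_num)
    (fun t _ => hl.hy t (mem_univ t)) (fun t _ => (hyp t).le) (by
      intro s _
      have p := hl.ph s (mem_univ s)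
      have h2 := p.con2
      have h3 := p.sum
      have h4 := hu s
      have h5 := p.two_sub_q w
      rw [hO s, hx s, hD s, hu s] at h2
      rw [hO s, hx s, hD s] at h5
      have h6 : ((Z s).2.1 i - 2) * ((Z s).2.1 i + 2) = 0 := by linarith
      have h7 : (Z s).2.1 i = -2 := by
        rcases mul_eq_zero.1 h6 with h | h
        · exact absurd (by linarith [hc s]) hc2
        · linarith
      have h8 : (Z s).2.1 j = 1 := by linarith
      rw [hO s, h8]
      have : qv w 0 ((Z s).2.1 i) 1 ((Z s).2.1 k) = 2 := by
        rw [h8] at h5; linarith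
      rw [this]
      linarith [(hyp s).le]) (by
      intro s _
      exact (le_abs_self _).trans (hB _ (hZ.mem s) j k i d.rot).2.2.2)
  exact hy0 this

lemma Orb.vac_alpha (C : Ctx w X) {Y : ℝ → VV} (hY : Orb w X Y) (hO : ∀ s, (Y s).1 = 0)
    {i : Fin 3} (hx : ∀ s, (Y s).2.2 i = 0) :
    ∃ v ∈ AL X, (TL i v ∨ Kas v) ∧ ∀ s, v.2.1 i ≤ (Y s).2.1 i := by
  obtain ⟨j, k, d⟩ := Dist3.exists_of i
  have hm := hY.vac_mono hO hx
  have hl := hY.loc d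
  obtain ⟨c, hc⟩ := mono_lim_bot (f := fun s => (Y s).2.1 i) (T := 0) (B := -2)
    (hm.monotoneOn _) (fun s _ => ((hl.ph s (mem_univ s)).vac_a (w := w) (hO s) (hx s)).2.2)
  obtain ⟨Z, hZ, hZO⟩ := hY.limit C (fun n => -(n:ℝ))
  have hZO0 : ∀ s, (Z s).1 = 0 := fun s => lim_zero hZ (g := fun v => v.1) (by fun_prop) hO s
  have hZx : ∀ s, (Z s).2.2 i = 0 := fun s =>
    lim_zero hZ (g := fun v => v.2.2 i) (by fun_prop) hx s
  have hZa : ∀ s, (Z s).2.1 i = c := fun s =>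
    lim_const hZ (g := fun v => v.2.1 i) (by fun_prop) (shift_bot neg_natCast_UF) hc s
  refine ⟨Z 0, hZO.mem 0, hZO.vac_const C hZO0 hZx hZa, fun s => ?_⟩
  rw [hZa 0]
  exact hm.le_of_tendsto hc s

lemma Orb.vac_omega (C : Ctx w X) {Y : ℝ → VV} (hY : Orb w X Y) (hO : ∀ s, (Y s).1 = 0)
    {i : Fin 3} (hx : ∀ s, (Y s).2.2 i = 0) :
    ∃ Z, LimAlong Y (fun n : ℕ => (n:ℝ)) Z ∧ Orb w X Z ∧ (TL i (Z 0) ∨ Kas (Z 0)) ∧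
      ∀ s, (Y s).2.1 i ≤ (Z 0).2.1 i := by
  obtain ⟨j, k, d⟩ := Dist3.exists_of i
  have hm := hY.vac_mono hO hx
  have hl := hY.loc d
  obtain ⟨c, hc⟩ := mono_lim_top (f := fun s => (Y s).2.1 i) (T := 0) (B := 2)
    (hm.monotoneOn _) (fun s _ => ((hl.ph s (mem_univ s)).vac_a (w := w) (hO s) (hx s)).2.1)
  obtain ⟨Z, hZ, hZO⟩ := hY.limit C (fun n => (n:ℝ))
  have hZO0 : ∀ s, (Z s).1 = 0 := fun s => lim_zero hZ (g := fun v => v.1) (by fun_prop) hO s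
  have hZx : ∀ s, (Z s).2.2 i = 0 := fun s =>
    lim_zero hZ (g := fun v => v.2.2 i) (by fun_prop) hx s
  have hZa : ∀ s, (Z s).2.1 i = c := fun s =>
    lim_const hZ (g := fun v => v.2.1 i) (by fun_prop) (shift_top natCast_UF) hc s
  refine ⟨Z, hZ, hZO, hZO.vac_const C hZO0 hZx hZa, fun s => ?_⟩
  rw [hZa 0]
  exact hm.ge_of_tendsto hc s

lemma Ctx.vac_pt (C : Ctx w X) {v : VV} (hv : v ∈ AL X) (hO : v.1 = 0) :
    ∃ v ∈ AL X, Kas v ∨ ∃ i, TL i v := by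
  obtain ⟨t, Z, ht, hZ, hZO, hZ0⟩ := C.through hv
  have hex : ∃ i, v.2.2 i = 0 := by
    have := C.AL_prod hv d012
    rcases mul_eq_zero.1 this with h | h
    · rcases mul_eq_zero.1 h with h | h
      · exact ⟨_, h⟩
      · exact ⟨_, h⟩
    · exact ⟨_, h⟩
  obtain ⟨i, hi⟩ := hex
  obtain ⟨v', h1, h2, -⟩ := hZO.vac_alpha C (hZO.O_zero C (s₀ := 0) (by rw [hZ0]; exact hO))
    (hZO.N_zero C (i := i) (s₀ := 0) (by rw [hZ0]; exact hi))
  exact ⟨v', h1, h2.symm.imp id fun h => ⟨i, h⟩⟩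

/-! nonvacuum orbits -/

lemma Ctx.AL_nonempty (C : Ctx w X) : (AL X).Nonempty := by
  obtain ⟨Z, -, hZ⟩ := C.limit neg_natCast_UF
  exact ⟨_, hZ.mem 0⟩

/-- type I rates -/
lemma PhysL.typeI {O a b c x y z : ℝ} (h : PhysL O a b c x y z) (hx : x = 0) (hy : y = 0)
    (hz : z = 0) (w : ℝ) : (2 * qv w O a b c - w) * O = (4 - w) * (O * (1 - O)) ∧ O ≤ 1 := by
  have h1 := h.con
  subst hx hy hz
  constructor
  · have : qv w O a b c = w / 2 * O + 2 * (1 - O) := by unfold qv; linarith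
    rw [this]; ring
  · nlinarith [sq_nonneg a, sq_nonneg b, sq_nonneg c]

lemma Orb.typeI_mono {Y : ℝ → VV} (C : Ctx w X) (hY : Orb w X Y) (hN : ∀ s i, (Y s).2.2 i = 0) :
    Monotone (fun s => (Y s).1) := by
  have hl := hY.loc d012
  rw [← monotoneOn_univ]
  refine mono_of_hasDeriv convex_univ hl.hO (fun s _ => ?_)
  obtain ⟨h1, h2⟩ := (hl.ph s (mem_univ s)).typeI (hN s 0) (hN s 1) (hN s 2) w
  rw [h1]
  have h3 := (hl.ph s (mem_univ s)).O0
  have h4 : 0 ≤ 1 - (Y s).1 := by linarith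
  have h5 := C.w4
  exact mul_nonneg (by linarith) (mul_nonneg h3 h4)

lemma Orb.typeI_const {Y : ℝ → VV} (C : Ctx w X) (hY : Orb w X Y) (hN : ∀ s i, (Y s).2.2 i = 0)
    {c : ℝ} (hc : ∀ s, (Y s).1 = c) : c = 0 ∨ (c = 1 ∧ Y 0 = Fpt) := by
  have hl := hY.loc d012
  have h1 := const_deriv_zero (hl.hO 0 (mem_univ 0)) hc
  have hp := hl.ph 0 (mem_univ 0)
  rw [(hp.typeI (hN 0 0) (hN 0 1) (hN 0 2) w).1, hc 0] at h1
  rcases mul_eq_zero.1 h1 with h2 | h2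
  · have := C.w4; linarith
  rcases mul_eq_zero.1 h2 with h3 | h3
  · exact Or.inl h3
  · right
    have hc1 : c = 1 := by linarith
    refine ⟨hc1, ?_⟩
    have h4 := hp.con
    rw [hc 0, hN 0 0, hN 0 1, hN 0 2, hc1] at h4
    have e1 := sq_nonneg ((Y 0).2.1 0)
    have e2 := sq_nonneg ((Y 0).2.1 1)
    have e3 := sq_nonneg ((Y 0).2.1 2)
    have hA : ∀ m, (Y 0).2.1 m = 0 := by
      refine d012.all (p := fun m => (Y 0).2.1 m = 0) ?_ ?_ ?_ <;>
      · apply pow_eq_zero_iff (two_ne_zero) |>.1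
        linarith
    refine Prod.ext ?_ (Prod.ext (funext fun m => ?_) (funext fun m => ?_))
    · rw [hc 0, hc1]; rfl
    · exact hA m
    · exact hN 0 m

lemma Ctx.typeI_F (C : Ctx w X) {v : VV} (hv : v ∈ AL X) (hO : v.1 ≠ 0) (hN : ∀ i, v.2.2 i = 0) :
    Fpt ∈ AL X := by
  obtain ⟨t, Y, ht, -, hY, hY0⟩ := C.through hv
  have hYN : ∀ s i, (Y s).2.2 i = 0 := fun s i =>
    hY.N_zero C (i := i) (s₀ := 0) (by rw [hY0]; exact hN i) s
  have hm := hY.typeI_mono C hYN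
  obtain ⟨c, hc⟩ := mono_lim_top (f := fun s => (Y s).1) (T := 0) (B := 1)
    (hm.monotoneOn _) (fun s _ => (((hY.loc d012).ph s (mem_univ s)).typeI (hYN s 0) (hYN s 1)
      (hYN s 2) w).2)
  obtain ⟨Z, hZ, hZO⟩ := hY.limit C (fun n => (n:ℝ))
  have hZN : ∀ s i, (Z s).2.2 i = 0 := fun s i => lim_zero hZ (g := fun v => v.2.2 i)
    (by fun_prop) (fun s => hYN s i) s
  have hZc : ∀ s, (Z s).1 = c := fun s =>
    lim_const hZ (g := fun v => v.1) (by fun_prop) (shift_top natCast_UF) hc s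
  have hcpos : 0 < c := by
    have h1 := hm.ge_of_tendsto hc 0
    have h2 := hY.O_pos C (s₀ := 0) (by rw [hY0]; exact hO) 0
    linarith
  rcases hZO.typeI_const C hZN hZc with h | h
  · linarith
  · rw [← h.2]; exact hZO.mem 0

end

section
variable {w : ℝ} {X : ℝ → VV}

lemma Ctx.AL_cbdd (C : Ctx w X) {H : VV → ℝ} (hH : Continuous H) :
    ∃ B, ∀ v ∈ AL X, |H v| ≤ B := by
  obtain ⟨M, -, hM⟩ := C.AL_bdd
  obtain ⟨B, hB⟩ := (isCompact_closedBall (0:VV) M).exists_bound_of_continuousOn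
    hH.continuousOn
  refine ⟨B, fun v hv => hB v ?_⟩
  simpa using hM v hv

lemma Orb.lyap_fwd (C : Ctx w X) {Y : ℝ → VV} (hY : Orb w X Y) {H : VV → ℝ} (hH : Continuous H)
    (hm : Monotone (fun s => H (Y s))) :
    ∃ Z c, LimAlong Y (fun n : ℕ => (n:ℝ)) Z ∧ Orb w X Z ∧ (∀ s, H (Z s) = c) ∧
      ∀ s, H (Y s) ≤ c := by
  obtain ⟨B, hB⟩ := C.AL_cbdd hH
  obtain ⟨c, hc⟩ := mono_lim_top (f := fun s => H (Y s)) (T := 0) (B := B)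
    (hm.monotoneOn _) (fun s _ => (le_abs_self _).trans (hB _ (hY.mem s)))
  obtain ⟨Z, hZ, hZO⟩ := hY.limit C (fun n => (n:ℝ))
  exact ⟨Z, c, hZ, hZO, fun s => lim_const hZ hH (shift_top natCast_UF) hc s,
    fun s => hm.ge_of_tendsto hc s⟩

lemma Orb.lyap_bwd (C : Ctx w X) {Y : ℝ → VV} (hY : Orb w X Y) {H : VV → ℝ} (hH : Continuous H)
    (hm : Monotone (fun s => H (Y s))) :
    ∃ Z c, LimAlong Y (fun n : ℕ => -(n:ℝ)) Z ∧ Orb w X Z ∧ (∀ s, H (Z s) = c) ∧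
      ∀ s, c ≤ H (Y s) := by
  obtain ⟨B, hB⟩ := C.AL_cbdd hH
  obtain ⟨c, hc⟩ := mono_lim_bot (f := fun s => H (Y s)) (T := 0) (B := -B)
    (hm.monotoneOn _) (fun s _ => (neg_le_of_abs_le (hB _ (hY.mem s))))
  obtain ⟨Z, hZ, hZO⟩ := hY.limit C (fun n => -(n:ℝ))
  exact ⟨Z, c, hZ, hZO, fun s => lim_const hZ hH (shift_bot neg_natCast_UF) hc s,
    fun s => hm.le_of_tendsto hc s⟩

/-! ### type VII₀ -/

def HS (w : ℝ) (i j k : Fin 3) (v : VV) : ℝ :=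
  v.1 ^ (4:ℝ) * (v.2.2 j ^ w * v.2.2 k ^ w) *
    Real.exp (-(2 * (4 + w)) * Real.log (max (1 - w / 8 * v.2.1 i) (1 - w / 4)))

lemma HS_cont {w : ℝ} (hw : 0 < w) (hw4 : w < 4) (i j k : Fin 3) : Continuous (HS w i j k) := by
  unfold HS
  have h1 : ∀ v : VV, max (1 - w / 8 * v.2.1 i) (1 - w / 4) ≠ 0 := fun v =>
    (lt_of_lt_of_le (by linarith) (le_max_right _ _)).ne'
  have h2 : Continuous (fun v : VV => Real.log (max (1 - w / 8 * v.2.1 i) (1 - w / 4))) :=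
    Continuous.log (by fun_prop) h1
  have h3 : Continuous (fun v : VV => v.1 ^ (4:ℝ)) :=
    Continuous.rpow_const (by fun_prop) (fun _ => Or.inr (by norm_num))
  have h4 : ∀ m, Continuous (fun v : VV => v.2.2 m ^ w) := fun m =>
    Continuous.rpow_const (by fun_prop) (fun _ => Or.inr hw.le)
  exact (h3.mul ((h4 j).mul (h4 k))).mul ((continuous_const.mul h2).rexp)

lemma VII_ident {w O a b c x y z : ℝ} (p : PhysL O a b c x y z) (hx : x = 0) :
    (4 * (2 * qv w O a b c - w) + w * (2 * qv w O a b c - 2 * a)) * (1 - w / 8 * a)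
      - (2 * (4 + w)) * (-(w / 8) * (-(2 - qv w O a b c) * a
        - 3 * (-(y - z) ^ 2 + x * (2 * x - y - z))))
    = (w - 2 * a) ^ 2 + (4 + w) * (4 - w) * (b - c) ^ 2 / 12 := by
  have h1 := p.two_sub_q w
  have h2 := p.con2
  subst hx
  have h3 : qv w O a b c = 2 - ((2 - w / 2) * O + 3 / 2 * (y - z) ^ 2) := by linarith
  have h4 : O = 1 - a ^ 2 / 4 - (b - c) ^ 2 / 12 - 3 / 4 * (y - z) ^ 2 := by linarith
  rw [h3, h4]; ring

lemma div_help {A c E κ : ℝ} (h : κ ≠ 0) : A - c * (E / κ) = (A * κ - c * E) / κ := by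
  field_simp

lemma Loc.hSder {w : ℝ} {O a b c x y z : ℝ → ℝ} (h : Loc w univ O a b c x y z) {t : ℝ}
    (hO : 0 < O t) (hy : 0 < y t) (hz : 0 < z t) (hx : x t = 0) (hk : 0 < 1 - w / 8 * a t) :
    HasDerivAt (fun t => 4 * Real.log (O t) + w * (Real.log (y t) + Real.log (z t))
      - (2 * (4 + w)) * Real.log (1 - w / 8 * a t))
      (((w - 2 * a t) ^ 2 + (4 + w) * (4 - w) * (b t - c t) ^ 2 / 12) / (1 - w / 8 * a t)) t := by
  have m := mem_univ t
  have h1 := ((h.hO t m).log hO.ne').const_mul 4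
  have h2 := (h.hlog m hy hz).const_mul w
  have h3 := ((((h.ha t m).const_mul (w / 8)).const_sub 1).log hk.ne').const_mul (2 * (4 + w))
  refine ((h1.add h2).sub h3).congr_deriv ?_
  rw [← VII_ident (h.ph t m) hx]
  have e1 : (2 * qv w (O t) (a t) (b t) (c t) - w) * O t / O t
    = (2 * qv w (O t) (a t) (b t) (c t) - w) := by field_simp
  rw [e1, div_help hk.ne']
  congr 1
  ring

lemma VII_a {O a b c x y z : ℝ} (p : PhysL O a b c x y z) (hx : x = 0) : a ≤ 2 := by
  have h2 := p.con2
  have h3 := p.O0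
  subst hx
  nlinarith [sq_nonneg (b - c), sq_nonneg (y - z)]

lemma HS_eq {w : ℝ} {i j k : Fin 3} {v : VV} (hw : 0 < w)
    (ha : v.2.1 i ≤ 2) (hO : 0 < v.1) (hy : 0 < v.2.2 j) (hz : 0 < v.2.2 k) :
    HS w i j k v = Real.exp (4 * Real.log v.1 + w * (Real.log (v.2.2 j) + Real.log (v.2.2 k))
      - (2 * (4 + w)) * Real.log (1 - w / 8 * v.2.1 i)) := by
  unfold HS
  have : max (1 - w / 8 * v.2.1 i) (1 - w / 4) = 1 - w / 8 * v.2.1 i := by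
    apply max_eq_left
    have := mul_le_mul_of_nonneg_left ha (by positivity : 0 ≤ w / 8)
    linarith
  rw [this, Real.rpow_def_of_pos hO, Real.rpow_def_of_pos hy, Real.rpow_def_of_pos hz,
    ← Real.exp_add, ← Real.exp_add, ← Real.exp_add]
  congr 1
  ring

lemma Orb.no_VII (C : Ctx w X) {Y : ℝ → VV} (hY : Orb w X Y) {i j k : Fin 3} (d : Dist3 i j k)
    (hx : (Y 0).2.2 i = 0) (hy : (Y 0).2.2 j ≠ 0) (hz : (Y 0).2.2 k ≠ 0) (hO : (Y 0).1 ≠ 0) :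
    False := by
  have hw := C.w0
  have hw4 := C.w4
  have key : ∀ {Y : ℝ → VV}, Orb w X Y → (∀ s, (Y s).2.2 i = 0) → (∀ s, 0 < (Y s).2.2 j) →
      (∀ s, 0 < (Y s).2.2 k) → (∀ s, 0 < (Y s).1) → (∀ s, (Y s).2.1 i ≤ 2) ∧
      (∀ s, 0 < 1 - w / 8 * (Y s).2.1 i) := by
    intro Y hY hx hy hz hO
    have ha : ∀ s, (Y s).2.1 i ≤ 2 := fun s => VII_a ((hY.loc d).ph s (mem_univ s)) (hx s)
    refine ⟨ha, fun s => ?_⟩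
    have := mul_le_mul_of_nonneg_left (ha s) (by positivity : 0 ≤ w / 8)
    linarith
  have hx' := hY.N_zero C hx
  have hy' := hY.N_pos C hy
  have hz' := hY.N_pos C hz
  have hO' := hY.O_pos C hO
  obtain ⟨ha, hk⟩ := key hY hx' hy' hz' hO'
  have hl := hY.loc d
  have hm0 := mono_of_hasDeriv convex_univ
    (fun s _ => hl.hSder (hO' s) (hy' s) (hz' s) (hx' s) (hk s)) (by
      intro s _
      have h4 : 0 ≤ 4 - w := by linarith
      exact div_nonneg (by positivity) (hk s).le)
  have hm : Monotone (fun s => HS w i j k (Y s)) := by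
    intro s t hst
    have := hm0 (mem_univ s) (mem_univ t) hst
    simp only [HS_eq hw (ha _) (hO' _) (hy' _) (hz' _)]
    exact Real.exp_le_exp.2 this
  obtain ⟨Z, c, hZ, hZO, hZc, hYc⟩ := hY.lyap_fwd C (HS_cont hw hw4 i j k) hm
  have hc : 0 < c := by
    refine lt_of_lt_of_le ?_ (hYc 0)
    rw [HS_eq hw (ha _) (hO' _) (hy' _) (hz' _)]
    exact Real.exp_pos _
  have hne : HS w i j k (Z 0) ≠ 0 := by rw [hZc 0]; exact hc.ne'
  unfold HS at hne
  have zx : ∀ s, (Z s).2.2 i = 0 := fun s =>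
    lim_zero hZ (g := fun v => v.2.2 i) (by fun_prop) hx' s
  have zO : ∀ s, 0 < (Z s).1 := hZO.O_pos C (s₀ := 0) (by
    intro h0; apply hne; rw [h0, Real.zero_rpow (by norm_num)]; ring)
  have zy : ∀ s, 0 < (Z s).2.2 j := hZO.N_pos C (s₀ := 0) (by
    intro h0; apply hne; rw [h0, Real.zero_rpow hw.ne']; ring)
  have zz : ∀ s, 0 < (Z s).2.2 k := hZO.N_pos C (s₀ := 0) (by
    intro h0; apply hne; rw [h0, Real.zero_rpow hw.ne']; ring)
  obtain ⟨za, zk⟩ := key hZO zx zy zz zO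
  have zl := hZO.loc d
  have hd : ∀ s, (w - 2 * (Z s).2.1 i) ^ 2 + (4 + w) * (4 - w) *
      ((Z s).2.1 j - (Z s).2.1 k) ^ 2 / 12 = 0 := by
    intro s
    have h1 := const_deriv_zero (c := Real.log c)
      (zl.hSder (zO s) (zy s) (zz s) (zx s) (zk s)) (by
        intro r
        have := hZc r
        rw [HS_eq hw (za _) (zO _) (zy _) (zz _)] at this
        rw [← this, Real.log_exp])
    rcases div_eq_zero_iff.1 h1 with h | h
    · exact h
    · exact absurd h (zk s).ne'
  have hprod : 0 < (4 + w) * (4 - w) := mul_pos (by linarith) (by linarith)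
  have hza : ∀ s, (Z s).2.1 i = w / 2 := by
    intro s
    have h1 := hd s
    have h2 : 0 ≤ (4 + w) * (4 - w) * ((Z s).2.1 j - (Z s).2.1 k) ^ 2 / 12 := by positivity
    have h3 : (w - 2 * (Z s).2.1 i) ^ 2 = 0 := le_antisymm (by linarith) (sq_nonneg _)
    have := (pow_eq_zero_iff two_ne_zero).1 h3
    linarith
  have hzu : ∀ s, (Z s).2.1 j - (Z s).2.1 k = 0 := by
    intro s
    have h1 := hd s
    rw [hza s] at h1
    have h2 : (4 + w) * (4 - w) * ((Z s).2.1 j - (Z s).2.1 k) ^ 2 = 0 := by linarith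
    rcases mul_eq_zero.1 h2 with h | h
    · exact absurd h hprod.ne'
    · exact (pow_eq_zero_iff two_ne_zero).1 h
  have hD : (Z 0).2.2 j - (Z 0).2.2 k = 0 := by
    have h1 := const_deriv_zero (zl.hu (mem_univ 0)) hzu
    rw [hzu 0, zx 0] at h1
    have h2 : ((Z 0).2.2 j - (Z 0).2.2 k) * ((Z 0).2.2 j + (Z 0).2.2 k) = 0 := by linarith
    rcases mul_eq_zero.1 h2 with h | h
    · exact h
    · linarith [zy 0, zz 0]
  have h1 := const_deriv_zero (zl.ha 0 (mem_univ 0)) hza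
  rw [(zl.ph 0 (mem_univ 0)).two_sub_q w, hD, zx 0, hza 0] at h1
  have h2 : 0 < (2 - w / 2) * (Z 0).1 * (w / 2) :=
    mul_pos (mul_pos (by linarith) (zO 0)) (by linarith)
  linarith

/-! ### type II -/

def HT (w : ℝ) (i : Fin 3) (v : VV) : ℝ :=
  v.1 ^ (2 - w / 8) * v.2.2 i ^ (w / 4 * (1 - w / 4)) *
    Real.exp (-(4 * (1 - (w / 8) ^ 2)) * Real.log (max (1 + w / 16 * v.2.1 i) (1 - w / 8)))

lemma HT_cont {w : ℝ} (hw : 0 < w) (hw4 : w < 4) (i : Fin 3) : Continuous (HT w i) := by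
  unfold HT
  have h1 : ∀ v : VV, max (1 + w / 16 * v.2.1 i) (1 - w / 8) ≠ 0 := fun v =>
    (lt_of_lt_of_le (by linarith) (le_max_right _ _)).ne'
  have h2 : Continuous (fun v : VV => Real.log (max (1 + w / 16 * v.2.1 i) (1 - w / 8))) :=
    Continuous.log (by fun_prop) h1
  have h3 : Continuous (fun v : VV => v.1 ^ (2 - w / 8)) :=
    Continuous.rpow_const (by fun_prop) (fun _ => Or.inr (by linarith))
  have h4 : Continuous (fun v : VV => v.2.2 i ^ (w / 4 * (1 - w / 4))) :=
    Continuous.rpow_const (by fun_prop)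
      (fun _ => Or.inr (mul_nonneg (by linarith) (by linarith)))
  exact (h3.mul h4).mul ((continuous_const.mul h2).rexp)

lemma II_ident {w O a b c x y z : ℝ} (p : PhysL O a b c x y z) (hy : y = 0) (hz : z = 0) :
    ((2 - w / 8) * (2 * qv w O a b c - w) + (w / 4 * (1 - w / 4)) * (qv w O a b c + 2 * a))
        * (1 + w / 16 * a)
      - (4 * (1 - (w / 8) ^ 2)) * ((w / 16) * (-(2 - qv w O a b c) * a
        - 3 * (-(y - z) ^ 2 + x * (2 * x - y - z))))
    = 2 * (1 - w / 4) * (a + w / 4) ^ 2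
      + 8 * (1 - (w / 8) ^ 2) * (1 - w / 4) * (b - c) ^ 2 / 12 := by
  have h1 := p.two_sub_q w
  have h2 := p.con2
  subst hy hz
  have h3 : qv w O a b c = 2 - ((2 - w / 2) * O + 3 / 2 * x ^ 2) := by linarith
  have h4 : O = 1 - a ^ 2 / 4 - (b - c) ^ 2 / 12 - 3 / 4 * x ^ 2 := by linarith
  rw [h3, h4]; ring

lemma Loc.hTder {w : ℝ} {O a b c x y z : ℝ → ℝ} (h : Loc w univ O a b c x y z) {t : ℝ}
    (hO : 0 < O t) (hx : 0 < x t) (hy : y t = 0) (hz : z t = 0) (hk : 0 < 1 + w / 16 * a t) :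
    HasDerivAt (fun t => (2 - w / 8) * Real.log (O t) + (w / 4 * (1 - w / 4)) * Real.log (x t)
      - (4 * (1 - (w / 8) ^ 2)) * Real.log (1 + w / 16 * a t))
      ((2 * (1 - w / 4) * (a t + w / 4) ^ 2
      + 8 * (1 - (w / 8) ^ 2) * (1 - w / 4) * (b t - c t) ^ 2 / 12) / (1 + w / 16 * a t)) t := by
  have m := mem_univ t
  have h1 := ((h.hO t m).log hO.ne').const_mul (2 - w / 8)
  have h2 := ((h.hx t m).log hx.ne').const_mul (w / 4 * (1 - w / 4))
  have h3 := ((((h.ha t m).const_mul (w / 16)).const_add 1).log hk.ne').const_mul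
    (4 * (1 - (w / 8) ^ 2))
  refine ((h1.add h2).sub h3).congr_deriv ?_
  rw [← II_ident (h.ph t m) hy hz]
  have e1 : (2 * qv w (O t) (a t) (b t) (c t) - w) * O t / O t
    = (2 * qv w (O t) (a t) (b t) (c t) - w) := by field_simp
  have e2 : (qv w (O t) (a t) (b t) (c t) + 2 * a t) * x t / x t
    = (qv w (O t) (a t) (b t) (c t) + 2 * a t) := by field_simp
  rw [e1, e2, div_help hk.ne']

lemma II_a {O a b c x y z : ℝ} (p : PhysL O a b c x y z) (hy : y = 0) (hz : z = 0) : -2 ≤ a := by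
  have h2 := p.con2
  have h3 := p.O0
  subst hy hz
  nlinarith [sq_nonneg (b - c), sq_nonneg x]

lemma HT_eq {w : ℝ} {i : Fin 3} {v : VV} (hw : 0 < w)
    (ha : -2 ≤ v.2.1 i) (hO : 0 < v.1) (hx : 0 < v.2.2 i) :
    HT w i v = Real.exp ((2 - w / 8) * Real.log v.1 + (w / 4 * (1 - w / 4)) * Real.log (v.2.2 i)
      - (4 * (1 - (w / 8) ^ 2)) * Real.log (1 + w / 16 * v.2.1 i)) := by
  unfold HT
  have : max (1 + w / 16 * v.2.1 i) (1 - w / 8) = 1 + w / 16 * v.2.1 i := by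
    apply max_eq_left
    have := mul_le_mul_of_nonneg_left ha (by positivity : 0 ≤ w / 16)
    linarith
  rw [this, Real.rpow_def_of_pos hO, Real.rpow_def_of_pos hx,
    ← Real.exp_add, ← Real.exp_add]
  congr 1
  ring

/-- data of a type II nonvacuum orbit -/
structure OrbII (w : ℝ) (X : ℝ → VV) (i j k : Fin 3) (Y : ℝ → VV) : Prop where
  o : Orb w X Y
  d : Dist3 i j k
  O : ∀ s, 0 < (Y s).1
  x : ∀ s, 0 < (Y s).2.2 i
  y : ∀ s, (Y s).2.2 j = 0
  z : ∀ s, (Y s).2.2 k = 0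

lemma OrbII.a {i j k : Fin 3} {Y : ℝ → VV} (h : OrbII w X i j k Y) (s : ℝ) : -2 ≤ (Y s).2.1 i :=
  II_a ((h.o.loc h.d).ph s (mem_univ s)) (h.y s) (h.z s)

lemma OrbII.k {i j k : Fin 3} {Y : ℝ → VV} (C : Ctx w X) (h : OrbII w X i j k Y) (s : ℝ) :
    0 < 1 + w / 16 * (Y s).2.1 i := by
  have := mul_le_mul_of_nonneg_left (h.a s) (by have := C.w0; positivity : 0 ≤ w / 16)
  linarith [C.w4]

lemma OrbII.mono {i j k : Fin 3} {Y : ℝ → VV} (C : Ctx w X) (h : OrbII w X i j k Y) :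
    Monotone (fun s => HT w i (Y s)) := by
  have hw := C.w0
  have hw4 := C.w4
  have hm0 := mono_of_hasDeriv convex_univ
    (fun s _ => (h.o.loc h.d).hTder (h.O s) (h.x s) (h.y s) (h.z s) (h.k C s)) (by
      intro s _
      have h4 : 0 ≤ 1 - w / 4 := by linarith
      have h5 : 0 ≤ 1 - (w / 8) ^ 2 := by
        have : 1 - (w / 8) ^ 2 = (1 - w / 8) * (1 + w / 8) := by ring
        rw [this]; exact mul_nonneg (by linarith) (by linarith)
      exact div_nonneg (by positivity) (h.k C s).le)
  intro s t hst
  have := hm0 (mem_univ s) (mem_univ t) hst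
  simp only [HT_eq hw (h.a _) (h.O _) (h.x _)]
  exact Real.exp_le_exp.2 this

lemma P_solve {w O x : ℝ} (hw : 0 < w) (hw4 : w < 4)
    (h1 : O + (w / 4) ^ 2 / 4 + 3 / 4 * x ^ 2 = 1)
    (h2 : ((2 - w / 2) * O + 3 / 2 * x ^ 2) * (w / 4) = 6 * x ^ 2) :
    O = 1 - w / 16 ∧ x ^ 2 = w / 12 * (1 - w / 4) := by
  have e1 : x ^ 2 = 4 / 3 * (1 - (w / 4) ^ 2 / 4 - O) := by linarith
  rw [e1] at h2
  have e2 : (64 - w ^ 2) * (O - (1 - w / 16)) = 0 := by linear_combination 8 * h2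
  have e3 : 0 < 64 - w ^ 2 := by nlinarith
  rcases mul_eq_zero.1 e2 with h | h
  · linarith
  · have : O = 1 - w / 16 := by linarith
    refine ⟨this, ?_⟩
    rw [e1, this]; ring

lemma OrbII.const {i j k : Fin 3} {Y : ℝ → VV} (C : Ctx w X) (h : OrbII w X i j k Y) {c : ℝ}
    (hc : ∀ s, HT w i (Y s) = c) (s : ℝ) : Y s = Ppt w i := by
  have hw := C.w0
  have hw4 := C.w4
  have hl := h.o.loc h.d
  have h4 : 0 < 1 - w / 4 := by linarith
  have h5 : 0 < 1 - (w / 8) ^ 2 := by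
    have : 1 - (w / 8) ^ 2 = (1 - w / 8) * (1 + w / 8) := by ring
    rw [this]; exact mul_pos (by linarith) (by linarith)
  have hd : ∀ s, 2 * (1 - w / 4) * ((Y s).2.1 i + w / 4) ^ 2
      + 8 * (1 - (w / 8) ^ 2) * (1 - w / 4) * ((Y s).2.1 j - (Y s).2.1 k) ^ 2 / 12 = 0 := by
    intro s
    have h1 := const_deriv_zero (c := Real.log c)
      (hl.hTder (h.O s) (h.x s) (h.y s) (h.z s) (h.k C s)) (by
        intro r
        have := hc r
        rw [HT_eq hw (h.a _) (h.O _) (h.x _)] at this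
        rw [← this, Real.log_exp])
    rcases div_eq_zero_iff.1 h1 with h | h'
    · exact h
    · exact absurd h' (h.k C s).ne'
  have ha : ∀ s, (Y s).2.1 i = -(w / 4) := by
    intro s
    have h1 := hd s
    have h2 : 0 ≤ 8 * (1 - (w / 8) ^ 2) * (1 - w / 4) * ((Y s).2.1 j - (Y s).2.1 k) ^ 2 / 12 := by
      positivity
    have h3 : 0 ≤ 2 * (1 - w / 4) * ((Y s).2.1 i + w / 4) ^ 2 := by positivity
    have h6 : 2 * (1 - w / 4) * ((Y s).2.1 i + w / 4) ^ 2 = 0 := by linarith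
    rcases mul_eq_zero.1 h6 with h | h
    · linarith
    · have := (pow_eq_zero_iff two_ne_zero).1 h
      linarith
  have hu : ∀ s, (Y s).2.1 j - (Y s).2.1 k = 0 := by
    intro s
    have h1 := hd s
    rw [ha s] at h1
    have h2 : (1 - (w / 8) ^ 2) * (1 - w / 4) * ((Y s).2.1 j - (Y s).2.1 k) ^ 2 = 0 := by
      have e : 2 * (1 - w / 4) * (-(w / 4) + w / 4) ^ 2 = 0 := by ring
      linarith
    rcases mul_eq_zero.1 h2 with h | h
    · exact absurd h (mul_pos h5 h4).ne'
    · exact (pow_eq_zero_iff two_ne_zero).1 h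
  have p := hl.ph s (mem_univ s)
  have h1 := const_deriv_zero (hl.ha s (mem_univ s)) ha
  have h2 := p.con2
  rw [p.two_sub_q w, h.y s, h.z s, ha s] at h1
  rw [h.y s, h.z s, ha s, hu s] at h2
  obtain ⟨hO, hx⟩ := P_solve (O := (Y s).1) (x := (Y s).2.2 i) hw hw4 (by linarith) (by linarith)
  have hx' : (Y s).2.2 i = PN w := by
    unfold PN
    rw [← hx, Real.sqrt_sq (h.x s).le]
  have hs := p.sum
  have hb : (Y s).2.1 j = w / 8 := by linarith [ha s, hu s]
  have hcc : (Y s).2.1 k = w / 8 := by linarith [ha s, hu s]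
  refine Prod.ext hO (Prod.ext (funext ?_) (funext ?_))
  · refine h.d.all ?_ ?_ ?_
    · rw [ha s]; simp [Ppt]
    · rw [hb]; simp [Ppt, h.d.ij.symm]
    · rw [hcc]; simp [Ppt, h.d.ik.symm]
  · refine h.d.all ?_ ?_ ?_
    · rw [hx']; simp [Ppt]
    · rw [h.y]; simp [Ppt, h.d.ij.symm]
    · rw [h.z]; simp [Ppt, h.d.ik.symm]

lemma HT_ne {w : ℝ} (hw : 0 < w) (hw4 : w < 4) {i : Fin 3} {v : VV} (h : HT w i v ≠ 0) :
    v.1 ≠ 0 ∧ v.2.2 i ≠ 0 := by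
  unfold HT at h
  constructor <;> intro h0 <;> apply h <;> rw [h0]
  · rw [Real.zero_rpow (by linarith)]; ring
  · rw [Real.zero_rpow (mul_pos (by linarith) (by linarith)).ne']; ring

lemma OrbII.P_mem {i j k : Fin 3} {Y : ℝ → VV} (C : Ctx w X) (h : OrbII w X i j k Y) :
    Ppt w i ∈ AL X ∧ ∀ s, HT w i (Y s) ≤ HT w i (Ppt w i) := by
  obtain ⟨Z, c, hZ, hZO, hZc, hYc⟩ := h.o.lyap_fwd C (HT_cont C.w0 C.w4 i) (h.mono C)
  have hc : 0 < c := by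
    refine lt_of_lt_of_le ?_ (hYc 0)
    rw [HT_eq C.w0 (h.a _) (h.O _) (h.x _)]
    exact Real.exp_pos _
  have hne : HT w i (Z 0) ≠ 0 := by rw [hZc 0]; exact hc.ne'
  obtain ⟨h1, h2⟩ := HT_ne C.w0 C.w4 hne
  have hz : OrbII w X i j k Z := ⟨hZO, h.d, hZO.O_pos C h1, hZO.N_pos C h2,
    fun s => lim_zero hZ (g := fun v => v.2.2 j) (by fun_prop) h.y s,
    fun s => lim_zero hZ (g := fun v => v.2.2 k) (by fun_prop) h.z s⟩
  have := hz.const C hZc 0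
  refine ⟨by rw [← this]; exact hZO.mem 0, fun s => ?_⟩
  rw [← this, hZc 0]
  exact hYc s

end

section
variable {w : ℝ} {X : ℝ → VV}

lemma near {g : VV → ℝ} (hg : Continuous g) {v : VV} {l : ℝ} (h : l < g v) :
    ∃ ε > 0, ∀ u : VV, ‖u - v‖ ≤ ε → l ≤ g u := by
  have h1 : {u | l < g u} ∈ 𝓝 v := (isOpen_lt continuous_const hg).mem_nhds h
  obtain ⟨ε, h2, h3⟩ := Metric.mem_nhds_iff.1 h1
  refine ⟨ε / 2, by positivity, fun u hu => ?_⟩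
  have : u ∈ Metric.ball v ε := by
    rw [mem_ball_iff_norm]; linarith
  exact (h3 this).le

structure Exit (w : ℝ) (X : ℝ → VV) (v : VV) (ε : ℝ) (σ t : ℕ → ℝ) (Z : ℝ → VV) : Prop where
  hσ : Tendsto σ UF atBot
  lim : LimAlong X σ Z
  orb : Orb w X Z
  n0 : ‖Z 0 - v‖ = ε
  ns : ∀ s, 0 ≤ s → ‖Z s - v‖ ≤ ε
  tv : Tendsto (fun n => X (t n)) UF (𝓝 v)
  ev : ∀ᶠ n in UF, σ n ≤ t n ∧ t n ≤ 0 ∧ ∀ τ ∈ Icc (σ n) (t n), ‖X τ - v‖ ≤ ε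
  len : Tendsto (fun n => t n - σ n) UF atTop

lemma Ctx.exit_point (C : Ctx w X) {v : VV} (hv : v ∈ AL X) (hF : FF w v = 0)
    (hn : ¬ Tendsto X atBot (𝓝 v)) {ε₀ : ℝ} (hε₀ : 0 < ε₀) :
    ∃ ε σ t Z, 0 < ε ∧ ε ≤ ε₀ ∧ Exit w X v ε σ t Z := by
  rw [Metric.tendsto_nhds] at hn
  push Not at hn
  obtain ⟨ε₁, h1, h2⟩ := hn
  obtain ⟨t, Y, ht, hY, hYO, hY0⟩ := C.through hv
  obtain ⟨M, -, hM⟩ := C.AL_bdd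
  have hYc := const_of_equilibrium (FF_contDiff w) (fun s => hYO.sol.d s (mem_univ s))
    (fun s => hM _ (hYO.mem s)) hF hY0
  obtain ⟨M', hM'⟩ := C.bdd
  have hε : 0 < min ε₀ ε₁ := lt_min hε₀ h1
  obtain ⟨σ, h3, h4, h5⟩ := exit_back (FF_contDiff w) C.sol.d hM' (g := fun u => ‖u - v‖)
    (ε := min ε₀ ε₁) (by fun_prop) ht hY (by
      intro s
      rw [hYc s]; simpa using ⟨hε₀, h1⟩) (by
      refine h2.mono fun τ hτ => ?_
      rw [← dist_eq_norm]
      exact (min_le_right _ _).trans hτ)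
  obtain ⟨Z, hZ, hZO⟩ := C.limit h3
  have hg : Continuous (fun u : VV => ‖u - v‖) := by fun_prop
  refine ⟨min ε₀ ε₁, σ, t, Z, hε, min_le_left _ _, h3, hZ, hZO, ?_, ?_, ?_, ?_, h5⟩
  · have h6 := hZ.comp hg 0
    refine tendsto_nhds_unique h6 (tendsto_const_nhds.congr' ?_)
    filter_upwards [h4] with n hn
    rw [add_zero]; exact hn.2.1.symm
  · intro s hs
    have h6 := hZ.comp hg s
    refine le_of_tendsto h6 ?_
    filter_upwards [h4, h5.eventually (eventually_ge_atTop s)] with n hn h7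
    exact hn.2.2 _ ⟨by linarith, by linarith⟩
  · have := hY 0
    simp only [add_zero, hY0] at this
    exact this
  · filter_upwards [h4, ht.eventually (eventually_le_atBot 0)] with n hn h7
    exact ⟨hn.1, h7, hn.2.2⟩

lemma QV_cont (w : ℝ) : Continuous (QV w) := by unfold QV qv; fun_prop

lemma Exit.N_zero {v : VV} {ε : ℝ} {σ t : ℕ → ℝ} {Z : ℝ → VV} (C : Ctx w X)
    (h : Exit w X v ε σ t Z) {i : Fin 3} {l : ℝ} (hl : 0 < l)
    (hr : ∀ u : VV, ‖u - v‖ ≤ ε → l ≤ QV w u + 2 * u.2.1 i) : ∀ s, (Z s).2.2 i = 0 := by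
  obtain ⟨j, k, d⟩ := Dist3.exists_of i
  obtain ⟨B, hB0, hB⟩ := C.q_bdd
  have hL := h.orb.loc d
  have := growth_zero (f := fun s => (Z s).2.2 i) (lam := l) (M := B) hl
    (fun t _ => hL.hx t (mem_univ t)) (fun t _ => (hL.ph t (mem_univ t)).x0) (by
      intro s hs
      have := hr _ (h.ns s hs)
      rw [QV_eq d] at this
      exact mul_le_mul_of_nonneg_right this (hL.ph s (mem_univ s)).x0)
    (fun s _ => (le_abs_self _).trans (hB _ (h.orb.mem s) i j k d).2.2.2)
  exact h.orb.N_zero C this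

lemma Exit.O_zero {v : VV} {ε : ℝ} {σ t : ℕ → ℝ} {Z : ℝ → VV} (C : Ctx w X)
    (h : Exit w X v ε σ t Z) {l : ℝ} (hl : 0 < l)
    (hr : ∀ u : VV, ‖u - v‖ ≤ ε → l ≤ 2 * QV w u - w) : ∀ s, (Z s).1 = 0 := by
  obtain ⟨B, hB0, hB⟩ := C.q_bdd
  have hL := h.orb.loc d012
  have := growth_zero (f := fun s => (Z s).1) (lam := l) (M := B) hl
    (fun t _ => hL.hO t (mem_univ t)) (fun t _ => (hL.ph t (mem_univ t)).O0) (by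
      intro s hs
      have := hr _ (h.ns s hs)
      rw [QV_eq d012] at this
      exact mul_le_mul_of_nonneg_right this (hL.ph s (mem_univ s)).O0)
    (fun s _ => (le_abs_self _).trans (hB _ (h.orb.mem s) 0 1 2 d012).2.1)
  exact h.orb.O_zero C this

lemma QV_F : QV w Fpt = w / 2 := by simp [QV, qv, Fpt]

lemma FF_F : FF w Fpt = 0 := by
  unfold FF
  rw [QV_F]
  refine Prod.ext ?_ (Prod.ext (funext fun m => ?_) (funext fun m => ?_))
  · simp; left; ring
  · simp [Fpt, SV]
  · simp [Fpt]

lemma Ctx.F_case (C : Ctx w X) (hF : Fpt ∈ AL X) : ∃ v ∈ AL X, Kas v ∨ ∃ i, TL i v := by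
  have hw := C.w0
  have hn : ∀ i, ∃ ε > 0, ∀ u : VV, ‖u - Fpt‖ ≤ ε → w / 4 ≤ QV w u + 2 * u.2.1 i := fun i =>
    near (g := fun u => QV w u + 2 * u.2.1 i) ((QV_cont w).add (by fun_prop)) (by
      simp only [QV_F]; simp [Fpt]; linarith)
  choose e he hn using hn
  obtain ⟨ε, σ, t, Z, hε, hε', hE⟩ := C.exit_point hF FF_F C.notF
    (ε₀ := min (e 0) (min (e 1) (e 2))) (lt_min (he 0) (lt_min (he 1) (he 2)))
  have hle : ∀ i, ε ≤ e i := d012.all (hε'.trans (min_le_left _ _))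
    (hε'.trans ((min_le_right _ _).trans (min_le_left _ _)))
    (hε'.trans ((min_le_right _ _).trans (min_le_right _ _)))
  have hN : ∀ s i, (Z s).2.2 i = 0 := fun s i => hE.N_zero C (by linarith : 0 < w / 4)
    (fun u hu => hn i u (hu.trans (hle i))) s
  obtain ⟨Z', c, h1, h2, h3, h4⟩ := hE.orb.lyap_bwd C (H := fun v => v.1) (by fun_prop)
    (hE.orb.typeI_mono C hN)
  have hN' : ∀ s i, (Z' s).2.2 i = 0 := fun s i =>
    lim_zero h1 (g := fun v => v.2.2 i) (by fun_prop) (fun r => hN r i) s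
  rcases h2.typeI_const C hN' h3 with h | h
  · exact C.vac_pt (h2.mem 0) (by rw [h3 0, h])
  · exfalso
    have h5 : ∀ s, (Z s).1 = 1 := fun s => by
      have a1 := h4 s
      have a2 := (((hE.orb.loc d012).ph s (mem_univ s)).typeI (hN s 0) (hN s 1) (hN s 2) w).2
      linarith [h.1]
    rcases hE.orb.typeI_const C hN h5 with h6 | h6
    · norm_num at h6
    · have := hE.n0
      rw [h6.2] at this
      simp at this
      linarith

lemma PN_sq (C : Ctx w X) : PN w ^ 2 = w / 12 * (1 - w / 4) := by
  unfold PN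
  exact Real.sq_sqrt (mul_nonneg (by linarith [C.w0]) (by linarith [C.w4]))

lemma PN_pos (C : Ctx w X) : 0 < PN w := by
  unfold PN
  exact Real.sqrt_pos.2 (mul_pos (by linarith [C.w0]) (by linarith [C.w4]))

lemma QV_P (i : Fin 3) : QV w (Ppt w i) = w / 2 := by
  obtain ⟨j, k, d⟩ := Dist3.exists_of i
  rw [QV_eq d]
  simp [qv, Ppt, d.ij.symm, d.ik.symm]
  ring

lemma FF_P (C : Ctx w X) (i : Fin 3) : FF w (Ppt w i) = 0 := by
  obtain ⟨j, k, d⟩ := Dist3.exists_of i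
  have h1 := PN_sq C
  unfold FF
  rw [QV_P]
  refine Prod.ext ?_ (Prod.ext (funext ?_) (funext ?_))
  · simp; left; ring
  · refine d.all ?_ ?_ ?_
    · dsimp only
      rw [SV_eq d]; simp [Ppt, d.ij.symm, d.ik.symm]
      linear_combination (-6) * h1
    · dsimp only
      rw [SV_eq d.rot]; simp [Ppt, d.ij.symm, d.ik.symm]
      linear_combination 3 * h1
    · dsimp only
      rw [SV_eq d.rot.rot]; simp [Ppt, d.ij.symm, d.ik.symm]
      linear_combination 3 * h1
  · refine d.all ?_ ?_ ?_
    · simp [Ppt]; left; ring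
    · simp [Ppt, d.ij.symm]
    · simp [Ppt, d.ik.symm]

lemma Ctx.P_case (C : Ctx w X) {i : Fin 3} (hP : Ppt w i ∈ AL X) :
    ∃ v ∈ AL X, Kas v ∨ ∃ i, TL i v := by
  have hw := C.w0
  have hw4 := C.w4
  obtain ⟨j, k, d⟩ := Dist3.exists_of i
  have hn : ∀ m, m ≠ i → ∃ ε > 0, ∀ u : VV, ‖u - Ppt w i‖ ≤ ε → w / 4 ≤ QV w u + 2 * u.2.1 m :=
    fun m hm => near (g := fun u => QV w u + 2 * u.2.1 m) ((QV_cont w).add (by fun_prop)) (by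
      simp only [QV_P]; simp [Ppt, hm]; linarith)
  obtain ⟨e1, he1, hn1⟩ := hn j d.ij.symm
  obtain ⟨e2, he2, hn2⟩ := hn k d.ik.symm
  obtain ⟨e3, he3, hn3⟩ := near (g := fun u => u.1) (v := Ppt w i) (l := 1 / 2) (by fun_prop)
    (by simp [Ppt]; linarith)
  obtain ⟨e4, he4, hn4⟩ := near (g := fun u => u.2.2 i) (v := Ppt w i) (l := PN w / 2)
    (by fun_prop) (by simp [Ppt]; exact PN_pos C)
  obtain ⟨ε, σ, t, Z, hε, hε', hE⟩ := C.exit_point hP (FF_P C i) (C.notP i)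
    (ε₀ := min (min e1 e2) (min e3 e4)) (lt_min (lt_min he1 he2) (lt_min he3 he4))
  have l1 : ε ≤ e1 := hε'.trans ((min_le_left _ _).trans (min_le_left _ _))
  have l2 : ε ≤ e2 := hε'.trans ((min_le_left _ _).trans (min_le_right _ _))
  have l3 : ε ≤ e3 := hε'.trans ((min_le_right _ _).trans (min_le_left _ _))
  have l4 : ε ≤ e4 := hε'.trans ((min_le_right _ _).trans (min_le_right _ _))
  have hZ : OrbII w X i j k Z := by
    refine ⟨hE.orb, d, hE.orb.O_pos C (s₀ := 0) ?_, hE.orb.N_pos C (s₀ := 0) ?_, ?_, ?_⟩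
    · have := hn3 (Z 0) (hE.n0.le.trans l3)
      linarith
    · have := hn4 (Z 0) (hE.n0.le.trans l4)
      have := PN_pos C
      linarith
    · exact hE.N_zero C (by linarith : 0 < w / 4) (fun u hu => hn1 u (hu.trans l1))
    · exact hE.N_zero C (by linarith : 0 < w / 4) (fun u hu => hn2 u (hu.trans l2))
  have hPm := (hZ.P_mem C).2
  obtain ⟨Z', c, h1, h2, h3, h4⟩ := hZ.o.lyap_bwd C (HT_cont hw hw4 i) (hZ.mono C)
  have yz : ∀ s, (Z' s).2.2 j = 0 := fun s =>
    lim_zero h1 (g := fun v => v.2.2 j) (by fun_prop) hZ.y s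
  have zz : ∀ s, (Z' s).2.2 k = 0 := fun s =>
    lim_zero h1 (g := fun v => v.2.2 k) (by fun_prop) hZ.z s
  by_cases hO : (Z' 0).1 = 0
  · exact C.vac_pt (h2.mem 0) hO
  by_cases hx : (Z' 0).2.2 i = 0
  · exact C.F_case (C.typeI_F (h2.mem 0) hO (d.all hx (yz 0) (zz 0)))
  exfalso
  have hZ' : OrbII w X i j k Z' := ⟨h2, d, h2.O_pos C hO, h2.N_pos C hx, yz, zz⟩
  have h5 := hZ'.const C h3 0
  have h6 := h3 0
  rw [h5] at h6
  have h7 := hZ.const C (c := c) (fun s => le_antisymm ((hPm s).trans h6.le) (h4 s)) 0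
  have := hE.n0
  rw [h7] at this
  simp at this
  linarith

theorem Ctx.T1 (C : Ctx w X) : ∃ v ∈ AL X, Kas v ∨ ∃ i, TL i v := by
  obtain ⟨v, hv⟩ := C.AL_nonempty
  by_cases hO : v.1 = 0
  · exact C.vac_pt hv hO
  obtain ⟨t, Y, ht, -, hY, hY0⟩ := C.through hv
  have two : ∀ {i j k : Fin 3}, Dist3 i j k → v.2.2 i = 0 → v.2.2 j = 0 →
      ∃ v ∈ AL X, Kas v ∨ ∃ i, TL i v := by
    intro i j k d hi hj
    by_cases hk : v.2.2 k = 0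
    · exact C.F_case (C.typeI_F hv hO (d.all hi hj hk))
    · have : OrbII w X k i j Y := ⟨hY, d.rot.rot, hY.O_pos C (s₀ := 0) (by rwa [hY0]),
        hY.N_pos C (s₀ := 0) (by rwa [hY0]), hY.N_zero C (s₀ := 0) (by rwa [hY0]),
        hY.N_zero C (s₀ := 0) (by rwa [hY0])⟩
      exact C.P_case (this.P_mem C).1
  have one : ∀ {i j k : Fin 3}, Dist3 i j k → v.2.2 i = 0 →
      ∃ v ∈ AL X, Kas v ∨ ∃ i, TL i v := by
    intro i j k d hi
    by_cases hj : v.2.2 j = 0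
    · exact two d hi hj
    by_cases hk : v.2.2 k = 0
    · exact two d.swap hi hk
    exact (hY.no_VII C d (by rwa [hY0]) (by rwa [hY0]) (by rwa [hY0]) (by rwa [hY0])).elim
  rcases mul_eq_zero.1 (C.AL_prod hv d012) with h | h
  · rcases mul_eq_zero.1 h with h | h
    · exact one d012 h
    · exact one d012.rot h
  · exact one d012.rot.rot h

end

section
variable {w : ℝ} {X : ℝ → VV}

/-- growth of `O + x` near the Taub line -/
lemma PhysL.R_rate {w O a b c x y z l e : ℝ} (h : PhysL O a b c x y z) (hw : 0 ≤ w)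
    (he : e ≤ 1) (ha : 2 - e ≤ a) (hl1 : l ≤ (2 - e) ^ 2 - w) (hl2 : l ≤ 2) :
    l * (O + x) ≤ (2 * qv w O a b c - w) * O + (qv w O a b c + 2 * a) * x := by
  have hq := h.q_ge hw
  have h1 : (2 - e) ^ 2 ≤ a ^ 2 := pow_le_pow_left₀ (by linarith) ha 2
  have h2 : l ≤ 2 * qv w O a b c - w := by linarith
  have h3 : l ≤ qv w O a b c + 2 * a := by have := sq_nonneg a; linarith
  have h4 := mul_le_mul_of_nonneg_right h2 h.O0
  have h5 := mul_le_mul_of_nonneg_right h3 h.x0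
  linarith

lemma E_aux {O a x P u D M s q w : ℝ} (hO : 0 ≤ O) (hx : 0 ≤ x) (hP : 0 ≤ P) (hxM : x ≤ M)
    (hPM : P ≤ 2 * M) (hM : 0 ≤ M) (hw : w ≤ 4) (ha : 1 ≤ a)
    (hq : 2 - q = (2 - w / 2) * O + 3 / 2 * (D ^ 2 + x ^ 2 - 2 * x * P))
    (hs : s = 2 - a)
    (hc : s * (2 + a) = 4 * O + u ^ 2 / 3 + 3 * D ^ 2 + 3 * x ^ 2 - 6 * (x * P)) :
    -2 * (2 - q) * u ^ 2 + 18 * (q - a) * D ^ 2 + 18 * x * (u * D)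
      ≤ (3 + 14 * M) * (O + x) * (u ^ 2 + 9 * D ^ 2) := by
  have hxP : 0 ≤ x * P := mul_nonneg hx hP
  have hx2 : 0 ≤ x ^ 2 := sq_nonneg x
  have hwO : 0 ≤ (2 - w / 2) * O := mul_nonneg (by linarith) hO
  have hD2 := sq_nonneg D
  have hu2 := sq_nonneg u
  have h1 : 3 / 2 * D ^ 2 - 3 * (x * P) ≤ 2 - q := by linarith
  have h2 : s ≤ (u ^ 2 + 9 * D ^ 2) / 9 + 4 / 3 * O + x ^ 2 := by
    rcases le_or_gt s 0 with h | h
    · linarith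
    · have : s * 3 ≤ s * (2 + a) := mul_le_mul_of_nonneg_left (by linarith) h.le
      linarith
  have h3 : q - a ≤ (u ^ 2 + 9 * D ^ 2) / 9 + 4 / 3 * O + x ^ 2 - 3 / 2 * D ^ 2 + 3 * (x * P) := by
    linarith
  have h4 := mul_le_mul_of_nonneg_right h1 hu2
  have h5 := mul_le_mul_of_nonneg_right h3 hD2
  have h6 : 18 * x * (u * D) ≤ 3 * x * (u ^ 2 + 9 * D ^ 2) := by
    have := mul_nonneg hx (sq_nonneg (u - 3 * D)); linarith
  have h7 : x * P ≤ x * (2 * M) := mul_le_mul_of_nonneg_left hPM hx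
  have h8 : x ^ 2 ≤ x * M := by rw [sq]; exact mul_le_mul_of_nonneg_left hxM hx
  have hMO : 0 ≤ M * O := mul_nonneg hM hO
  have h9 : 8 / 3 * O + 2 * x ^ 2 + 6 * (x * P) + 3 * x ≤ (3 + 14 * M) * (O + x) := by linarith
  have h10 := mul_le_mul_of_nonneg_right h9 (by positivity : 0 ≤ u ^ 2 + 9 * D ^ 2)
  have h11 : 0 ≤ u ^ 2 * D ^ 2 := by positivity
  have h12 : 0 ≤ D ^ 2 * D ^ 2 := by positivity
  have h13 : 0 ≤ O * u ^ 2 := by positivity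
  have h14 : 0 ≤ x ^ 2 * u ^ 2 := by positivity
  refine le_trans ?_ h10
  linarith

lemma E_aux2 {a x u D M q : ℝ} (hx : |x| ≤ M) (hq : |q| ≤ M) (ha : |a| ≤ M) :
    |-2 * (2 - q) * u ^ 2 + 18 * (q - a) * D ^ 2 + 18 * x * (u * D)|
      ≤ (4 + 9 * M) * (u ^ 2 + 9 * D ^ 2) := by
  have hM : 0 ≤ M := (abs_nonneg x).trans hx
  have h1 : |-2 * (2 - q) * u ^ 2| ≤ (4 + 2 * M) * u ^ 2 := by
    rw [abs_mul, abs_of_nonneg (sq_nonneg u)]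
    refine mul_le_mul_of_nonneg_right ?_ (sq_nonneg u)
    rw [abs_le] at *
    constructor <;> linarith [hq.1, hq.2]
  have h2 : |18 * (q - a) * D ^ 2| ≤ 36 * M * D ^ 2 := by
    rw [abs_mul, abs_of_nonneg (sq_nonneg D)]
    refine mul_le_mul_of_nonneg_right ?_ (sq_nonneg D)
    rw [abs_le] at *
    constructor <;> linarith [hq.1, hq.2, ha.1, ha.2]
  have h3 : |18 * x * (u * D)| ≤ 3 * M * (u ^ 2 + 9 * D ^ 2) := by
    have : |18 * x * (u * D)| = 18 * |x| * |u * D| := by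
      rw [abs_mul, abs_mul]; norm_num
    rw [this]
    have h4 : 6 * |u * D| ≤ u ^ 2 + 9 * D ^ 2 := by
      rw [abs_mul]
      have := sq_nonneg (|u| - 3 * |D|)
      have e1 := sq_abs u
      have e2 := sq_abs D
      linarith
    have h5 := mul_le_mul hx h4 (by positivity) hM
    linarith
  refine (abs_add_three _ _ _).trans ?_
  have := mul_nonneg hM (sq_nonneg u)
  have := mul_nonneg hM (sq_nonneg D)
  have := sq_nonneg D
  linarith

lemma Loc.hE {w : ℝ} {S : Set ℝ} {O a b c x y z : ℝ → ℝ} (h : Loc w S O a b c x y z) {t : ℝ}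
    (ht : t ∈ S) :
    HasDerivAt (fun t => (b t - c t) ^ 2 + 9 * (y t - z t) ^ 2)
      (-2 * (2 - qv w (O t) (a t) (b t) (c t)) * (b t - c t) ^ 2
        + 18 * (qv w (O t) (a t) (b t) (c t) - a t) * (y t - z t) ^ 2
        + 18 * x t * ((b t - c t) * (y t - z t))) t := by
  refine (((h.hu ht).fun_pow 2).add (((h.hD ht).fun_pow 2).const_mul 9)).congr_deriv ?_
  push_cast
  ring

/-- coordinates of the solution are bounded -/
lemma Ctx.q_bdd0 (C : Ctx w X) : ∃ B : ℝ, 0 ≤ B ∧ ∀ t ≤ 0, ∀ i j k, Dist3 i j k →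
    |qv w (X t).1 ((X t).2.1 i) ((X t).2.1 j) ((X t).2.1 k)| ≤ B ∧ |(X t).1| ≤ B
      ∧ |(X t).2.1 i| ≤ B ∧ |(X t).2.2 i| ≤ B := by
  obtain ⟨M, hM⟩ := C.bdd
  have hM0 : 0 ≤ M := (norm_nonneg _).trans (hM 0 (le_refl (0:ℝ)))
  refine ⟨M + (w / 2 * M + M ^ 2), by have := C.w0; positivity, fun t ht i j k d => ?_⟩
  obtain ⟨h1, h2, h3⟩ := vv_coord (v := X t)
  have hv' := hM t ht
  have hw := C.w0
  have e0 : 0 ≤ w / 2 * M := by positivity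
  have e1 : 0 ≤ M ^ 2 := by positivity
  have hsq : ∀ m, ((X t).2.1 m) ^ 2 ≤ M ^ 2 := fun m => by
    rw [← sq_abs]; exact pow_le_pow_left₀ (abs_nonneg _) ((h2 m).trans hv') 2
  refine ⟨?_, by linarith, by linarith [h2 i], by linarith [h3 i]⟩
  have hp := (C.sol.ph t ht).loc d
  rw [abs_of_nonneg (hp.q_nonneg hw.le)]
  unfold qv
  have h5 : w / 2 * (X t).1 ≤ w / 2 * M :=
    mul_le_mul_of_nonneg_left ((le_abs_self _).trans (h1.trans hv')) (by positivity)
  linarith [hsq i, hsq j, hsq k]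

lemma Ctx.E_false (C : Ctx w X) {i j k : Fin 3} (d : Dist3 i j k) {e l : ℝ} (he : e ≤ 1)
    (hl : 0 < l) (hl1 : l ≤ (2 - e) ^ 2 - w) (hl2 : l ≤ 2)
    (hT : ∀ᶠ τ in atBot, 2 - e ≤ (X τ).2.1 i) {v : VV} (hv : v ∈ AL X) (hvT : TL i v) : False := by
  obtain ⟨B, hB0, hB⟩ := C.q_bdd0
  have hL := C.sol.loc d
  obtain ⟨T, hT⟩ := eventually_atBot.1 hT
  set T' := min T 0
  set K := (3 + 14 * B) / l
  have hKl : K * l = 3 + 14 * B := by simp only [K]; field_simp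
  have hT0 : ∀ t ∈ Iic T', t ∈ Iic (0:ℝ) := fun t ht => le_trans (mem_Iic.1 ht) (min_le_right _ _)
  have hanti : AntitoneOn (fun t => (((X t).2.1 j - (X t).2.1 k) ^ 2
      + 9 * ((X t).2.2 j - (X t).2.2 k) ^ 2) * Real.exp (-K * ((X t).1 + (X t).2.2 i)))
      (Iic T') := by
    refine anti_of_hasDeriv (convex_Iic _) (f' := fun t => _)
      (fun t ht => (hL.hE (hT0 t ht)).mul
        ((((hL.hO t (hT0 t ht)).add
          (hL.hx t (hT0 t ht))).const_mul (-K)).exp)) ?_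
    intro t ht
    have ht0 : t ≤ 0 := ht.trans (min_le_right _ _)
    have hp := hL.ph t ht0
    obtain ⟨-, b2, b3, b4⟩ := hB t ht0 i j k d
    obtain ⟨-, -, -, b5⟩ := hB t ht0 j k i d.rot
    obtain ⟨-, -, -, b6⟩ := hB t ht0 k i j d.rot.rot
    have ha : 2 - e ≤ (X t).2.1 i := hT t (ht.trans (min_le_left _ _))
    have hR := hp.R_rate C.w0.le he ha hl1 hl2
    have hE := E_aux (s := 2 - (X t).2.1 i) (M := B) (u := (X t).2.1 j - (X t).2.1 k) hp.O0 hp.x0 (add_nonneg hp.y0 hp.z0)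
      ((le_abs_self _).trans b4)
      (by linarith [le_abs_self ((X t).2.2 j), le_abs_self ((X t).2.2 k)]) hB0 C.w4.le
      (by linarith : 1 ≤ (X t).2.1 i) (hp.two_sub_q w) rfl (by
        linear_combination (-4) * hp.con2)
    have hK0 : 0 ≤ K := by positivity
    have h1 := mul_le_mul_of_nonneg_left hR hK0
    have h2 := mul_le_mul_of_nonneg_right h1 (by positivity :
      0 ≤ ((X t).2.1 j - (X t).2.1 k) ^ 2 + 9 * ((X t).2.2 j - (X t).2.2 k) ^ 2)
    rw [← mul_assoc, hKl] at h2
    simp only [Pi.add_apply]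
    have h3 := hE.trans h2
    set ex := Real.exp (-K * ((X t).1 + (X t).2.2 i)) with hex
    have h4 : 0 < ex := Real.exp_pos _
    have h5 := mul_le_mul_of_nonneg_right h3 h4.le
    linarith
  have hz : ∀ t ≤ T', ((X t).2.1 j - (X t).2.1 k) ^ 2
      + 9 * ((X t).2.2 j - (X t).2.2 k) ^ 2 = 0 := by
    intro t ht
    have ht0 : t ≤ 0 := ht.trans (min_le_right _ _)
    set δ := (((X t).2.1 j - (X t).2.1 k) ^ 2
      + 9 * ((X t).2.2 j - (X t).2.2 k) ^ 2) * Real.exp (-K * ((X t).1 + (X t).2.2 i)) with hδ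
    have h1 : ∀ s ≤ t, δ ≤ ((X s).2.1 j - (X s).2.1 k) ^ 2
      + 9 * ((X s).2.2 j - (X s).2.2 k) ^ 2 := by
      intro s hs
      have h2 := hanti (mem_Iic.2 (hs.trans ht)) (mem_Iic.2 ht) hs
      refine h2.trans ?_
      have hp := hL.ph s (hs.trans ht0)
      refine mul_le_of_le_one_right (by positivity) (Real.exp_le_one_iff.2 ?_)
      have hK0 : 0 ≤ K := by positivity
      have := mul_nonneg hK0 (add_nonneg hp.O0 hp.x0)
      linarith
    obtain ⟨ts, hts, htv⟩ := AL_seq hv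
    have hc : Continuous (fun u : VV => (u.2.1 j - u.2.1 k) ^ 2 + 9 * (u.2.2 j - u.2.2 k) ^ 2) := by
      fun_prop
    have h2 : δ ≤ (v.2.1 j - v.2.1 k) ^ 2 + 9 * (v.2.2 j - v.2.2 k) ^ 2 := by
      refine ge_of_tendsto ((hc.tendsto v).comp htv) ?_
      filter_upwards [hts.eventually (eventually_le_atBot t)] with n hn
      exact h1 _ hn
    have hvp := ((C.AL_phys hv).loc d).con2
    obtain ⟨e1, e2, e3⟩ := hvT
    rw [e1, e2, e3] at hvp
    have h3 : δ ≤ 0 := by linarith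
    have h4 : 0 ≤ ((X t).2.1 j - (X t).2.1 k) ^ 2
      + 9 * ((X t).2.2 j - (X t).2.2 k) ^ 2 := by positivity
    by_contra hne
    have : 0 < δ := mul_pos (lt_of_le_of_ne h4 (Ne.symm hne)) (Real.exp_pos _)
    linarith
  have hall := zero_persist (convex_Iic (0:ℝ)) (fun t ht => hL.hE ht)
    (fun t _ => by positivity) (C := 4 + 9 * B) (fun t ht => by
      obtain ⟨b1, b2, b3, b4⟩ := hB t ht i j k d
      exact E_aux2 b4 b1 b3) (t₀ := T') (mem_Iic.2 (min_le_right _ _)) (hz T' le_rfl)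
  refine C.notTaub i j k d (fun t ht => ?_)
  have h1 := hall t ht
  have h2 := sq_nonneg ((X t).2.1 j - (X t).2.1 k)
  have h3 := sq_nonneg ((X t).2.2 j - (X t).2.2 k)
  have h4 : ((X t).2.1 j - (X t).2.1 k) ^ 2 = 0 := by linarith
  have h5 : ((X t).2.2 j - (X t).2.2 k) ^ 2 = 0 := by linarith
  exact ⟨sub_eq_zero.1 (pow_eq_zero_iff two_ne_zero |>.1 h4),
    sub_eq_zero.1 (pow_eq_zero_iff two_ne_zero |>.1 h5)⟩

end

section
variable {w : ℝ} {X : ℝ → VV}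

lemma psi_low_aux {O x P D V s r q w M : ℝ} (hO : 0 ≤ O) (hx : 0 ≤ x) (hP : 0 ≤ P) (hxM : x ≤ M)
    (hPM : P ≤ 2 * M) (hw0 : 0 ≤ w) (hw : w ≤ 4) (hDP : D ^ 2 ≤ P ^ 2) (hV : |V| ≤ 2 * M)
    (hr : r ≤ 2 * M)
    (hq : 2 - q = (2 - w / 2) * O + 3 / 2 * (D ^ 2 + x ^ 2 - 2 * x * P))
    (hc : 3 * D ^ 2 - 6 * (x * P) ≤ s * (4 - s)) :
    -(2 + 5 * M + 3 * M ^ 2 + 9 * M ^ 3) * (O + x) ≤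
      s ^ 2 / 2 + (w - 2) * O - 3 / 2 * x ^ 2 + 3 * x * P + (2 - q) * V / 6 + V ^ 2 / 6
        - 3 / 2 * x * r := by
  have hM : 0 ≤ M := hx.trans hxM
  have hxP : 0 ≤ x * P := mul_nonneg hx hP
  have hD0 := sq_nonneg D
  have h1 : 9 / 16 * (D ^ 2) ^ 2 - 9 / 4 * D ^ 2 * (x * P) ≤ s ^ 2 := by
    rcases le_or_gt (D ^ 2) (4 * (x * P)) with h | h
    · have := mul_le_mul_of_nonneg_left h hD0
      have := sq_nonneg s
      linarith
    · have hs4 : 3 * D ^ 2 - 6 * (x * P) ≤ 4 * s := by have := sq_nonneg s; linarith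
      have h2 : 0 ≤ 3 / 4 * D ^ 2 - 3 / 2 * (x * P) := by linarith
      have h3 := pow_le_pow_left₀ h2 (by linarith : _ ≤ s) 2
      have := sq_nonneg (x * P)
      linarith
  have h2 : D ^ 2 * (x * P) ≤ 8 * M ^ 3 * x := by
    have e1 : D ^ 2 ≤ 4 * M ^ 2 := by
      have := pow_le_pow_left₀ hP hPM 2; linarith
    have e2 : x * P ≤ x * (2 * M) := mul_le_mul_of_nonneg_left hPM hx
    have := mul_le_mul e1 e2 hxP (by positivity)
    linarith
  have h3 : x ^ 2 ≤ M * x := by rw [sq]; exact mul_le_mul_of_nonneg_right hxM hx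
  have h4 : x * r ≤ x * (2 * M) := mul_le_mul_of_nonneg_left hr hx
  have h5 : -((2 * O + 15 / 2 * M * x) * (2 * M)) ≤ ((2 - w / 2) * O + 3 / 2 * x ^ 2 - 3 * (x * P)) * V := by
    have e2 : x * P ≤ x * (2 * M) := mul_le_mul_of_nonneg_left hPM hx
    have e1 : |((2 - w / 2) * O + 3 / 2 * x ^ 2 - 3 * (x * P)) * V| ≤
        (2 * O + 15 / 2 * M * x) * (2 * M) := by
      rw [abs_mul]
      have g1 : 0 ≤ (2 - w / 2) * O := mul_nonneg (by linarith) hO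
      have g2 : 0 ≤ w * O := mul_nonneg hw0 hO
      have g3 : 0 ≤ M * x := mul_nonneg hM hx
      have g4 := sq_nonneg x
      refine mul_le_mul ?_ hV (abs_nonneg _) (by linarith)
      rw [abs_le]; constructor <;> linarith
    exact (abs_le.1 e1).1
  have h6 : 0 ≤ w * O := mul_nonneg hw0 hO
  have h7 : (2 - q) * V = ((2 - w / 2) * O + 3 / 2 * x ^ 2 - 3 * (x * P)) * V + 3 / 2 * D ^ 2 * V := by
    rw [hq]; ring
  have h8 := sq_nonneg (V + 3 / 4 * D ^ 2)
  have g1 : 0 ≤ M * O := mul_nonneg hM hO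
  have g2 : 0 ≤ M ^ 2 * O := by positivity
  have g3 : 0 ≤ M ^ 3 * O := by positivity
  have g4 : 0 ≤ M * x := mul_nonneg hM hx
  have g5 : 0 ≤ M ^ 2 * x := by positivity
  have g6 : 0 ≤ M ^ 3 * x := by positivity
  have g7 := sq_nonneg (D ^ 2)
  rw [h7]
  linarith

lemma PhysL.psi_low {O a b c x y z w M : ℝ} (h : PhysL O a b c x y z) (hw0 : 0 ≤ w) (hw : w ≤ 4)
    (hy : 0 < y) (hz : 0 < z) (hxM : |x| ≤ M) (hyM : |y| ≤ M) (hzM : |z| ≤ M) (hbM : |b| ≤ M)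
    (hcM : |c| ≤ M) :
    -(2 + 5 * M + 3 * M ^ 2 + 9 * M ^ 3) * (O + x) ≤
      (2 * qv w O a b c - 2 * a) - 1 / 6 * ((b - c) ^ 2 - 9 * (y - z) ^ 2
        - (2 - qv w O a b c) * VL b c y z
        - VL b c y z ^ 2 + 9 * x * ((y - z) ^ 2 / (y + z))) := by
  have hP : 0 < y + z := add_pos hy hz
  have hDP : (y - z) ^ 2 ≤ (y + z) ^ 2 := by
    have := mul_pos hy hz; linarith
  have hPM : y + z ≤ 2 * M := by linarith [le_abs_self y, le_abs_self z]
  have := psi_low_aux (V := VL b c y z) (s := 2 - a) (r := (y - z) ^ 2 / (y + z)) h.O0 h.x0 hP.le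
    ((le_abs_self _).trans hxM) hPM hw0 hw hDP
    ((VL_bound hy hz).trans ((abs_sub _ _).trans (by linarith))) (by
      rw [div_le_iff₀ hP]
      have := mul_le_mul_of_nonneg_right hPM hP.le
      linarith) (h.two_sub_q w) (by
      have h1 := h.con2
      have h2 := sq_nonneg (b - c)
      have h3 := h.O0
      have h4 := sq_nonneg x
      linarith)
  refine this.trans_eq ?_
  rw [h.log_rate]
  ring

lemma TL.eqs {v : VV} {i j k : Fin 3} (d : Dist3 i j k) (hp : Phys v) (h : TL i v) :
    v.2.1 j = -1 ∧ v.2.1 k = -1 ∧ v.2.2 j = v.2.2 k := by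
  obtain ⟨e1, e2, e3⟩ := h
  have hl := hp.loc d
  have h1 := hl.con2
  have h5 := hl.sum
  rw [e1, e2, e3] at h1
  rw [e2] at h5
  have h2 := sq_nonneg (v.2.1 j - v.2.1 k)
  have h3 := sq_nonneg (v.2.2 j - v.2.2 k)
  have h4 : (v.2.1 j - v.2.1 k) ^ 2 = 0 := by linarith
  have h6 : (v.2.2 j - v.2.2 k) ^ 2 = 0 := by linarith
  have h7 := pow_eq_zero_iff two_ne_zero |>.1 h4
  have h8 := pow_eq_zero_iff two_ne_zero |>.1 h6
  exact ⟨by linarith, by linarith, by linarith⟩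

lemma TL.FF_zero {v : VV} {i j k : Fin 3} (d : Dist3 i j k) (hp : Phys v) (h : TL i v) :
    FF w v = 0 := by
  obtain ⟨h1, h2, h3⟩ := h.eqs d hp
  obtain ⟨e1, e2, e3⟩ := h
  have hq : QV w v = 2 := by
    rw [QV_eq d, qv, e1, e2, h1, h2]; norm_num
  unfold FF
  rw [hq]
  refine Prod.ext ?_ (Prod.ext (funext fun m => ?_) (funext fun m => ?_))
  · simp [e1]
  · simp only [Prod.snd_zero, Prod.fst_zero, Pi.zero_apply]
    revert m
    refine d.all (p := fun m => -(2 - 2) * v.2.1 m - 3 * SV v.2.2 m = 0) ?_ ?_ ?_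
    · rw [SV_eq d, e3, h3]; ring
    · rw [SV_eq d.rot, e3, h3]; ring
    · rw [SV_eq d.rot.rot, e3, h3]; ring
  · simp only [Prod.snd_zero, Pi.zero_apply]
    revert m
    refine d.all (p := fun m => (2 + 2 * v.2.1 m) * v.2.2 m = 0) ?_ ?_ ?_
    · rw [e3]; ring
    · rw [h1]; ring
    · rw [h2]; ring

/-- `O + x = 0` for orbits staying near the Taub line in forward time -/
lemma Orb.R_zero (C : Ctx w X) {Z : ℝ → VV} (hZ : Orb w X Z) {i j k : Fin 3} (d : Dist3 i j k)
    {e l : ℝ} (he : e ≤ 1) (hl : 0 < l) (hl1 : l ≤ (2 - e) ^ 2 - w) (hl2 : l ≤ 2)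
    (ha : ∀ s, 0 ≤ s → 2 - e ≤ (Z s).2.1 i) : (∀ s, (Z s).1 = 0) ∧ ∀ s, (Z s).2.2 i = 0 := by
  obtain ⟨B, hB0, hB⟩ := C.q_bdd
  have hL := hZ.loc d
  have h1 := growth_zero (f := fun s => (Z s).1 + (Z s).2.2 i) (f' := fun s => _) (lam := l)
    (M := B + B) hl
    (fun t _ => (hL.hO t (mem_univ t)).add (hL.hx t (mem_univ t)))
    (fun t _ => add_nonneg (hL.ph t (mem_univ t)).O0 (hL.ph t (mem_univ t)).x0)
    (fun t ht => (hL.ph t (mem_univ t)).R_rate C.w0.le he (ha t ht) hl1 hl2)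
    (fun s _ => by
      obtain ⟨-, b1, -, b2⟩ := hB _ (hZ.mem s) i j k d
      exact add_le_add ((le_abs_self _).trans b1) ((le_abs_self _).trans b2))
  have hp := hL.ph 0 (mem_univ 0)
  have h2 := hp.O0
  have h3 := hp.x0
  exact ⟨hZ.O_zero C (s₀ := 0) (by linarith), hZ.N_zero C (s₀ := 0) (by linarith)⟩

/-- an orbit with only `y` nonzero cannot run into the Taub point -/
lemma Orb.no_run (C : Ctx w X) {Z Z' : ℝ → VV} (hZ : Orb w X Z) {i j k : Fin 3} (d : Dist3 i j k)
    (hO : ∀ s, (Z s).1 = 0) (hx : ∀ s, (Z s).2.2 i = 0) (hz : ∀ s, (Z s).2.2 k = 0)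
    (ha : (Z 0).2.1 i ≠ 2) (hZ' : LimAlong Z (fun n : ℕ => (n:ℝ)) Z') (hZO : Orb w X Z')
    (hT : TL i (Z' 0)) : False := by
  obtain ⟨B, hB0, hB⟩ := C.q_bdd
  have hL := hZ.loc d
  set A0 := (Z 0).2.1 i
  set B0 := (Z 0).2.1 j
  have hf : ∀ s ∈ (univ : Set ℝ), HasDerivAt
      (fun s => (2 - (Z s).2.1 i) * (B0 + 4) - (2 - A0) * ((Z s).2.1 j + 4))
      ((-(3 / 2 * (Z s).2.2 j ^ 2)) *
        ((2 - (Z s).2.1 i) * (B0 + 4) - (2 - A0) * ((Z s).2.1 j + 4))) s := by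
    intro s hs
    refine ((((hL.ha s hs).const_sub 2).mul_const (B0 + 4)).sub
      (((hL.hb s hs).add_const 4).const_mul (2 - A0))).congr_deriv ?_
    have h1 := (hL.ph s hs).two_sub_q w
    have hO' := hO s
    have hx' := hx s
    have hz' := hz s
    rw [h1, hO', hx', hz']
    ring
  have h0 := zero_persist_lin convex_univ hf (C := 3 / 2 * B ^ 2) (fun s _ => by
    obtain ⟨-, -, -, b⟩ := hB _ (hZ.mem s) j k i d.rot
    rw [abs_neg, abs_of_nonneg (by positivity), ← sq_abs]
    have := pow_le_pow_left₀ (abs_nonneg _) b 2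
    linarith) (mem_univ (0:ℝ)) (by simp only [A0, B0]; ring)
  have hg : Continuous (fun v : VV => (2 - v.2.1 i) * (B0 + 4) - (2 - A0) * (v.2.1 j + 4)) := by
    fun_prop
  have h1 := lim_zero hZ' hg (fun s => h0 s (mem_univ s)) 0
  obtain ⟨e1, e2, e3⟩ := hT.eqs d (C.AL_phys (hZO.mem 0))
  simp only [hT.2.1, e1] at h1
  apply ha
  linarith

end

section
variable {w : ℝ} {X : ℝ → VV}

lemma Ctx.yz_grow (C : Ctx w X) {i j k : Fin 3} (d : Dist3 i j k) {e l : ℝ} (he : e ≤ 1)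
    (hl : 0 < l) (hl1 : l ≤ (2 - e) ^ 2 - w) (hl2 : l ≤ 2) : ∃ G : ℝ, 0 < G ∧
    ∀ σ ρ, σ ≤ ρ → ρ ≤ 0 → (∀ τ ∈ Icc σ ρ, 2 - e ≤ (X τ).2.1 i) →
      (X σ).2.2 j * (X σ).2.2 k ≤ G * ((X ρ).2.2 j * (X ρ).2.2 k) := by
  obtain ⟨B, hB0, hB⟩ := C.q_bdd0
  have hL := C.sol.loc d
  set C₀ := 2 + 5 * B + 3 * B ^ 2 + 9 * B ^ 3 with hC₀
  set K := C₀ / l with hK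
  have hC0 : 0 ≤ C₀ := by positivity
  have hKl : K * l = C₀ := by rw [hK]; field_simp
  have hK0 : 0 ≤ K := by positivity
  have hV : ∀ t ≤ 0, |VL ((X t).2.1 j) ((X t).2.1 k) ((X t).2.2 j) ((X t).2.2 k)| ≤ 2 * B := by
    intro t ht
    obtain ⟨-, -, b3, -⟩ := hB t ht j k i d.rot
    obtain ⟨-, -, b4, -⟩ := hB t ht k i j d.rot.rot
    refine (VL_bound (C.pos t ht j) (C.pos t ht k)).trans ((abs_sub _ _).trans ?_)
    linarith
  have hR : ∀ t ≤ 0, 0 ≤ (X t).1 + (X t).2.2 i ∧ (X t).1 + (X t).2.2 i ≤ 2 * B := by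
    intro t ht
    obtain ⟨-, b3, -, b4⟩ := hB t ht i j k d
    have hp := hL.ph t ht
    exact ⟨add_nonneg hp.O0 hp.x0, by
      linarith [le_abs_self (X t).1, le_abs_self ((X t).2.2 i)]⟩
  refine ⟨Real.exp (2 * B + 2 * B * K), Real.exp_pos _, fun σ ρ hσρ hρ ha => ?_⟩
  have hmono : MonotoneOn (fun t => (Real.log ((X t).2.2 j) + Real.log ((X t).2.2 k)
      - 1 / 6 * VL ((X t).2.1 j) ((X t).2.1 k) ((X t).2.2 j) ((X t).2.2 k))
      + K * ((X t).1 + (X t).2.2 i)) (Icc σ ρ) := by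
    refine mono_of_hasDeriv (convex_Icc _ _) (f' := fun t => _) (fun t ht =>
      ((hL.hlog (mem_Iic.2 (ht.2.trans hρ)) (C.pos t (ht.2.trans hρ) j)
        (C.pos t (ht.2.trans hρ) k)).sub
        ((hL.hV (mem_Iic.2 (ht.2.trans hρ)) (add_pos (C.pos t (ht.2.trans hρ) j)
          (C.pos t (ht.2.trans hρ) k))).const_mul (1 / 6))).add
        (((hL.hO t (mem_Iic.2 (ht.2.trans hρ))).add
          (hL.hx t (mem_Iic.2 (ht.2.trans hρ)))).const_mul K)) ?_
    intro t ht
    have ht0 := ht.2.trans hρ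
    have hp := hL.ph t (mem_Iic.2 ht0)
    obtain ⟨-, -, b1, b2⟩ := hB t ht0 i j k d
    obtain ⟨-, -, b3, b4⟩ := hB t ht0 j k i d.rot
    obtain ⟨-, -, b5, b6⟩ := hB t ht0 k i j d.rot.rot
    have h1 := hp.psi_low C.w0.le C.w4.le (C.pos t ht0 j) (C.pos t ht0 k) b2 b4 b6 b3 b5
    have h2 := mul_le_mul_of_nonneg_left (hp.R_rate C.w0.le he (ha t ht) hl1 hl2) hK0
    rw [← mul_assoc, hKl] at h2
    rw [← hC₀] at h1
    linarith
  have h1 := hmono (left_mem_Icc.2 hσρ) (right_mem_Icc.2 hσρ) hσρ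
  have hσ := hσρ.trans hρ
  have v1 := abs_le.1 (hV σ hσ)
  have v2 := abs_le.1 (hV ρ hρ)
  have r1 := hR σ hσ
  have r2 := hR ρ hρ
  have k1 := mul_nonneg hK0 r1.1
  have k2 := mul_le_mul_of_nonneg_left r2.2 hK0
  dsimp only at h1
  rw [← Real.log_mul (C.pos σ hσ j).ne' (C.pos σ hσ k).ne',
    ← Real.log_mul (C.pos ρ hρ j).ne' (C.pos ρ hρ k).ne'] at h1
  have p1 := mul_pos (C.pos σ hσ j) (C.pos σ hσ k)
  have p2 := mul_pos (C.pos ρ hρ j) (C.pos ρ hρ k)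
  rw [← Real.log_le_log_iff p1 (by positivity), Real.log_mul (Real.exp_pos _).ne' p2.ne',
    Real.log_exp]
  linarith [v1.1, v1.2, v2.1, v2.2]

lemma Ctx.lemX (C : Ctx w X) {i j k : Fin 3} (d : Dist3 i j k) {e : ℝ} (he0 : 0 < e) (he : e ≤ 1)
    (hew : w < (2 - e) ^ 2) {v : VV} (hv : v ∈ AL X) (hT : TL i v) :
    ∃ p ∈ AL X, Kas p ∧ 2 - e ≤ p.2.1 i ∧ p.2.1 i < 2 := by
  by_contra hno
  push Not at hno
  set l := min ((2 - e) ^ 2 - w) 2 with hl_def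
  have hl : 0 < l := lt_min (by linarith) (by norm_num)
  have hl1 : l ≤ (2 - e) ^ 2 - w := min_le_left _ _
  have hl2 : l ≤ 2 := min_le_right _ _
  have hfreq : ∃ᶠ τ in atBot, e ≤ 2 - (X τ).2.1 i := by
    by_contra h
    rw [not_frequently] at h
    refine C.E_false d he hl hl1 hl2 (h.mono fun τ hτ => ?_) hv hT
    push Not at hτ
    linarith
  obtain ⟨t, Y, ht, hY, hYO, hY0⟩ := C.through hv
  obtain ⟨M, -, hM⟩ := C.AL_bdd
  have hYc := const_of_equilibrium (FF_contDiff w) (fun s => hYO.sol.d s (mem_univ s))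
    (fun s => hM _ (hYO.mem s)) (hT.FF_zero d (C.AL_phys hv)) hY0
  obtain ⟨M', hM'⟩ := C.bdd
  have hg : Continuous (fun u : VV => 2 - u.2.1 i) := by fun_prop
  have hYg : ∀ s, (fun u : VV => 2 - u.2.1 i) (Y s) < e := fun s => by
    simp only [hYc s, hT.2.1]; linarith
  obtain ⟨σ, hσ, hσe, hσt⟩ := exit_back (FF_contDiff w) C.sol.d hM' hg ht hY hYg hfreq
  obtain ⟨ρ, hρ, hρe, hρt⟩ := exit_fwd (FF_contDiff w) C.sol.d hM' hg ht hY hYg hfreq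
  obtain ⟨Z, hZ, hZO⟩ := C.limit hσ
  obtain ⟨W, hW, hWO⟩ := C.limit hρ
  have hga : Continuous (fun u : VV => u.2.1 i) := by fun_prop
  -- the backward exit orbit
  have hZ0 : (Z 0).2.1 i = 2 - e := by
    have h1 := hZ.comp hga 0
    refine tendsto_nhds_unique h1 (tendsto_const_nhds.congr' ?_)
    filter_upwards [hσe] with n hn
    have := hn.2.1
    rw [add_zero]; linarith
  have hZa : ∀ s, 0 ≤ s → 2 - e ≤ (Z s).2.1 i := by
    intro s hs
    have h1 := hZ.comp hga s
    refine ge_of_tendsto h1 ?_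
    filter_upwards [hσe, hσt.eventually (eventually_ge_atTop s)] with n hn h7
    have := hn.2.2 (σ n + s) ⟨by linarith, by linarith⟩
    linarith
  obtain ⟨hZO0, hZx⟩ := hZO.R_zero C d he hl hl1 hl2 hZa
  obtain ⟨Z', hZ', hZ'O, hZ'T, hZ'a⟩ := hZO.vac_omega C hZO0 hZx
  have hTZ' : TL i (Z' 0) := by
    rcases hZ'T with h | h
    · exact h
    · have h1 := hno _ (hZ'O.mem 0) h (by have := hZ'a 0; linarith)
      have hp := (hZ'O.loc d).ph 0 (mem_univ 0)
      have h2 := (hp.vac_a (w := w) h.1 (h.2 i)).2.1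
      exact ⟨h.1, le_antisymm h2 h1, h.2 i⟩
  have hane : (Z 0).2.1 i ≠ 2 := by rw [hZ0]; linarith
  have hZy : 0 < (Z 0).2.2 j := by
    rcases ((hZO.loc d).ph 0 (mem_univ 0)).y0.lt_or_eq with h | h
    · exact h
    · exact (hZO.no_run C d.swap hZO0 hZx (hZO.N_zero C (s₀ := 0) h.symm) hane hZ' hZ'O hTZ').elim
  have hZz : 0 < (Z 0).2.2 k := by
    rcases ((hZO.loc d).ph 0 (mem_univ 0)).z0.lt_or_eq with h | h
    · exact h
    · exact (hZO.no_run C d hZO0 hZx (hZO.N_zero C (s₀ := 0) h.symm) hane hZ' hZ'O hTZ').elim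
  -- transfer to the forward exit orbit
  obtain ⟨G, hG, hgrow⟩ := C.yz_grow d he hl hl1 hl2
  have hgp : Continuous (fun u : VV => u.2.2 j * u.2.2 k) := by fun_prop
  have hle : (Z 0).2.2 j * (Z 0).2.2 k ≤ G * ((W 0).2.2 j * (W 0).2.2 k) := by
    refine le_of_tendsto_of_tendsto (hZ.comp hgp 0) ((hW.comp hgp 0).const_mul G) ?_
    filter_upwards [hσe, hρe, hρ.eventually (eventually_le_atBot 0)] with n h1 h2 h3
    simp only [add_zero]
    refine hgrow _ _ (h1.1.trans h2.1) h3 (fun τ hτ => ?_)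
    rcases le_total τ (t n) with h | h
    · have := h1.2.2 τ ⟨hτ.1, h⟩; linarith
    · have := h2.2.2 τ ⟨h, hτ.2⟩; linarith
  have hWp : (W 0).2.2 j * (W 0).2.2 k ≠ 0 := by
    intro h
    rw [h, mul_zero] at hle
    have := mul_pos hZy hZz
    linarith
  have hWy : (W 0).2.2 j ≠ 0 := left_ne_zero_of_mul hWp
  have hWz : (W 0).2.2 k ≠ 0 := right_ne_zero_of_mul hWp
  have hWx : (W 0).2.2 i = 0 := by
    have := C.AL_prod (hWO.mem 0) d
    rw [mul_assoc] at this
    exact (mul_eq_zero.1 this).resolve_right hWp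
  have hWO0 : (W 0).1 = 0 := by
    by_contra h
    exact hWO.no_VII C d hWx hWy hWz h
  have hWxs := hWO.N_zero C hWx
  have hWOs := hWO.O_zero C hWO0
  have hm := hWO.vac_mono hWOs hWxs
  have hW0 : (W 0).2.1 i = 2 - e := by
    have h1 := hW.comp hga 0
    refine tendsto_nhds_unique h1 (tendsto_const_nhds.congr' ?_)
    filter_upwards [hρe] with n hn
    have := hn.2.1
    rw [add_zero]; linarith
  have hWa : ∀ s < 0, (W s).2.1 i = 2 - e := by
    intro s hs
    refine le_antisymm (hW0 ▸ hm hs.le) ?_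
    have h1 := hW.comp hga s
    refine ge_of_tendsto h1 ?_
    filter_upwards [hρe, hρt.eventually (eventually_ge_atTop (-s))] with n hn h7
    have := hn.2.2 (ρ n + s) ⟨by linarith, by linarith⟩
    linarith
  have hWL := hWO.loc d
  have hD : ∀ s < 0, (W s).2.2 j - (W s).2.2 k = 0 := by
    intro s hs
    have h1 := const_deriv_zero_of_lt (hWL.ha s (mem_univ s)) hs hWa
    rw [((hWL.ph s (mem_univ s)).vac_a (w := w) (hWOs s) (hWxs s)).1, hWa s hs] at h1
    have h2 : ((W s).2.2 j - (W s).2.2 k) ^ 2 = 0 := by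
      rcases mul_eq_zero.1 h1 with h3 | h3
      · linarith
      · linarith
    exact pow_eq_zero_iff two_ne_zero |>.1 h2
  have h1 := const_deriv_zero_of_lt (hWL.hD (mem_univ (-1:ℝ))) (by norm_num : (-1:ℝ) < 0) hD
  have hD1 := hD (-1) (by norm_num)
  have hWa1 := hWa (-1) (by norm_num)
  rw [hD1, mul_zero, zero_add] at h1
  have hP : 0 < (W (-1)).2.2 j + (W (-1)).2.2 k :=
    add_pos (hWO.N_pos C hWy (-1)) (hWO.N_pos C hWz (-1))
  have hu := (mul_eq_zero.1 h1).resolve_right hP.ne'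
  have hcon := (hWL.ph (-1) (mem_univ _)).con2
  rw [hu, hD1, hWOs (-1), hWxs (-1), hWa1] at hcon
  have h5 : e * (4 - e) = 0 := by linarith
  rcases mul_eq_zero.1 h5 with h | h <;> linarith

end

/-- elementary facts on Kasner points -/
lemma Kas.eqs {v : VV} {i j k : Fin 3} (d : Dist3 i j k) (hp : Phys v) (h : Kas v) :
    v.2.1 i + v.2.1 j + v.2.1 k = 0 ∧
      (v.2.1 i) ^ 2 + (v.2.1 j) ^ 2 + (v.2.1 k) ^ 2 = 6 := by
  have hl := hp.loc d
  have h1 := hl.con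
  rw [h.1, h.2 i, h.2 j, h.2 k] at h1
  exact ⟨hl.sum, by linarith⟩

lemma kasner_gt {a b c : ℝ} (h1 : a + b + c = 0) (h2 : a ^ 2 + b ^ 2 + c ^ 2 = 6) (ha : a < -1) :
    -1 < b := by
  by_contra hb
  push Not at hb
  have hc : c = -a - b := by linarith
  subst hc
  nlinarith [mul_nonneg (by linarith : 0 ≤ -1 - a) (by linarith : 0 ≤ -1 - b)]

lemma kasner_ge {a b c : ℝ} (h1 : a + b + c = 0) (h2 : a ^ 2 + b ^ 2 + c ^ 2 = 6) :
    -2 ≤ a ∧ a ≤ 2 := by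
  have hc : c = -a - b := by linarith
  subst hc
  have : a ^ 2 ≤ 2 ^ 2 := by nlinarith [sq_nonneg (a + 2 * b)]
  exact ⟨by linarith [(abs_le_of_sq_le_sq' this (by norm_num)).1],
    (abs_le_of_sq_le_sq' this (by norm_num)).2⟩

lemma drift_aux {w O A x y z S q s B : ℝ} (hw0 : 0 ≤ w) (hw : w ≤ 4) (hO : 0 ≤ O) (hx : 0 ≤ x)
    (hy : 0 ≤ y) (hz : 0 ≤ z) (hS : S = x + y + z) (hSB : S ≤ 3 * B) (hA : |A| ≤ B)
    (hq : 2 - q = (2 - w / 2) * O + 3 / 2 * ((y - z) ^ 2 + x ^ 2 - 2 * x * (y + z)))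
    (hs : |s| ≤ 2 * S ^ 2) :
    |-(2 - q) * A - 3 * s| ≤ (20 * B + 5 * B ^ 2) * (O + S) := by
  have hB : 0 ≤ B := (abs_nonneg _).trans hA
  have hS0 : 0 ≤ S := by rw [hS]; positivity
  have hS2 : S ^ 2 ≤ 3 * B * S := by rw [sq]; exact mul_le_mul_of_nonneg_right hSB hS0
  have hxy := mul_nonneg hx hy
  have hyz := mul_nonneg hy hz
  have hxz := mul_nonneg hx hz
  have hwO := mul_nonneg hw0 hO
  have hwO2 : 0 ≤ (2 - w / 2) * O := mul_nonneg (by linarith) hO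
  have h1 : |2 - q| ≤ 2 * O + 9 / 2 * B * S := by
    have e1 : (x + y + z) ^ 2 ≤ 3 * B * S := by rw [← hS]; exact hS2
    have := sq_nonneg x
    have := sq_nonneg y
    have := sq_nonneg z
    have := sq_nonneg (y - z)
    rw [hq, abs_le]
    constructor <;> linarith
  have h2 : |-(2 - q) * A| ≤ (2 * O + 9 / 2 * B * S) * B := by
    rw [abs_mul, abs_neg]
    exact mul_le_mul h1 hA (abs_nonneg _) (by positivity)
  have h3 : |3 * s| ≤ 18 * B * S := by
    rw [abs_mul, abs_of_pos (by norm_num : (0:ℝ) < 3)]; linarith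
  refine (abs_sub _ _).trans ?_
  have g1 := mul_nonneg hB hO
  have g2 := mul_nonneg hB hS0
  have g3 : 0 ≤ B ^ 2 * O := by positivity
  have g4 : 0 ≤ B ^ 2 * S := by positivity
  linarith

lemma SV_bound {x y z : ℝ} (hx : 0 ≤ x) (hy : 0 ≤ y) (hz : 0 ≤ z) :
    |-(y - z) ^ 2 + x * (2 * x - y - z)| ≤ 2 * (x + y + z) ^ 2 := by
  have hxy := mul_nonneg hx hy
  have hyz := mul_nonneg hy hz
  have hxz := mul_nonneg hx hz
  have := sq_nonneg x
  have := sq_nonneg y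
  have := sq_nonneg z
  rw [abs_le]; constructor <;> linarith

section
variable {w : ℝ} {X : ℝ → VV}

lemma Kas.QV_two {v : VV} (hp : Phys v) (h : Kas v) : QV w v = 2 := by
  rw [QV_eq d012, qv, h.1]
  have := (h.eqs d012 hp).2
  linarith

lemma Kas.FF_zero {v : VV} (hp : Phys v) (h : Kas v) : FF w v = 0 := by
  unfold FF
  rw [h.QV_two hp]
  refine Prod.ext ?_ (Prod.ext (funext fun m => ?_) (funext fun m => ?_))
  · simp [h.1]
  · simp [SV, h.2]
  · simp [h.2]

/-- drift bound for any component of `A` -/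
lemma Ctx.drift (C : Ctx w X) : ∃ K : ℝ, 0 ≤ K ∧ ∀ t ≤ 0, ∀ i j k, Dist3 i j k →
    |(FF w (X t)).2.1 i| ≤ K * ((X t).1 + ((X t).2.2 i + (X t).2.2 j + (X t).2.2 k)) := by
  obtain ⟨B, hB0, hB⟩ := C.q_bdd0
  refine ⟨20 * B + 5 * B ^ 2, by positivity, fun t ht i j k d => ?_⟩
  have hp := (C.sol.ph t ht).loc d
  obtain ⟨-, -, b1, b2⟩ := hB t ht i j k d
  obtain ⟨-, -, b3, b4⟩ := hB t ht j k i d.rot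
  obtain ⟨-, -, b5, b6⟩ := hB t ht k i j d.rot.rot
  have h1 : (FF w (X t)).2.1 i = -(2 - QV w (X t)) * (X t).2.1 i - 3 * SV (X t).2.2 i := rfl
  rw [h1, QV_eq d, SV_eq d]
  exact drift_aux C.w0.le C.w4.le hp.O0 hp.x0 hp.y0 hp.z0 rfl
    (by linarith [le_abs_self ((X t).2.2 i), le_abs_self ((X t).2.2 j),
      le_abs_self ((X t).2.2 k)]) b1 (hp.two_sub_q w) (SV_bound hp.x0 hp.y0 hp.z0)

/-- the rates near a Kasner point -/
structure Rates (w : ℝ) (i j k : Fin 3) (l : ℝ) (u : VV) : Prop where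
  i : QV w u + 2 * u.2.1 i ≤ -l
  j : l ≤ QV w u + 2 * u.2.1 j
  k : l ≤ QV w u + 2 * u.2.1 k
  o : l ≤ 2 * QV w u - w

lemma Ctx.rates (C : Ctx w X) {i j k : Fin 3} (d : Dist3 i j k) {p : VV} (hp : p ∈ AL X)
    (hK : Kas p) (hpi : p.2.1 i < -1) : ∃ l > 0, ∃ ε₀ > 0, ∀ u : VV, ‖u - p‖ ≤ ε₀ →
      Rates w i j k l u := by
  have hph := C.AL_phys hp
  have hQ : QV w p = 2 := hK.QV_two hph
  have hj : -1 < p.2.1 j := kasner_gt (hK.eqs d hph).1 (hK.eqs d hph).2 hpi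
  have hk : -1 < p.2.1 k := kasner_gt (hK.eqs d.swap hph).1 (hK.eqs d.swap hph).2 hpi
  have hw := C.w4
  obtain ⟨l, l0, l1⟩ := exists_between (lt_min (lt_min (by linarith : 0 < -(2 + 2 * p.2.1 i))
    (by linarith : 0 < 2 + 2 * p.2.1 j)) (lt_min (by linarith : 0 < 2 + 2 * p.2.1 k)
    (by linarith : 0 < 4 - w)))
  simp only [lt_min_iff] at l1
  obtain ⟨⟨l1, l2⟩, l3, l4⟩ := l1
  have hQc := QV_cont w
  obtain ⟨e1, e1', h1⟩ := near (g := fun u => -(QV w u + 2 * u.2.1 i)) (by fun_prop) (v := p) (l := l)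
    (by simp only [hQ]; exact l1)
  obtain ⟨e2, e2', h2⟩ := near (g := fun u => QV w u + 2 * u.2.1 j) (by fun_prop) (v := p) (l := l)
    (by simp only [hQ]; exact l2)
  obtain ⟨e3, e3', h3⟩ := near (g := fun u => QV w u + 2 * u.2.1 k) (by fun_prop) (v := p) (l := l)
    (by simp only [hQ]; exact l3)
  obtain ⟨e4, e4', h4⟩ := near (g := fun u => 2 * QV w u - w) (by fun_prop) (v := p) (l := l)
    (by simp only [hQ]; linarith)
  refine ⟨l, l0, min (min e1 e2) (min e3 e4), lt_min (lt_min e1' e2') (lt_min e3' e4'),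
    fun u hu => ?_⟩
  simp only [le_min_iff] at hu
  obtain ⟨⟨u1, u2⟩, u3, u4⟩ := hu
  exact ⟨by have := h1 u u1; linarith, h2 u u2, h3 u u3, h4 u u4⟩

lemma Ctx.not_to_kas (C : Ctx w X) {i j k : Fin 3} (d : Dist3 i j k) {p : VV}
    (hK : Kas p) {l ε₀ : ℝ} (hl : 0 < l) (hε : 0 < ε₀)
    (hr : ∀ u : VV, ‖u - p‖ ≤ ε₀ → Rates w i j k l u) : ¬ Tendsto X atBot (𝓝 p) := by
  intro h
  have h1 : ∀ᶠ τ in atBot, ‖X τ - p‖ ≤ ε₀ := by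
    have := (Metric.tendsto_nhds.1 h) ε₀ hε
    exact this.mono fun τ hτ => by rw [← dist_eq_norm]; exact hτ.le
  obtain ⟨T, hT⟩ := eventually_atBot.1 h1
  set T' := min T 0 with hT'
  have hL := C.sol.loc d
  have hanti : AntitoneOn (fun t => (X t).2.2 i) (Iic T') := by
    refine anti_of_hasDeriv (convex_Iic _) (f' := fun t => _)
      (fun t ht => hL.hx t (mem_Iic.2 (le_trans (mem_Iic.1 ht) (min_le_right _ _)))) ?_
    intro t ht
    have ht0 : t ≤ 0 := le_trans (mem_Iic.1 ht) (min_le_right _ _)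
    have := (hr _ (hT t (le_trans (mem_Iic.1 ht) (min_le_left _ _)))).i
    rw [QV_eq d] at this
    exact mul_nonpos_of_nonpos_of_nonneg (by linarith) (C.pos t ht0 i).le
  have hc : Continuous (fun u : VV => u.2.2 i) := by fun_prop
  have h2 : (X T').2.2 i ≤ p.2.2 i := by
    refine ge_of_tendsto ((hc.tendsto p).comp h) ?_
    filter_upwards [eventually_le_atBot T'] with τ hτ
    exact hanti (mem_Iic.2 hτ) (mem_Iic.2 le_rfl) hτ
  have h3 := C.pos T' (min_le_right _ _) i
  rw [hK.2 i] at h2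
  linarith

lemma Exit.drift {p : VV} {ε l : ℝ} {σ t : ℕ → ℝ} {Z : ℝ → VV} (C : Ctx w X)
    (h : Exit w X p ε σ t Z) {i j k : Fin 3} (d : Dist3 i j k) (hl : 0 < l) (hK : Kas p)
    (hr : ∀ u : VV, ‖u - p‖ ≤ ε → Rates w i j k l u) :
    (∀ s, (Z s).1 = 0) ∧ (∀ s, (Z s).2.2 j = 0) ∧ (∀ s, (Z s).2.2 k = 0) ∧
    ∃ κ, ∀ s, 0 ≤ s → ∀ m, |(Z s).2.1 m - p.2.1 m| ≤ κ * (Z s).2.2 i := by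
  have hO := h.O_zero C hl (fun u hu => (hr u hu).o)
  have hy := h.N_zero C hl (fun u hu => (hr u hu).j)
  have hz := h.N_zero C hl (fun u hu => (hr u hu).k)
  refine ⟨hO, hy, hz, ?_⟩
  obtain ⟨K, hK0, hD⟩ := C.drift
  have hL := C.sol.loc d
  set κ := K / l with hκ
  have hκ0 : 0 ≤ κ := by positivity
  have hκl : κ * l = K := by rw [hκ]; field_simp
  refine ⟨κ, fun s hs m => ?_⟩
  have key : ∀ sg : ℝ, |sg| = 1 → sg * p.2.1 m ≤ sg * (Z s).2.1 m + κ * (Z s).2.2 i := by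
    intro sg hsg
    set H : VV → ℝ := fun u => sg * u.2.1 m - κ * (u.1 + u.2.2 j + u.2.2 k - u.2.2 i) with hH
    have hHc : Continuous H := by fun_prop
    have hle : H p ≤ H (Z s) := by
      refine le_of_tendsto_of_tendsto ((hHc.tendsto p).comp h.tv) (h.lim.comp hHc s) ?_
      filter_upwards [h.ev, h.len.eventually (eventually_ge_atTop s)] with n hn hns
      obtain ⟨n1, n2, n3⟩ := hn
      have hsub : ∀ τ ∈ Icc (σ n) (t n), τ ∈ Iic (0:ℝ) := fun τ hτ => mem_Iic.2 (hτ.2.trans n2)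
      have hAm : ∀ τ ∈ Icc (σ n) (t n), HasDerivAt (fun t => (X t).2.1 m) ((FF w (X τ)).2.1 m) τ :=
        fun τ hτ => (hasDerivAt_pi.1 (C.sol.d τ (hsub τ hτ)).snd.fst) m
      have hanti : AntitoneOn (fun τ => H (X τ)) (Icc (σ n) (t n)) := by
        refine anti_of_hasDeriv (convex_Icc _ _) (f' := fun τ => _) (fun τ hτ =>
          ((hAm τ hτ).const_mul sg).sub (((((hL.hO τ (hsub τ hτ)).add (hL.hy τ (hsub τ hτ))).add
            (hL.hz τ (hsub τ hτ))).sub (hL.hx τ (hsub τ hτ))).const_mul κ)) ?_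
        intro τ hτ
        have hR := hr _ (n3 τ hτ)
        have hp := hL.ph τ (hsub τ hτ)
        have r1 := hR.i
        have r2 := hR.j
        have r3 := hR.k
        have r4 := hR.o
        rw [QV_eq d] at r1 r2 r3 r4
        have q1 := mul_le_mul_of_nonneg_right r1 hp.x0
        have q2 := mul_le_mul_of_nonneg_right r2 hp.y0
        have q3 := mul_le_mul_of_nonneg_right r3 hp.z0
        have q4 := mul_le_mul_of_nonneg_right r4 hp.O0
        have hdm : |(FF w (X τ)).2.1 m| ≤
            K * ((X τ).1 + ((X τ).2.2 i + (X τ).2.2 j + (X τ).2.2 k)) := by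
          refine d.all (p := fun m => |(FF w (X τ)).2.1 m| ≤
            K * ((X τ).1 + ((X τ).2.2 i + (X τ).2.2 j + (X τ).2.2 k))) ?_ ?_ ?_ m
          · exact hD τ (hsub τ hτ) i j k d
          · refine (hD τ (hsub τ hτ) j k i d.rot).trans_eq (by ring)
          · refine (hD τ (hsub τ hτ) k i j d.rot.rot).trans_eq (by ring)
        have hsd : sg * (FF w (X τ)).2.1 m ≤
            K * ((X τ).1 + ((X τ).2.2 i + (X τ).2.2 j + (X τ).2.2 k)) := by
          refine le_trans (le_abs_self _) ?_
          rw [abs_mul, hsg, one_mul]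
          exact hdm
        have q5 := add_le_add (add_le_add (add_le_add q4 q2) q3) (neg_le_neg q1)
        have q6 := mul_le_mul_of_nonneg_left q5 hκ0
        have q7 : κ * (l * (X τ).1 + l * (X τ).2.2 j + l * (X τ).2.2 k + -(-l * (X τ).2.2 i))
            = K * ((X τ).1 + ((X τ).2.2 i + (X τ).2.2 j + (X τ).2.2 k)) := by rw [← hκl]; ring
        rw [q7] at q6
        linarith
      exact hanti ⟨by linarith, by linarith⟩ ⟨n1, le_rfl⟩ (by linarith)
    simp only [hH, hK.1, hK.2, hO, hy, hz] at hle
    linarith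
  have k1 := key 1 (by norm_num)
  have k2 := key (-1) (by norm_num)
  rw [abs_le]
  constructor <;> linarith

end

lemma kasner_map_aux {a b c a' b' c' A0 B0 C0 : ℝ} (h1 : a + b + c = 0)
    (h2 : a ^ 2 + b ^ 2 + c ^ 2 = 6) (h1' : a' + b' + c' = 0)
    (h2' : a' ^ 2 + b' ^ 2 + c' ^ 2 = 6) (hA : 0 < A0 + 4)
    (e1 : (a + 4) * (B0 - 2) = (A0 + 4) * (b - 2)) (e2 : (a + 4) * (C0 - 2) = (A0 + 4) * (c - 2))
    (e1' : (a' + 4) * (B0 - 2) = (A0 + 4) * (b' - 2))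
    (e2' : (a' + 4) * (C0 - 2) = (A0 + 4) * (c' - 2)) (ha : -2 ≤ a) (haa : a < a') :
    ∃ g > 1, g * (5 + 2 * a) = 3 ∧ a' = -4 + g * (a + 4) ∧ b' = 2 + g * (b - 2) ∧
      c' = 2 + g * (c - 2) := by
  have ha4 : 0 < a + 4 := by linarith
  obtain ⟨g, hg⟩ : ∃ g, g = (a' + 4) / (a + 4) := ⟨_, rfl⟩
  have hg' : g * (a + 4) = a' + 4 := by rw [hg]; field_simp
  have hg1 : 1 < g := by rw [hg, lt_div_iff₀ ha4]; linarith
  have hb : b' = 2 + g * (b - 2) := by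
    have : (A0 + 4) * (b' - 2 - g * (b - 2)) = 0 := by
      linear_combination -e1' + g * e1 - (B0 - 2) * hg'
    rcases mul_eq_zero.1 this with h | h <;> linarith
  have hc : c' = 2 + g * (c - 2) := by
    have : (A0 + 4) * (c' - 2 - g * (c - 2)) = 0 := by
      linear_combination -e2' + g * e2 - (C0 - 2) * hg'
    rcases mul_eq_zero.1 this with h | h <;> linarith
  have ha' : a' = -4 + g * (a + 4) := by linarith
  refine ⟨g, hg1, ?_, ha', hb, hc⟩
  have hcc : c = -a - b := by linarith
  rw [ha', hb, hc] at h2'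
  rw [hcc] at h2 h2'
  have : (g - 1) * (g * (5 + 2 * a) - 3) = 0 := by
    linear_combination (1/6) * h2' - (1/6) * g ^ 2 * h2
  rcases mul_eq_zero.1 this with h | h <;> linarith

section
variable {w : ℝ} {X : ℝ → VV}

lemma Orb.II_ratio (C : Ctx w X) {Z : ℝ → VV} (hZ : Orb w X Z) {i j k : Fin 3} (d : Dist3 i j k)
    (hO : ∀ s, (Z s).1 = 0) (hy : ∀ s, (Z s).2.2 j = 0) (hz : ∀ s, (Z s).2.2 k = 0) (s : ℝ) :
    ((Z s).2.1 i + 4) * ((Z 0).2.1 j - 2) - ((Z 0).2.1 i + 4) * ((Z s).2.1 j - 2) = 0 := by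
  obtain ⟨B, hB0, hB⟩ := C.q_bdd
  have hL := hZ.loc d
  set A0 := (Z 0).2.1 i
  set B0 := (Z 0).2.1 j
  have hf : ∀ s ∈ (univ : Set ℝ), HasDerivAt
      (fun s => ((Z s).2.1 i + 4) * (B0 - 2) - (A0 + 4) * ((Z s).2.1 j - 2))
      ((-(3 / 2 * (Z s).2.2 i ^ 2)) *
        (((Z s).2.1 i + 4) * (B0 - 2) - (A0 + 4) * ((Z s).2.1 j - 2))) s := by
    intro s hs
    refine ((((hL.ha s hs).add_const 4).mul_const (B0 - 2)).sub
      (((hL.hb s hs).sub_const 2).const_mul (A0 + 4))).congr_deriv ?_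
    have h1 := (hL.ph s hs).two_sub_q w
    have hO' := hO s
    have hx' := hy s
    have hz' := hz s
    rw [h1, hO', hx', hz']
    ring
  exact zero_persist_lin convex_univ hf (C := 3 / 2 * B ^ 2) (fun s _ => by
    obtain ⟨-, -, -, b⟩ := hB _ (hZ.mem s) i j k d
    rw [abs_neg, abs_of_nonneg (by positivity), ← sq_abs]
    have := pow_le_pow_left₀ (abs_nonneg _) b 2
    linarith) (mem_univ (0:ℝ)) (by simp only [A0, B0]; ring) s (mem_univ s)

lemma Orb.II_a {Z : ℝ → VV} (hZ : Orb w X Z) {i j k : Fin 3} (d : Dist3 i j k)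
    (hO : ∀ s, (Z s).1 = 0) (hy : ∀ s, (Z s).2.2 j = 0) (hz : ∀ s, (Z s).2.2 k = 0) (s : ℝ) :
    HasDerivAt (fun s => (Z s).2.1 i) (-(3 / 2 * (Z s).2.2 i ^ 2) * ((Z s).2.1 i + 4)) s := by
  have hL := hZ.loc d
  refine (hL.ha s (mem_univ s)).congr_deriv ?_
  have h1 := (hL.ph s (mem_univ s)).two_sub_q w
  have hO' := hO s
  have hx' := hy s
  have hz' := hz s
  rw [h1, hO', hx', hz']
  ring

lemma Orb.II_ge {Z : ℝ → VV} (hZ : Orb w X Z) {i j k : Fin 3} (d : Dist3 i j k)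
    (hO : ∀ s, (Z s).1 = 0) (hy : ∀ s, (Z s).2.2 j = 0) (hz : ∀ s, (Z s).2.2 k = 0) (s : ℝ) :
    -2 ≤ (Z s).2.1 i := by
  have h := ((hZ.loc d).ph s (mem_univ s)).con2
  simp only [hO, hy, hz] at h
  have h1 := sq_nonneg ((Z s).2.1 j - (Z s).2.1 k)
  have h2 := sq_nonneg ((Z s).2.2 i)
  exact (abs_le_of_sq_le_sq' (by linarith : ((Z s).2.1 i) ^ 2 ≤ 2 ^ 2) (by norm_num)).1

/-- the backward limit of a vacuum type II orbit -/
lemma Orb.II_back (C : Ctx w X) {Z : ℝ → VV} (hZ : Orb w X Z) {i j k : Fin 3} (d : Dist3 i j k)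
    (hO : ∀ s, (Z s).1 = 0) (hy : ∀ s, (Z s).2.2 j = 0) (hz : ∀ s, (Z s).2.2 k = 0) :
    ∃ p' ∈ AL X, Kas p' ∧ (∀ s, (Z s).2.1 i ≤ p'.2.1 i) ∧
      (p'.2.1 i + 4) * ((Z 0).2.1 j - 2) = ((Z 0).2.1 i + 4) * (p'.2.1 j - 2) ∧
      (p'.2.1 i + 4) * ((Z 0).2.1 k - 2) = ((Z 0).2.1 i + 4) * (p'.2.1 k - 2) := by
  have hm : MonotoneOn (fun s => -(Z s).2.1 i) univ := by
    refine mono_of_hasDeriv convex_univ (f' := fun t => _)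
      (fun t _ => (hZ.II_a d hO hy hz t).neg) (fun t _ => ?_)
    have := hZ.II_ge d hO hy hz t
    have h2 : 0 ≤ 3 / 2 * (Z t).2.2 i ^ 2 * ((Z t).2.1 i + 4) :=
      mul_nonneg (by positivity) (by linarith)
    linarith
  obtain ⟨Z', c, hl, hZ', hc, hle⟩ := hZ.lyap_bwd C (H := fun u => - u.2.1 i) (by fun_prop)
    (monotoneOn_univ.1 hm)
  have hO' := lim_zero hl (g := fun u => u.1) (by fun_prop) hO
  have hy' := lim_zero hl (g := fun u => u.2.2 j) (by fun_prop) hy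
  have hz' := lim_zero hl (g := fun u => u.2.2 k) (by fun_prop) hz
  have hx' : (Z' 0).2.2 i = 0 := by
    have h1 := const_deriv_zero (hZ'.II_a d hO' hy' hz' 0) (c := -c) (fun s => by
      have := hc s; linarith)
    have h2 := hZ'.II_ge d hO' hy' hz' 0
    rcases mul_eq_zero.1 h1 with h | h
    · have : (Z' 0).2.2 i ^ 2 = 0 := by linarith
      exact pow_eq_zero_iff (two_ne_zero) |>.1 this
    · linarith
  refine ⟨Z' 0, hZ'.mem 0, ⟨hO' 0, fun m => d.all (p := fun m => (Z' 0).2.2 m = 0)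
    hx' (hy' 0) (hz' 0) m⟩, fun s => ?_, ?_, ?_⟩
  · have h1 := hle s
    have h2 := hc 0
    linarith
  · have := lim_zero hl (g := fun u => (u.2.1 i + 4) * ((Z 0).2.1 j - 2)
      - ((Z 0).2.1 i + 4) * (u.2.1 j - 2)) (by fun_prop) (hZ.II_ratio C d hO hy hz) 0
    linarith
  · have := lim_zero hl (g := fun u => (u.2.1 i + 4) * ((Z 0).2.1 k - 2)
      - ((Z 0).2.1 i + 4) * (u.2.1 k - 2)) (by fun_prop) (hZ.II_ratio C d.swap hO hz hy) 0
    linarith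

lemma Ctx.lemK (C : Ctx w X) {i j k : Fin 3} (d : Dist3 i j k) {p : VV} (hp : p ∈ AL X)
    (hK : Kas p) (hpi : p.2.1 i < -1) : (∃ v ∈ AL X, v.2.2 i ≠ 0) ∧ ∃ p' ∈ AL X, Kas p' ∧
      ∃ g > 1, g * (5 + 2 * p.2.1 i) = 3 ∧ p'.2.1 i = -4 + g * (p.2.1 i + 4) ∧
        p'.2.1 j = 2 + g * (p.2.1 j - 2) ∧ p'.2.1 k = 2 + g * (p.2.1 k - 2) := by
  have hph := C.AL_phys hp
  obtain ⟨l, hl, ε₀, hε₀, hr⟩ := C.rates d hp hK hpi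
  obtain ⟨ε, σ, t, Z, hε, hεε, hE⟩ := C.exit_point hp (hK.FF_zero hph)
    (C.not_to_kas d hK hl hε₀ hr) hε₀
  have hr' : ∀ u : VV, ‖u - p‖ ≤ ε → Rates w i j k l u := fun u hu => hr u (hu.trans hεε)
  obtain ⟨hO, hy, hz, κ, hκ⟩ := hE.drift C d hl hK hr'
  have hZ := hE.orb
  have hL := hZ.loc d
  have hx0 : (Z 0).2.2 i ≠ 0 := by
    intro hx
    have : Z 0 = p := by
      refine Prod.ext ?_ (Prod.ext (funext fun m => ?_) (funext fun m => ?_))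
      · rw [hO, hK.1]
      · have := hκ 0 le_rfl m
        rw [hx, mul_zero] at this
        have := abs_nonpos_iff.1 this
        linarith
      · rw [hK.2 m]
        exact d.all (p := fun m => (Z 0).2.2 m = 0) hx (hy 0) (hz 0) m
    have h0 := hE.n0
    rw [this, sub_self, norm_zero] at h0
    linarith
  refine ⟨⟨Z 0, hZ.mem 0, hx0⟩, ?_⟩
  -- forward decay
  have hanti : AntitoneOn (fun s => (Z s).2.2 i * Real.exp (l * s)) (Ici 0) := by
    refine anti_of_hasDeriv (convex_Ici _) (f' := fun t => _)
      (fun t _ => hasDeriv_mul_exp l (hL.hx t (mem_univ t))) (fun t ht => ?_)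
    have h1 := (hr' _ (hE.ns t ht)).i
    rw [QV_eq d] at h1
    have h2 := mul_le_mul_of_nonneg_right h1 (hL.ph t (mem_univ t)).x0
    exact mul_nonpos_of_nonpos_of_nonneg (by linarith) (Real.exp_pos _).le
  have hx : Tendsto (fun s => (Z s).2.2 i) atTop (𝓝 0) := by
    have hexp : Tendsto (fun s : ℝ => (Z 0).2.2 i * Real.exp (-(l * s))) atTop (𝓝 0) := by
      have h1 : Tendsto (fun s : ℝ => Real.exp (-(l * s))) atTop (𝓝 0) :=
        Real.tendsto_exp_neg_atTop_nhds_zero.comp (tendsto_id.const_mul_atTop hl)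
      simpa using h1.const_mul ((Z 0).2.2 i)
    refine squeeze_zero' (Eventually.of_forall fun s => (hL.ph s (mem_univ s)).x0) ?_ hexp
    filter_upwards [eventually_ge_atTop 0] with s hs
    have h1 := hanti (mem_Ici.2 le_rfl) (mem_Ici.2 hs) hs
    simp only [mul_zero, Real.exp_zero, mul_one] at h1
    rw [Real.exp_neg, ← div_eq_mul_inv, le_div_iff₀ (Real.exp_pos _)]
    exact h1
  have hA : ∀ m, Tendsto (fun s => (Z s).2.1 m) atTop (𝓝 (p.2.1 m)) := by
    intro m
    rw [tendsto_iff_norm_sub_tendsto_zero]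
    have h1 : Tendsto (fun s => κ * (Z s).2.2 i) atTop (𝓝 0) := by simpa using hx.const_mul κ
    refine squeeze_zero' (Eventually.of_forall fun s => norm_nonneg _) ?_ h1
    filter_upwards [eventually_ge_atTop 0] with s hs
    exact hκ s hs m
  obtain ⟨p', hp', hK', hle, e1, e2⟩ := hZ.II_back C d hO hy hz
  have hrat : ∀ {j k : Fin 3}, Dist3 i j k → (∀ s, (Z s).2.2 j = 0) → (∀ s, (Z s).2.2 k = 0) →
      (p.2.1 i + 4) * ((Z 0).2.1 j - 2) = ((Z 0).2.1 i + 4) * (p.2.1 j - 2) := by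
    intro j k d hy hz
    have h1 := (((hA i).add_const 4).mul_const ((Z 0).2.1 j - 2)).sub
      (((hA j).sub_const 2).const_mul ((Z 0).2.1 i + 4))
    simp only [hZ.II_ratio C d hO hy hz] at h1
    have := tendsto_nhds_unique h1 tendsto_const_nhds
    linarith
  have f1 := hrat d hy hz
  have f2 := hrat d.swap hz hy
  have hph' := C.AL_phys hp'
  have hge := hZ.II_ge d hO hy hz
  have hantia : Antitone (fun s => (Z s).2.1 i) := by
    refine antitoneOn_univ.1 (anti_of_hasDeriv convex_univ (f' := fun t => _)
      (fun t _ => hZ.II_a d hO hy hz t) (fun t _ => ?_))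
    have h2 : 0 ≤ 3 / 2 * (Z t).2.2 i ^ 2 * ((Z t).2.1 i + 4) :=
      mul_nonneg (by positivity) (by linarith [hge t])
    linarith
  have hlow : ∀ s, p.2.1 i ≤ (Z s).2.1 i := fun s => hantia.le_of_tendsto (hA i) s
  have hlt : p.2.1 i < p'.2.1 i := by
    refine lt_of_le_of_ne ((hlow 0).trans (hle 0)) fun he => hx0 ?_
    have h1 := const_deriv_zero (hZ.II_a d hO hy hz 0) (c := p.2.1 i) (fun s =>
      le_antisymm (he ▸ hle s) (hlow s))
    rcases mul_eq_zero.1 h1 with h | h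
    · have : (Z 0).2.2 i ^ 2 = 0 := by linarith
      exact pow_eq_zero_iff (two_ne_zero) |>.1 this
    · linarith [hge 0]
  obtain ⟨s1, s2⟩ := hK.eqs d hph
  obtain ⟨s1', s2'⟩ := hK'.eqs d hph'
  exact ⟨p', hp', hK', kasner_map_aux s1 s2 s1' s2' (by linarith [hge 0]) f1 f2 e1 e2
    (kasner_ge s1 s2).1 hlt⟩

end

lemma kasner_special {a b c : ℝ} (h1 : a + b + c = 0) (h2 : a ^ 2 + b ^ 2 + c ^ 2 = 6)
    (ha : -1 ≤ a) (hb : -1 ≤ b) (hc : -1 ≤ c) :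
    (a = 2 ∧ b = -1 ∧ c = -1) ∨ (a = -1 ∧ b = 2 ∧ c = -1) ∨ (a = -1 ∧ b = -1 ∧ c = 2) := by
  have p1 := mul_nonneg (by linarith : 0 ≤ a + 1) (by linarith : 0 ≤ b + 1)
  have p2 := mul_nonneg (by linarith : 0 ≤ b + 1) (by linarith : 0 ≤ c + 1)
  have p3 := mul_nonneg (by linarith : 0 ≤ c + 1) (by linarith : 0 ≤ a + 1)
  have hs : (a + 1) * (b + 1) + (b + 1) * (c + 1) + (c + 1) * (a + 1) = 0 := by
    have hcc : c = -a - b := by linarith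
    subst hcc
    linear_combination -(1/2) * h2
  have q1 : (a + 1) * (b + 1) = 0 := by linarith
  have q2 : (b + 1) * (c + 1) = 0 := by linarith
  have q3 : (c + 1) * (a + 1) = 0 := by linarith
  rcases mul_eq_zero.1 q1 with h | h <;> rcases mul_eq_zero.1 q2 with h' | h' <;>
    rcases mul_eq_zero.1 q3 with h'' | h''
  all_goals first
    | exact Or.inl ⟨by linarith, by linarith, by linarith⟩
    | exact Or.inr (Or.inl ⟨by linarith, by linarith, by linarith⟩)
    | exact Or.inr (Or.inr ⟨by linarith, by linarith, by linarith⟩)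

lemma kasner_lt_two {a b c : ℝ} (h1 : a + b + c = 0) (h2 : a ^ 2 + b ^ 2 + c ^ 2 = 6)
    (ha : a < -1) : b < 2 := by
  refine lt_of_le_of_ne (kasner_ge (by linarith : b + a + c = 0) (by linarith)).2 ?_
  rintro rfl
  have hcc : c = -a - 2 := by linarith
  subst hcc
  have h3 : (a + 1) ^ 2 = 0 := by linarith
  have := pow_eq_zero_iff (two_ne_zero) |>.1 h3
  linarith

section
variable {w : ℝ} {X : ℝ → VV}

lemma Ctx.exists_e (C : Ctx w X) : ∃ e : ℝ, 0 < e ∧ e ≤ 1 / 2 ∧ w < (2 - e) ^ 2 := by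
  have := C.w4
  refine ⟨min (1 / 2) ((4 - w) / 8), lt_min (by norm_num) (by linarith), min_le_left _ _, ?_⟩
  have h := min_le_right (1 / 2) ((4 - w) / 8)
  have h2 := sq_nonneg (min (1 / 2) ((4 - w) / 8))
  linarith

lemma Ctx.exists_kas (C : Ctx w X) : ∃ p ∈ AL X, Kas p := by
  obtain ⟨v, hv, h | ⟨i, h⟩⟩ := C.T1
  · exact ⟨v, hv, h⟩
  · obtain ⟨e, e0, e1, e2⟩ := C.exists_e
    obtain ⟨j, k, d⟩ := Dist3.exists_of i
    obtain ⟨p, hp, hK, -⟩ := C.lemX d e0 (by linarith) e2 hv h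
    exact ⟨p, hp, hK⟩

lemma Ctx.case_special (C : Ctx w X) {i j k : Fin 3} (d : Dist3 i j k) {p : VV} (hp : p ∈ AL X)
    (hK : Kas p) (hpi : p.2.1 i = 2) (hn : ∀ q ∈ AL X, Kas q → -1 ≤ q.2.1 k) : False := by
  obtain ⟨e, e0, e1, e2⟩ := C.exists_e
  obtain ⟨q, hq, hKq, q1, q2⟩ := C.lemX d e0 (by linarith) e2 hp ⟨hK.1, hpi, hK.2 i⟩
  obtain ⟨s1, s2⟩ := hKq.eqs d (C.AL_phys hq)
  have hqk := hn q hq hKq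
  have hqj : q.2.1 j < -1 := by
    by_contra hc
    push Not at hc
    rcases kasner_special s1 s2 (by linarith) hc hqk with h | h | h
    · linarith [h.1]
    · linarith [h.1]
    · linarith [h.1]
  obtain ⟨-, q', hq', hK', g, g1, g2, r1, r2, r3⟩ := C.lemK d.rot hq hKq hqj
  obtain ⟨t1, t2⟩ := hK'.eqs d (C.AL_phys hq')
  have hj2 := (kasner_ge (by linarith : q.2.1 j + q.2.1 i + q.2.1 k = 0) (by linarith)).1
  have hk' := hn q' hq' hK'
  have m1 := mul_nonneg (by linarith : 0 ≤ g) (by linarith : 0 ≤ 2 * q.2.1 j + 4)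
  have g3 : g ≤ 3 := by linarith
  have m2 := mul_pos (by linarith : 0 < g) (by linarith : 0 < -1 - q.2.1 j)
  have m3 := mul_nonneg (by linarith : 0 ≤ g) (by linarith : 0 ≤ q.2.1 i - 3 / 2)
  have hi' : -1 < q'.2.1 i := by linarith
  have hj' : -1 < q'.2.1 j := by linarith
  rcases kasner_special t1 t2 hi'.le hj'.le hk' with h | h | h
  · linarith [h.2.1]
  · linarith [h.1]
  · linarith [h.1]

lemma Ctx.claim (C : Ctx w X) (k : Fin 3) : ∃ p ∈ AL X, Kas p ∧ p.2.1 k < -1 := by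
  by_contra hcon
  push Not at hcon
  have hcomp : IsCompact (AL X ∩ {v | Kas v}) := by
    obtain ⟨M, -, hM⟩ := C.AL_bdd
    refine (isCompact_closedBall (0:VV) M).of_isClosed_subset ((AL_closed X).inter ?_) ?_
    · have h1 : {v : VV | Kas v} = {v | v.1 = 0} ∩ ⋂ i : Fin 3, {v | v.2.2 i = 0} := by
        ext v; simp [Kas]
      rw [h1]
      refine (isClosed_eq (by fun_prop) (by fun_prop)).inter (isClosed_iInter fun i => ?_)
      exact isClosed_eq (by fun_prop) (by fun_prop)
    · intro v hv
      rw [mem_closedBall_zero_iff]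
      exact hM v hv.1
  obtain ⟨p0, hp0, hK0⟩ := C.exists_kas
  obtain ⟨p, ⟨hp, hK⟩, hmin⟩ := hcomp.exists_isMinOn ⟨p0, hp0, hK0⟩
    (f := fun v : VV => v.2.1 k) (by fun_prop)
  have hmin' : ∀ q ∈ AL X, Kas q → p.2.1 k ≤ q.2.1 k := fun q hq hKq => hmin ⟨hq, hKq⟩
  obtain ⟨i, j, d⟩ := Dist3.exists_of k
  have hK : Kas p := hK
  obtain ⟨s1, s2⟩ := hK.eqs d (C.AL_phys hp)
  have nons : ∀ {i j : Fin 3}, Dist3 i k j → p.2.1 i < -1 → False := by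
    intro i j d hi
    obtain ⟨s1, s2⟩ := hK.eqs d (C.AL_phys hp)
    obtain ⟨-, q, hq, hKq, g, g1, -, -, r, -⟩ := C.lemK d hp hK hi
    have h1 := kasner_lt_two s1 s2 hi
    have h2 := hmin' q hq hKq
    have h3 := mul_pos (by linarith : 0 < g - 1) (by linarith : 0 < 2 - p.2.1 k)
    linarith
  have hi : -1 ≤ p.2.1 i := not_lt.1 fun h => nons (d.rot.swap) h
  have hj : -1 ≤ p.2.1 j := not_lt.1 fun h => nons (d.rot.rot) h
  rcases kasner_special s1 s2 (hcon p hp hK) hi hj with h | h | h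
  · obtain ⟨e, e0, e1, e2⟩ := C.exists_e
    obtain ⟨q, hq, hKq, -, q2⟩ := C.lemX d e0 (by linarith) e2 hp ⟨hK.1, h.1, hK.2 k⟩
    have := hmin' q hq hKq
    linarith [h.1]
  · exact C.case_special d.rot hp hK h.2.1 hcon
  · exact C.case_special d.rot.rot.swap hp hK h.2.2 hcon

end

/-- the solution in symmetric variables -/
def toX (O Sp Sm n1 n2 n3 : ℝ → ℝ) (t : ℝ) : VV :=
  (O t, ![-2 * Sp t, Sp t + √3 * Sm t, Sp t - √3 * Sm t], ![n1 t, n2 t, n3 t])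

lemma sq3 : √3 * √3 = (3:ℝ) := Real.mul_self_sqrt (by norm_num)

lemma SolOn.toSol {γ : ℝ} {S : Set ℝ} {O Sp Sm n1 n2 n3 : ℝ → ℝ}
    (h : SolOn γ S O Sp Sm n1 n2 n3)
    (hIX : ∀ τ ∈ S, 0 < n1 τ ∧ 0 < n2 τ ∧ 0 < n3 τ) :
    Sol (3 * γ - 2) S (toX O Sp Sm n1 n2 n3) := by
  have h3 := sq3
  have hq : ∀ t, QV (3 * γ - 2) (toX O Sp Sm n1 n2 n3 t) = qf γ (O t) (Sp t) (Sm t) := by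
    intro t
    simp only [QV, qv, qf, toX, Matrix.cons_val_zero, Matrix.cons_val_one, Matrix.cons_val]
    linear_combination (2 / 3 * Sm t ^ 2) * h3
  refine ⟨fun t ht => ?_, fun t ht => ?_⟩
  · have hA : ∀ i, HasDerivAt (fun t => (toX O Sp Sm n1 n2 n3 t).2.1 i)
        ((FF (3 * γ - 2) (toX O Sp Sm n1 n2 n3 t)).2.1 i) t := by
      intro i
      fin_cases i
      · refine ((h.hSp t ht).const_mul (-2)).congr_deriv ?_
        simp only [FF, hq]; simp only [SV, toX, SPf, Fin.zero_eta, Matrix.cons_val_zero, Matrix.cons_val_one,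
          Matrix.cons_val]
        ring
      · refine ((h.hSp t ht).add ((h.hSm t ht).const_mul √3)).congr_deriv ?_
        simp only [FF, hq]; simp only [SV, toX, SPf, SMf, Fin.mk_one, Matrix.cons_val_zero,
          Matrix.cons_val_one, Matrix.cons_val]
        linear_combination (-(3 / 2) * (n3 t - n2 t) * (n1 t - n2 t - n3 t)) * h3
      · refine ((h.hSp t ht).sub ((h.hSm t ht).const_mul √3)).congr_deriv ?_
        simp only [FF, hq]; simp only [SV, toX, SPf, SMf, Fin.reduceFinMk, Matrix.cons_val_zero,
          Matrix.cons_val_one, Matrix.cons_val]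
        linear_combination ((3 / 2) * (n3 t - n2 t) * (n1 t - n2 t - n3 t)) * h3
    have hN : ∀ i, HasDerivAt (fun t => (toX O Sp Sm n1 n2 n3 t).2.2 i)
        ((FF (3 * γ - 2) (toX O Sp Sm n1 n2 n3 t)).2.2 i) t := by
      intro i
      fin_cases i
      · refine (h.hn1 t ht).congr_deriv ?_
        simp only [FF, hq]; simp only [toX, Fin.zero_eta, Matrix.cons_val_zero, Matrix.cons_val_one,
          Matrix.cons_val]
        ring
      · refine (h.hn2 t ht).congr_deriv ?_
        simp only [FF, hq]; simp only [toX, Fin.mk_one, Matrix.cons_val_zero,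
          Matrix.cons_val_one, Matrix.cons_val]
        ring
      · refine (h.hn3 t ht).congr_deriv ?_
        simp only [FF, hq]; simp only [toX, Fin.reduceFinMk, Matrix.cons_val_zero,
          Matrix.cons_val_one, Matrix.cons_val]
        ring
    have hOd : HasDerivAt (fun t => (toX O Sp Sm n1 n2 n3 t).1)
        ((FF (3 * γ - 2) (toX O Sp Sm n1 n2 n3 t)).1) t := by
      refine (h.hO t ht).congr_deriv ?_
      simp only [FF, hq]; rfl
    exact hOd.prodMk ((hasDerivAt_pi.2 hA).prodMk (hasDerivAt_pi.2 hN))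
  · have hc := h.hcon t ht
    obtain ⟨p1, p2, p3⟩ := hIX t ht
    unfold Constraint at hc
    refine ⟨h.hOnn t ht, p1.le, p2.le, p3.le, ?_, ?_⟩
    · simp only [toX, Matrix.cons_val_zero, Matrix.cons_val_one, Matrix.cons_val]
      ring
    · simp only [toX, Matrix.cons_val_zero, Matrix.cons_val_one, Matrix.cons_val]
      linear_combination hc + (1 / 3 * Sm t ^ 2) * h3

lemma toX_Sp (O Sp Sm n1 n2 n3 : ℝ → ℝ) (t : ℝ) :
    Sp t = -(toX O Sp Sm n1 n2 n3 t).2.1 0 / 2 := by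
  simp only [toX, Matrix.cons_val_zero]; ring

lemma toX_Sm (O Sp Sm n1 n2 n3 : ℝ → ℝ) (t : ℝ) :
    Sm t = √3 * ((toX O Sp Sm n1 n2 n3 t).2.1 1 - (toX O Sp Sm n1 n2 n3 t).2.1 2) / 6 := by
  simp only [toX, Matrix.cons_val_one, Matrix.cons_val]
  linear_combination (-(1 / 3) * Sm t) * sq3

/-- convergence in symmetric variables gives convergence in the original variables -/
lemma toX_tendsto {O Sp Sm n1 n2 n3 : ℝ → ℝ} {ι : Type*} {l : Filter ι} {t : ι → ℝ} {v : VV}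
    (h : Tendsto (fun n => toX O Sp Sm n1 n2 n3 (t n)) l (𝓝 v)) :
    Tendsto (fun n => O (t n)) l (𝓝 v.1) ∧
    Tendsto (fun n => Sp (t n)) l (𝓝 (-v.2.1 0 / 2)) ∧
    Tendsto (fun n => Sm (t n)) l (𝓝 (√3 * (v.2.1 1 - v.2.1 2) / 6)) ∧
    Tendsto (fun n => n1 (t n)) l (𝓝 (v.2.2 0)) ∧
    Tendsto (fun n => n2 (t n)) l (𝓝 (v.2.2 1)) ∧
    Tendsto (fun n => n3 (t n)) l (𝓝 (v.2.2 2)) := by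
  have key : ∀ {g : VV → ℝ}, Continuous g →
      Tendsto (fun n => g (toX O Sp Sm n1 n2 n3 (t n))) l (𝓝 (g v)) :=
    fun hg => (hg.tendsto v).comp h
  refine ⟨key (g := fun v => v.1) (by fun_prop), ?_, ?_, key (g := fun v => v.2.2 0) (by fun_prop),
    key (g := fun v => v.2.2 1) (by fun_prop), key (g := fun v => v.2.2 2) (by fun_prop)⟩
  · refine (key (g := fun v => -v.2.1 0 / 2) (by fun_prop)).congr fun n => ?_
    exact (toX_Sp O Sp Sm n1 n2 n3 (t n)).symm
  · refine (key (g := fun v => √3 * (v.2.1 1 - v.2.1 2) / 6) (by fun_prop)).congr fun n => ?_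
    exact (toX_Sm O Sp Sm n1 n2 n3 (t n)).symm

lemma PNw_pos {w : ℝ} (h0 : 0 < w) (h4 : w < 4) : 0 < PN w :=
  Real.sqrt_pos.2 (mul_pos (by linarith) (by linarith))

lemma taub_aux {γ : ℝ} {O Sp Sm n1 n2 n3 : ℝ → ℝ}
    (hgen : Generic γ (Set.Iic 0) O Sp Sm n1 n2 n3) {i j k : Fin 3} (d : Dist3 i j k)
    (h : ∀ t ≤ 0, (toX O Sp Sm n1 n2 n3 t).2.1 j = (toX O Sp Sm n1 n2 n3 t).2.1 k ∧
      (toX O Sp Sm n1 n2 n3 t).2.2 j = (toX O Sp Sm n1 n2 n3 t).2.2 k) : False := by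
  have h3 := sq3
  have h3p : (0:ℝ) < √3 := Real.sqrt_pos.2 (by norm_num)
  refine hgen.1 ?_
  have c1 : (∀ t ≤ 0, Sp t + √3 * Sm t = Sp t - √3 * Sm t ∧ n2 t = n3 t) →
      TaubType (Iic 0) Sp Sm n1 n2 n3 := by
    intro h
    refine Or.inl fun t ht => ⟨?_, (h t ht).2⟩
    have := (h t ht).1
    have h4 : √3 * Sm t = 0 := by linarith
    rcases mul_eq_zero.1 h4 with h | h
    · linarith
    · exact h
  have c2 : (∀ t ≤ 0, -2 * Sp t = Sp t + √3 * Sm t ∧ n1 t = n2 t) →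
      TaubType (Iic 0) Sp Sm n1 n2 n3 := by
    intro h
    refine Or.inr (Or.inl fun t ht => ⟨?_, (h t ht).2⟩)
    have := (h t ht).1
    linear_combination (-(1 / 3) * √3) * this - (1 / 3) * Sm t * h3
  have c3 : (∀ t ≤ 0, -2 * Sp t = Sp t - √3 * Sm t ∧ n3 t = n1 t) →
      TaubType (Iic 0) Sp Sm n1 n2 n3 := by
    intro h
    refine Or.inr (Or.inr fun t ht => ⟨?_, (h t ht).2⟩)
    have := (h t ht).1
    linear_combination ((1 / 3) * √3) * this - (1 / 3) * Sm t * h3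
  revert h
  refine d.cases (p := fun i j k => (∀ t ≤ 0,
    (toX O Sp Sm n1 n2 n3 t).2.1 j = (toX O Sp Sm n1 n2 n3 t).2.1 k ∧
      (toX O Sp Sm n1 n2 n3 t).2.2 j = (toX O Sp Sm n1 n2 n3 t).2.2 k) →
      TaubType (Iic 0) Sp Sm n1 n2 n3) ?_ ?_ ?_ ?_ ?_ ?_
  · exact fun h => c1 fun t ht => h t ht
  · exact fun h => c1 fun t ht => ⟨(h t ht).1.symm, (h t ht).2.symm⟩
  · exact fun h => c3 fun t ht => ⟨(h t ht).1, (h t ht).2.symm⟩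
  · exact fun h => c3 fun t ht => ⟨(h t ht).1.symm, (h t ht).2⟩
  · exact fun h => c2 fun t ht => h t ht
  · exact fun h => c2 fun t ht => ⟨(h t ht).1.symm, (h t ht).2.symm⟩

lemma toX_ctx {γ : ℝ} (hγ1 : 2/3 < γ) (hγ2 : γ < 2) {O Sp Sm n1 n2 n3 : ℝ → ℝ}
    (hsol : SolOn γ (Set.Iic 0) O Sp Sm n1 n2 n3)
    (hIX : ∀ τ ∈ Set.Iic (0:ℝ), 0 < n1 τ ∧ 0 < n2 τ ∧ 0 < n3 τ)
    (hgen : Generic γ (Set.Iic 0) O Sp Sm n1 n2 n3) :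
    Ctx (3 * γ - 2) (toX O Sp Sm n1 n2 n3) := by
  have hw0 : 0 < 3 * γ - 2 := by linarith
  have hw4 : 3 * γ - 2 < 4 := by linarith
  have hPN := PNw_pos hw0 hw4
  refine ⟨hw0, hw4, hsol.toSol hIX, ?_, ?_, ?_, ?_⟩
  · intro t ht i
    obtain ⟨p1, p2, p3⟩ := hIX t ht
    fin_cases i
    exacts [p1, p2, p3]
  · intro i j k d h
    exact taub_aux hgen d h
  · intro h
    obtain ⟨t1, t2, t3, t4, t5, t6⟩ := toX_tendsto (t := fun t => t) h
    simp only [Fpt, Pi.zero_apply, Prod.fst_zero, Prod.snd_zero, neg_zero, zero_div, sub_self,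
      mul_zero] at t1 t2 t3 t4 t5 t6
    exact hgen.2.1 ⟨t1, t2, t3, t4, t5, t6⟩
  · intro i h
    obtain ⟨t1, t2, t3, t4, t5, t6⟩ := toX_tendsto (t := fun t => t) h
    obtain ⟨-, -, g1, g2, g3⟩ := hgen
    fin_cases i
    · simp [Ppt] at t1 t2 t3 t4 t5 t6
      refine g1 ⟨t1, ?_, t3, ⟨_, hPN, t4⟩, t5, t6⟩
      convert t2 using 2; ring
    · simp [Ppt] at t1 t2 t3 t4 t5 t6
      refine g2 ⟨t1, ?_, ?_, t4, ⟨_, hPN, t5⟩, t6⟩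
      · convert t2 using 2; ring
      · convert t3 using 2; ring
    · simp [Ppt] at t1 t2 t3 t4 t5 t6
      refine g3 ⟨t1, ?_, ?_, t4, t5, ⟨_, hPN, t6⟩⟩
      · convert t2 using 2; ring
      · convert t3 using 2; ring

lemma kas_eq_of {u v : ℝ × ℝ} {p p' : VV} (hu : p.2.1 0 + p.2.1 1 + p.2.1 2 = 0)
    (hv : p'.2.1 0 + p'.2.1 1 + p'.2.1 2 = 0)
    (eu : u = (-p.2.1 0 / 2, √3 * (p.2.1 1 - p.2.1 2) / 6))
    (ev : v = (-p'.2.1 0 / 2, √3 * (p'.2.1 1 - p'.2.1 2) / 6)) (h : u = v) :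
    ∀ i, p.2.1 i = p'.2.1 i := by
  have h3p : (0:ℝ) < √3 := Real.sqrt_pos.2 (by norm_num)
  rw [eu, ev, Prod.mk.injEq] at h
  obtain ⟨h1, h2⟩ := h
  have h4 : √3 * ((p.2.1 1 - p.2.1 2) - (p'.2.1 1 - p'.2.1 2)) = 0 := by linarith
  have h5 : (p.2.1 1 - p.2.1 2) - (p'.2.1 1 - p'.2.1 2) = 0 := by
    rcases mul_eq_zero.1 h4 with h | h
    · linarith
    · exact h
  refine d012.all (p := fun i => p.2.1 i = p'.2.1 i) ?_ ?_ ?_ <;> linarith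

lemma kas_nonspecial {p : VV} (s1 : p.2.1 0 + p.2.1 1 + p.2.1 2 = 0)
    (s2 : p.2.1 0 ^ 2 + p.2.1 1 ^ 2 + p.2.1 2 ^ 2 = 6) {k : Fin 3} (hk : p.2.1 k < -1) :
    NonSpecialKasner (-p.2.1 0 / 2) (√3 * (p.2.1 1 - p.2.1 2) / 6) := by
  have h3 := sq3
  have h3p : (0:ℝ) < √3 := Real.sqrt_pos.2 (by norm_num)
  have hcan : ∀ r : ℝ, √3 * r = 0 → r = 0 := fun r hr => by
    rcases mul_eq_zero.1 hr with h | h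
    · linarith
    · exact h
  have hno : (∀ i, -1 ≤ p.2.1 i) → False := fun h => by linarith [h k]
  have hall : -1 ≤ p.2.1 0 → -1 ≤ p.2.1 1 → -1 ≤ p.2.1 2 → False := fun a b c =>
    hno (d012.all (p := fun i => -1 ≤ p.2.1 i) a b c)
  refine ⟨?_, ?_, ?_, ?_⟩
  · have hc : p.2.1 0 = -p.2.1 1 - p.2.1 2 := by linarith
    rw [hc] at s2 ⊢
    linear_combination (1 / 6) * s2 + (1 / 36 * (p.2.1 1 - p.2.1 2) ^ 2) * h3
  · intro h
    rw [Prod.mk.injEq] at h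
    have := hcan (p.2.1 1 - p.2.1 2) (by linarith [h.2])
    exact hall (by linarith [h.1]) (by linarith [h.1]) (by linarith [h.1])
  · intro h
    rw [Prod.mk.injEq] at h
    have := hcan (p.2.1 1 - p.2.1 2 - 3) (by linarith [h.2])
    exact hall (by linarith [h.1]) (by linarith [h.1]) (by linarith [h.1])
  · intro h
    rw [Prod.mk.injEq] at h
    have := hcan (p.2.1 1 - p.2.1 2 + 3) (by linarith [h.2])
    exact hall (by linarith [h.1]) (by linarith [h.1]) (by linarith [h.1])

lemma kas_alpha {O Sp Sm n1 n2 n3 : ℝ → ℝ} {p : VV} (hp : p ∈ AL (toX O Sp Sm n1 n2 n3))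
    (hK : Kas p) : AlphaLim O Sp Sm n1 n2 n3 0 (-p.2.1 0 / 2) (√3 * (p.2.1 1 - p.2.1 2) / 6)
      0 0 0 := by
  obtain ⟨t, ht, hX⟩ := AL_seq' hp
  have h := toX_tendsto hX
  rw [hK.1, hK.2, hK.2, hK.2] at h
  exact ⟨t, ht, h⟩

/-- no component `N_i` converges to zero if some limit point has `N_i` nonzero -/
lemma not_zero_of_AL {X : ℝ → VV} {v : VV} {i : Fin 3} (hv : v ∈ AL X) (hi : v.2.2 i ≠ 0) :
    ¬ Tendsto (fun t => (X t).2.2 i) atBot (𝓝 0) := by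
  intro h
  obtain ⟨t, ht, hX⟩ := AL_seq' hv
  have hc : Continuous (fun v : VV => v.2.2 i) := by fun_prop
  exact hi (tendsto_nhds_unique ((hc.tendsto v).comp hX) (h.comp ht))

/-- a generic Bianchi IX solution with `2/3 < γ < 2` has at least three
distinct non-special α-limit points on the Kasner circle, and none of the `Nᵢ`
converges to zero as `τ → -∞`. -/
theorem bianchiIX_generic_three_nonspecial_limit_points
    (γ : ℝ) (hγ1 : 2/3 < γ) (hγ2 : γ < 2)
    (O Sp Sm n1 n2 n3 : ℝ → ℝ)
    (hsol : SolOn γ (Set.Iic 0) O Sp Sm n1 n2 n3)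
    (hIX : ∀ τ ∈ Set.Iic (0:ℝ), 0 < n1 τ ∧ 0 < n2 τ ∧ 0 < n3 τ)
    (hgen : Generic γ (Set.Iic 0) O Sp Sm n1 n2 n3) :
    (∃ a₁ b₁ a₂ b₂ a₃ b₃ : ℝ,
      NonSpecialKasner a₁ b₁ ∧ NonSpecialKasner a₂ b₂ ∧ NonSpecialKasner a₃ b₃ ∧
      (a₁, b₁) ≠ (a₂, b₂) ∧ (a₁, b₁) ≠ (a₃, b₃) ∧ (a₂, b₂) ≠ (a₃, b₃) ∧
      AlphaLim O Sp Sm n1 n2 n3 0 a₁ b₁ 0 0 0 ∧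
      AlphaLim O Sp Sm n1 n2 n3 0 a₂ b₂ 0 0 0 ∧
      AlphaLim O Sp Sm n1 n2 n3 0 a₃ b₃ 0 0 0) ∧
    ¬ Tendsto n1 atBot (𝓝 0) ∧ ¬ Tendsto n2 atBot (𝓝 0) ∧ ¬ Tendsto n3 atBot (𝓝 0) := by
  have C := toX_ctx hγ1 hγ2 hsol hIX hgen
  have key : ∀ k : Fin 3, ∃ p ∈ AL (toX O Sp Sm n1 n2 n3), Kas p ∧ p.2.1 k < -1 := C.claim
  have hN : ∀ k : Fin 3, ¬ Tendsto (fun t => (toX O Sp Sm n1 n2 n3 t).2.2 k) atBot (𝓝 0) := by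
    intro k
    obtain ⟨p, hp, hK, hk⟩ := key k
    obtain ⟨i, j, d⟩ := Dist3.exists_of k
    obtain ⟨⟨v, hv, hvk⟩, -⟩ := C.lemK d hp hK hk
    exact not_zero_of_AL hv hvk
  refine ⟨?_, hN 0, hN 1, hN 2⟩
  obtain ⟨p, hp, hKp, h0⟩ := key 0
  obtain ⟨q, hq, hKq, h1⟩ := key 1
  obtain ⟨r, hr, hKr, h2⟩ := key 2
  obtain ⟨p1, p2⟩ := hKp.eqs d012 (C.AL_phys hp)
  obtain ⟨q1, q2⟩ := hKq.eqs d012 (C.AL_phys hq)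
  obtain ⟨r1, r2⟩ := hKr.eqs d012 (C.AL_phys hr)
  have a1 := kasner_gt p1 p2 h0
  have a2 := kasner_gt (by linarith : p.2.1 0 + p.2.1 2 + p.2.1 1 = 0) (by linarith) h0
  have a3 := kasner_gt (by linarith : q.2.1 1 + q.2.1 2 + q.2.1 0 = 0) (by linarith) h1
  refine ⟨_, _, _, _, _, _, kas_nonspecial p1 p2 h0, kas_nonspecial q1 q2 h1,
    kas_nonspecial r1 r2 h2, ?_, ?_, ?_, kas_alpha hp hKp, kas_alpha hq hKq, kas_alpha hr hKr⟩
  · intro h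
    have := kas_eq_of p1 q1 rfl rfl h 1
    linarith
  · intro h
    have := kas_eq_of p1 r1 rfl rfl h 2
    linarith
  · intro h
    have := kas_eq_of q1 r1 rfl rfl h 2
    linarith

end WainwrightHsu
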